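/- arXiv:2303.04533 — 3 statements merged into one kernel-verified Lean document; each statement's English description precedes it below -/
import Mathlib

section
/- (Reynolds transport theorem.) Let w : ℝ^d × ℝ → ℝ^d be a C¹ velocity field, let Ω₀ ⊂ ℝ^d be a bounded open set, and let x(·,t) : Ω₀ → ℝ^d be the flow of w (so ∂x/∂t(χ,t) = w(x(χ,t),t), x(χ,0) = χ) which is a diffeomorphism onto Ω(t) := x(Ω₀, t) with positive Jacobian determinant for every t ∈ [0,T). Let u : ℝ^d × ℝ → ℝ be C¹. Then for every t ∈ [0,T), d/dt ∫_{Ω(t)} u(x,t) dx = ∫_{Ω(t)} [ ∂u/∂t(x,t) + ∇_x · ( u(x,t) w(x,t) ) ] dx. -/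
open MeasureTheory

/-- Liouville's formula: if `M' = W M` at `t`, then `(det M)' = tr W * det M` at `t`. -/
theorem hasDerivAt_det_of_hasDerivAt_mul {n : Type*} [Fintype n] [DecidableEq n]
    {M : ℝ → Matrix n n ℝ} {W : Matrix n n ℝ} {t : ℝ}
    (hM : ∀ i j, HasDerivAt (fun s => M s i j) ((W * M t) i j) t) :
    HasDerivAt (fun s => (M s).det) (W.trace * (M t).det) t := by
  let f : ContinuousMultilinearMap ℝ (fun _ : n => n → ℝ) ℝ :=
    { (Matrix.detRowAlternating (n := n) (R := ℝ)).toMultilinearMap with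
      cont := Continuous.matrix_det (A := fun A : Matrix n n ℝ => A) continuous_id }
  have hrow (i : n) : HasDerivAt (fun s => M s i) ((W * M t) i) t :=
    hasDerivAt_pi.2 fun j => hM i j
  have hf := (HasFDerivAt.multilinear_comp f (g := fun i s => M s i)
    fun i => (hrow i).hasFDerivAt).hasDerivAt
  convert! hf using 1
  simp only [sum_apply, ContinuousLinearMap.comp_apply,
    ContinuousLinearMap.toSpanSingleton_apply, one_smul, Matrix.trace, Finset.sum_mul]
  refine Finset.sum_congr rfl fun i _ => ?_
  have h := Matrix.det_updateRow_sum (M t) i (W i)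
  have hmul : (W * M t) i = ∑ k, W i k • M t k := by
    ext j
    simp [Matrix.mul_apply]
  rw [← hmul] at h
  exact h.symm

/-- Differentiation under an integral over a relatively compact set, for a jointly continuous
derivative. -/
theorem hasDerivAt_setIntegral_of_continuous {α E : Type*} [TopologicalSpace α]
    [MeasurableSpace α] [OpensMeasurableSpace α] [SecondCountableTopology α]
    [NormedAddCommGroup E] [NormedSpace ℝ E] {μ : Measure α} [IsFiniteMeasureOnCompacts μ]
    {s K : Set α} (hK : IsCompact K) (hsK : s ⊆ K) (hs : MeasurableSet s)
    {F F' : ℝ → α → E} (hF : ∀ x, Continuous (F x)) (hF' : Continuous (Function.uncurry F'))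
    (hderiv : ∀ x a, HasDerivAt (F · a) (F' x a) x) (x₀ : ℝ) :
    HasDerivAt (fun x => ∫ a in s, F x a ∂μ) (∫ a in s, F' x₀ a ∂μ) x₀ := by
  have hfin : μ s ≠ ⊤ := (measure_mono hsK |>.trans_lt hK.measure_lt_top).ne
  obtain ⟨C, hC⟩ :=
    ((isCompact_Icc (a := x₀ - 1) (b := x₀ + 1)).prod hK).exists_bound_of_continuousOn
    hF'.continuousOn
  obtain ⟨B, hB⟩ := hK.exists_bound_of_continuousOn (hF x₀).continuousOn
  refine (hasDerivAt_integral_of_dominated_loc_of_deriv_le (bound := fun _ => C)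
    (Icc_mem_nhds (by linarith : x₀ - 1 < x₀) (by linarith : x₀ < x₀ + 1))
    (.of_forall fun x => (hF x).aestronglyMeasurable)
    (Measure.integrableOn_of_bounded hfin (hF x₀).aestronglyMeasurable
      (ae_restrict_of_forall_mem hs fun a ha => hB a (hsK ha)))
    (hF'.comp (Continuous.prodMk_right x₀)).aestronglyMeasurable
    (ae_restrict_of_forall_mem hs fun a ha x hx => hC (x, a) ⟨hx, hsK ha⟩)
    (integrableOn_const hfin)
    (.of_forall fun a x _ => hderiv x a)).2

section Flow

variable {E : Type*} [NormedAddCommGroup E] [NormedSpace ℝ E]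

theorem DifferentiableAt.hasDerivAt_time {F : Type*} [NormedAddCommGroup F] [NormedSpace ℝ F]
    {X : E × ℝ → F} {χ : E} {t : ℝ} (hX : DifferentiableAt ℝ X (χ, t)) :
    HasDerivAt (fun s => X (χ, s)) (fderiv ℝ X (χ, t) (0, 1)) t :=
  hX.hasFDerivAt.comp_hasDerivAt t ((hasDerivAt_const t χ).prodMk (hasDerivAt_id t))

theorem DifferentiableAt.hasDerivAt_space {F : Type*} [NormedAddCommGroup F] [NormedSpace ℝ F]
    {X : E × ℝ → F} {χ e : E} {r t : ℝ} (hX : DifferentiableAt ℝ X (χ + r • e, t)) :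
    HasDerivAt (fun r => X (χ + r • e, t)) (fderiv ℝ X (χ + r • e, t) (e, 0)) r := by
  have h : HasDerivAt (fun r : ℝ => χ + r • e) e r := by
    simpa using ((hasDerivAt_id r).smul_const e).const_add χ
  exact hX.hasFDerivAt.comp_hasDerivAt r (h.prodMk (hasDerivAt_const r t))

/-- The integral form of the first variation equation of a flow. -/
theorem fderiv_flow_eq_add_integral [CompleteSpace E] {T : ℝ} {Ω₀ : Set E} (hΩ₀ : IsOpen Ω₀)
    {w X : E × ℝ → E} (hw : ContDiff ℝ 1 w) (hX : ContDiff ℝ 1 X)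
    (hflow : ∀ χ ∈ Ω₀, ∀ t ∈ Set.Ico (0 : ℝ) T, fderiv ℝ X (χ, t) (0, 1) = w (X (χ, t), t))
    (hinit : ∀ χ ∈ Ω₀, X (χ, 0) = χ) {χ : E} (hχ : χ ∈ Ω₀) {t : ℝ} (ht : t ∈ Set.Ico (0 : ℝ) T)
    (e : E) :
    fderiv ℝ X (χ, t) (e, 0) =
      e + ∫ s in 0..t, fderiv ℝ w (X (χ, s), s) (fderiv ℝ X (χ, s) (e, 0), 0) := by
  have hXd := hX.differentiable one_ne_zero
  have hwd := hw.differentiable one_ne_zero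
  have hXc := hX.continuous
  have hwc := hw.continuous
  have hX'c := hX.continuous_fderiv one_ne_zero
  have hw'c := hw.continuous_fderiv one_ne_zero
  have hXint : ∀ η ∈ Ω₀, X (η, t) = η + ∫ s in Set.Ioc 0 t, w (X (η, s), s) := by
    intro η hη
    rw [← intervalIntegral.integral_of_le ht.1,
      intervalIntegral.integral_eq_sub_of_hasDerivAt (f := fun s => X (η, s)), hinit η hη]
    · abel
    · intro s hs
      rw [Set.uIcc_of_le ht.1] at hs
      rw [← hflow η hη s ⟨hs.1, hs.2.trans_lt ht.2⟩]
      exact (hXd _).hasDerivAt_time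
    · exact Continuous.intervalIntegrable (by fun_prop) _ _
  have hderiv := hasDerivAt_setIntegral_of_continuous (μ := volume) isCompact_Icc
    (Set.Ioc_subset_Icc_self (a := 0) (b := t)) measurableSet_Ioc
    (F := fun r s => w (X (χ + r • e, s), s))
    (F' := fun r s =>
      fderiv ℝ w (X (χ + r • e, s), s) (fderiv ℝ X (χ + r • e, s) (e, 0), 0))
    (fun r => by fun_prop) (by unfold Function.uncurry; fun_prop)
    (fun r s => (hwd _).hasFDerivAt.comp_hasDerivAt r
      ((hXd _).hasDerivAt_space.prodMk (hasDerivAt_const r s))) 0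
  have hline : HasDerivAt (fun r : ℝ => χ + r • e) e 0 := by
    simpa using ((hasDerivAt_id (0 : ℝ)).smul_const e).const_add χ
  have hnear : ∀ᶠ r in nhds (0 : ℝ), χ + r • e ∈ Ω₀ :=
    hline.continuousAt.eventually_mem (hΩ₀.mem_nhds (by simpa using hχ))
  have hd₁ := (hline.add hderiv).congr_of_eventuallyEq
    (hnear.mono fun r hr => hXint _ hr)
  have hd₂ := (hXd (χ + (0 : ℝ) • e, t)).hasDerivAt_space
  have h := hd₂.unique hd₁
  rw [intervalIntegral.integral_of_le ht.1]
  simpa using h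

end Flow

theorem ContinuousLinearMap.apply_prodMk_zero_eq_sum {ι F : Type*} [Fintype ι] [DecidableEq ι]
    [NormedAddCommGroup F] [NormedSpace ℝ F] (L : (ι → ℝ) × ℝ →L[ℝ] F) (v : ι → ℝ) :
    L (v, 0) = ∑ k, v k • L (Pi.single k 1, 0) := by
  have h := congrArg (L.comp (ContinuousLinearMap.inl ℝ (ι → ℝ) ℝ)) (pi_eq_sum_univ' v)
  simpa [← Pi.single_apply, map_sum] using h

/-- The Jacobian of a flow agrees on `[0, T)` with a function of time satisfying Liouville's
equation, also at the initial time. -/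
theorem exists_hasDerivAt_flow_det {d : ℕ} {T : ℝ} {Ω₀ : Set (Fin d → ℝ)} (hΩ₀ : IsOpen Ω₀)
    {w X : (Fin d → ℝ) × ℝ → (Fin d → ℝ)} (hw : ContDiff ℝ 1 w) (hX : ContDiff ℝ 1 X)
    (hflow : ∀ χ ∈ Ω₀, ∀ t ∈ Set.Ico (0 : ℝ) T, fderiv ℝ X (χ, t) (0, 1) = w (X (χ, t), t))
    (hinit : ∀ χ ∈ Ω₀, X (χ, 0) = χ) {χ : Fin d → ℝ} (hχ : χ ∈ Ω₀) :
    ∃ J : ℝ → ℝ, ∀ t ∈ Set.Ico (0 : ℝ) T,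
      J t = (Matrix.of fun i j => fderiv ℝ X (χ, t) (Pi.single j 1, 0) i).det ∧
      HasDerivAt J ((∑ i, fderiv ℝ w (X (χ, t), t) (Pi.single i 1, 0) i) * J t) t := by
  have hXc := hX.continuous
  have hX'c := hX.continuous_fderiv one_ne_zero
  have hw'c := hw.continuous_fderiv one_ne_zero
  let A : Fin d → ℝ → Fin d → ℝ := fun j s =>
    fderiv ℝ w (X (χ, s), s) (fderiv ℝ X (χ, s) (Pi.single j 1, 0), 0)
  have hA (j) : Continuous (A j) := by fun_prop
  let N : ℝ → Matrix (Fin d) (Fin d) ℝ := fun t =>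
    Matrix.of fun i j => ((Pi.single j 1 : Fin d → ℝ) + ∫ s in 0..t, A j s) i
  have hN : ∀ t ∈ Set.Ico (0 : ℝ) T,
      N t = Matrix.of fun i j => fderiv ℝ X (χ, t) (Pi.single j 1, 0) i := by
    intro t ht
    ext i j
    simp only [N, A, Matrix.of_apply, fderiv_flow_eq_add_integral hΩ₀ hw hX hflow hinit hχ ht]
  refine ⟨fun t => (N t).det, fun t ht => ⟨congrArg _ (hN t ht), ?_⟩⟩
  refine hasDerivAt_det_of_hasDerivAt_mul
    (W := Matrix.of fun i k => fderiv ℝ w (X (χ, t), t) (Pi.single k 1, 0) i) fun i j => ?_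
  have hj : HasDerivAt (fun s => (Pi.single j 1 : Fin d → ℝ) + ∫ r in 0..s, A j r) (A j t) t :=
    ((hA j).integral_hasStrictDerivAt 0 t).hasDerivAt.const_add _
  convert! hasDerivAt_pi.1 hj i using 1
  rw [hN t ht]
  simp only [Matrix.mul_apply, Matrix.of_apply, A]
  rw [ContinuousLinearMap.apply_prodMk_zero_eq_sum (fderiv ℝ w _), Finset.sum_apply]
  exact Finset.sum_congr rfl fun k _ => mul_comm _ _

theorem ContinuousLinearMap.det_eq_det_of {d : ℕ} (L : (Fin d → ℝ) →L[ℝ] (Fin d → ℝ)) :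
    L.det = (Matrix.of fun i j => L (Pi.single j 1) i).det := by
  rw [ContinuousLinearMap.det, ← LinearMap.det_toMatrix']
  congr 1

theorem hasFDerivAt_slice {E F : Type*} [NormedAddCommGroup E] [NormedSpace ℝ E]
    [NormedAddCommGroup F] [NormedSpace ℝ F] {f : E × ℝ → F} {x : E} {t : ℝ}
    (hf : DifferentiableAt ℝ f (x, t)) :
    HasFDerivAt (fun y => f (y, t))
      ((fderiv ℝ f (x, t)).comp (ContinuousLinearMap.inl ℝ E ℝ)) x :=
  hf.hasFDerivAt.comp x (hasFDerivAt_prodMk_left x t)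

/-- **Reynolds transport theorem.**
Let `w : ℝ^d × ℝ → ℝ^d` be a `C¹` velocity field, `Ω₀ ⊂ ℝ^d` bounded open, and let
`X` be the flow of `w` (`∂X/∂t(χ,t) = w(X(χ,t),t)`, `X(χ,0) = χ`), a diffeomorphism
of `Ω₀` onto `Ω(t) = X(Ω₀,t)` with positive Jacobian determinant for `t ∈ [0,T)`.
Let `u : ℝ^d × ℝ → ℝ` be `C¹`, with `u, w` and their first derivatives bounded.
Then for every `t ∈ [0,T)`,
`d/dt ∫_{Ω(t)} u dx = ∫_{Ω(t)} [∂u/∂t + ∇ₓ·(u w)] dx`. -/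
theorem reynolds_transport (d : ℕ) (T : ℝ) (hT : 0 < T)
    (Ω₀ : Set (Fin d → ℝ)) (hΩ₀open : IsOpen Ω₀) (hΩ₀bdd : Bornology.IsBounded Ω₀)
    (w : (Fin d → ℝ) × ℝ → (Fin d → ℝ)) (hw : ContDiff ℝ 1 w)
    (X : (Fin d → ℝ) × ℝ → (Fin d → ℝ)) (hX : ContDiff ℝ 1 X)
    (hflow : ∀ χ ∈ Ω₀, ∀ t ∈ Set.Ico (0 : ℝ) T,
      fderiv ℝ X (χ, t) (0, 1) = w (X (χ, t), t))
    (hinit : ∀ χ ∈ Ω₀, X (χ, 0) = χ)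
    (hinj : ∀ t ∈ Set.Ico (0 : ℝ) T, Set.InjOn (fun χ => X (χ, t)) Ω₀)
    (hjac : ∀ χ ∈ Ω₀, ∀ t ∈ Set.Ico (0 : ℝ) T,
      0 < (Matrix.of fun i j => fderiv ℝ X (χ, t) (Pi.single j 1, 0) i).det)
    (u : (Fin d → ℝ) × ℝ → ℝ) (hu : ContDiff ℝ 1 u)
    (hbdd : ∃ C : ℝ, ∀ q : (Fin d → ℝ) × ℝ,
      |u q| ≤ C ∧ ‖fderiv ℝ u q‖ ≤ C ∧ ‖w q‖ ≤ C ∧ ‖fderiv ℝ w q‖ ≤ C)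
    (Ω : ℝ → Set (Fin d → ℝ)) (hΩ : ∀ t, Ω t = (fun χ => X (χ, t)) '' Ω₀) :
    ∀ t ∈ Set.Ico (0 : ℝ) T,
      HasDerivWithinAt (fun s => ∫ x in Ω s, u (x, s))
        (∫ x in Ω t,
          (fderiv ℝ u (x, t) (0, 1)
            + ∑ i : Fin d,
                fderiv ℝ (fun y : Fin d → ℝ => u (y, t) * w (y, t) i) x
                  (Pi.single i 1)))
        (Set.Ico (0 : ℝ) T) t := by
  have hXd := hX.differentiable one_ne_zero
  have hwd := hw.differentiable one_ne_zero
  have hud := hu.differentiable one_ne_zero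
  have hXc := hX.continuous
  have hwc := hw.continuous
  have huc := hu.continuous
  have hX'c := hX.continuous_fderiv one_ne_zero
  have hw'c := hw.continuous_fderiv one_ne_zero
  have hu'c := hu.continuous_fderiv one_ne_zero
  let K : (Fin d → ℝ) × ℝ → ℝ := fun q => fderiv ℝ u q (0, 1) +
    ∑ i, (u q * fderiv ℝ w q (Pi.single i 1, 0) i + w q i * fderiv ℝ u q (Pi.single i 1, 0))
  let J : ℝ → (Fin d → ℝ) → ℝ := fun t χ =>
    (Matrix.of fun i j => fderiv ℝ X (χ, t) (Pi.single j 1, 0) i).det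
  have hK : Continuous K := by fun_prop
  have hJ : Continuous (Function.uncurry J) := by
    refine Continuous.matrix_det (continuous_matrix fun i j => ?_)
    simp only [Matrix.of_apply]
    fun_prop
  have hJt (t) : Continuous (J t) := hJ.comp (Continuous.prodMk_right t)
  let G : ℝ → (Fin d → ℝ) → ℝ := fun t χ => J t χ * K (X (χ, t), t)
  have hG : Continuous (Function.uncurry G) := by
    unfold Function.uncurry at hJ ⊢
    fun_prop
  have hKeq (x t) : fderiv ℝ u (x, t) (0, 1)
      + ∑ i, fderiv ℝ (fun y => u (y, t) * w (y, t) i) x (Pi.single i 1) = K (x, t) := by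
    refine congrArg _ (Finset.sum_congr rfl fun i _ => ?_)
    have h : HasFDerivAt (fun y => u (y, t) * w (y, t) i) _ x :=
      (hasFDerivAt_slice (hud (x, t))).mul
        (hasFDerivAt_pi'.1 (hasFDerivAt_slice (hwd (x, t))) i)
    simp [h.fderiv]
  have hchange : ∀ t ∈ Set.Ico (0 : ℝ) T, ∀ g : (Fin d → ℝ) → ℝ,
      ∫ x in Ω t, g x = ∫ χ in Ω₀, J t χ * g (X (χ, t)) := by
    intro t ht g
    rw [hΩ, integral_image_eq_integral_abs_det_fderiv_smul volume hΩ₀open.measurableSet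
      (fun χ _ => (hasFDerivAt_slice (hXd (χ, t))).hasFDerivWithinAt) (hinj t ht)]
    refine setIntegral_congr_fun hΩ₀open.measurableSet fun χ hχ => ?_
    simp only [ContinuousLinearMap.det_eq_det_of, ContinuousLinearMap.comp_apply,
      ContinuousLinearMap.inl_apply, smul_eq_mul, abs_of_pos (hjac χ hχ t ht), J]
  have hprim : ∀ χ ∈ Ω₀, ∀ t ∈ Set.Ico (0 : ℝ) T,
      J t χ * u (X (χ, t), t) = J 0 χ * u (X (χ, 0), 0) + ∫ s in 0..t, G s χ := by
    intro χ hχ t ht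
    obtain ⟨j, hj⟩ := exists_hasDerivAt_flow_det hΩ₀open hw hX hflow hinit hχ
    have hjJ : ∀ s ∈ Set.Ico (0 : ℝ) T, j s = J s χ := fun s hs => (hj s hs).1
    have hderiv : ∀ s ∈ Set.uIcc 0 t,
        HasDerivAt (fun s => j s * u (X (χ, s), s)) (G s χ) s := by
      intro s hs
      rw [Set.uIcc_of_le ht.1] at hs
      have hsT : s ∈ Set.Ico (0 : ℝ) T := ⟨hs.1, hs.2.trans_lt ht.2⟩
      have hx := (hXd (χ, s)).hasDerivAt_time
      rw [hflow χ hχ s hsT] at hx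
      have hux : HasDerivAt (fun s => u (X (χ, s), s))
          (fderiv ℝ u (X (χ, s), s) (w (X (χ, s), s), 1)) s :=
        HasFDerivAt.comp_hasDerivAt (f := fun s => (X (χ, s), s)) s (hud _).hasFDerivAt
          (hx.prodMk (hasDerivAt_id s))
      convert! (hj s hsT).2.mul hux using 1
      have hsplit : (w (X (χ, s), s), (1 : ℝ)) = (0, 1) + (w (X (χ, s), s), 0) := by simp
      rw [hsplit, map_add, ContinuousLinearMap.apply_prodMk_zero_eq_sum, hjJ s hsT]
      simp only [G, K, Finset.sum_add_distrib, ← Finset.mul_sum, smul_eq_mul]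
      ring
    have h := intervalIntegral.integral_eq_sub_of_hasDerivAt hderiv
      ((hG.comp (Continuous.prodMk_left χ)).intervalIntegrable 0 t)
    rw [h, hjJ t ht, hjJ 0 ⟨le_rfl, hT⟩]
    ring
  intro t ht
  have hmain := hasDerivAt_setIntegral_of_continuous (μ := volume) hΩ₀bdd.isCompact_closure
    subset_closure hΩ₀open.measurableSet
    (F := fun t χ => J 0 χ * u (X (χ, 0), 0) + ∫ s in 0..t, G s χ) (F' := G)
    (fun t => by
      have : Continuous fun χ => ∫ s in 0..t, G s χ :=
        intervalIntegral.continuous_parametric_intervalIntegral_of_continuous'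
          (f := fun χ s => G s χ) (hG.comp continuous_swap) 0 t
      have := hJt 0
      fun_prop) hG
    (fun t χ => ((hG.comp (Continuous.prodMk_left χ)).integral_hasStrictDerivAt 0 t
      ).hasDerivAt.const_add _) t
  have hF : ∀ s ∈ Set.Ico (0 : ℝ) T, ∫ x in Ω s, u (x, s) =
      ∫ χ in Ω₀, (J 0 χ * u (X (χ, 0), 0) + ∫ r in 0..s, G r χ) := fun s hs => by
    rw [hchange s hs fun x => u (x, s)]
    exact setIntegral_congr_fun hΩ₀open.measurableSet fun χ hχ => hprim χ hχ s hs
  simp only [hKeq, hchange t ht fun x => K (x, t)]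
  exact hmain.hasDerivWithinAt.congr hF (hF t ht)
end

section
/- (Well-posedness of the scalar initial value problem; Kruzkov.) Let d ≥ 1, let f : ℝ → ℝ^d be locally Lipschitz continuous, and let u₀ ∈ L^∞(ℝ^d). Then there exists a unique function u ∈ L^∞(ℝ^d × (0,∞)) which is a Kruzkov entropy solution of ∂_t u + ∇_x·f(u) = 0 with initial data u₀, i.e. for every constant c ∈ ℝ and every nonnegative Lipschitz function φ on ℝ^d × [0,∞) with compact support, ∫₀^∞∫_{ℝ^d} [ |u − c| ∂_t φ + sgn(u − c)(f(u) − f(c)) · ∇_x φ ] dx dt + ∫_{ℝ^d} |u₀(x) − c| φ(x,0) dx ≥ 0. Moreover this solution satisfies u(·,t) ∈ C([0,∞); L¹_loc(ℝ^d)) (after modification on a null set) with u(·,0) = u₀. -/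
open MeasureTheory

/-- `u : ℝ^d × (0,∞) → ℝ` (written as `u x t`) is a (bounded, measurable) Kruzkov
entropy solution of the scalar conservation law `∂ₜu + ∇ₓ·f(u) = 0` with initial
data `u₀`: for every constant `c ∈ ℝ` and every nonnegative Lipschitz compactly
supported test function `φ` on `ℝ^d × [0,∞)`,
`∫₀^∞∫ [|u−c| ∂ₜφ + sgn(u−c)(f(u)−f(c))·∇ₓφ] dx dt + ∫ |u₀−c| φ(·,0) dx ≥ 0`. -/
def IsKruzkovEntropySolution {d : ℕ} (f : ℝ → (Fin d → ℝ))
    (u₀ : (Fin d → ℝ) → ℝ) (u : (Fin d → ℝ) → ℝ → ℝ) : Prop :=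
  Measurable (fun p : (Fin d → ℝ) × ℝ => u p.1 p.2) ∧
  (∃ C : ℝ, ∀ x t, |u x t| ≤ C) ∧
  ∀ (c : ℝ) (φ : (Fin d → ℝ) × ℝ → ℝ),
    (∃ L, LipschitzWith L φ) → HasCompactSupport φ → (∀ p, 0 ≤ φ p) →
    0 ≤ (∫ t in Set.Ioi (0 : ℝ), ∫ x : Fin d → ℝ,
          (|u x t - c| * fderiv ℝ φ (x, t) (0, 1)
            + ∑ i : Fin d, Real.sign (u x t - c) * (f (u x t) i - f c i)
                * fderiv ℝ φ (x, t) (Pi.single i 1, 0)))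
        + ∫ x : Fin d → ℝ, |u₀ x - c| * φ (x, 0)

/-- A polynomially decaying weight on `ℝ^d`, integrable with respect to Lebesgue measure. -/
noncomputable def decayWeight (d : ℕ) (x : Fin d → ℝ) : ℝ := (1 + ‖x‖) ^ (-((d : ℝ) + 1))

/-- The finite measure on `ℝ^d` with density `decayWeight`. -/
noncomputable def weightedVolume (d : ℕ) : Measure (Fin d → ℝ) :=
  volume.withDensity fun x => ENNReal.ofReal (decayWeight d x)

lemma decayWeight_pos {d : ℕ} (x : Fin d → ℝ) : 0 < decayWeight d x := by
  unfold decayWeight; positivity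

lemma measurable_decayWeight {d : ℕ} : Measurable (decayWeight d) := by
  unfold decayWeight; fun_prop

lemma integrable_decayWeight (d : ℕ) : Integrable (decayWeight d) := by
  refine integrable_one_add_norm ?_
  simp

lemma decayWeight_sub_le {d : ℕ} (x y : Fin d → ℝ) :
    decayWeight d (x - y) ≤ Real.exp ((d + 1) * ‖y‖) * decayWeight d x := by
  have h1 : 1 + ‖x‖ ≤ Real.exp ‖y‖ * (1 + ‖x - y‖) := by
    have h2 : ‖x‖ ≤ ‖x - y‖ + ‖y‖ := by simpa using norm_add_le (x - y) y
    have h3 := Real.add_one_le_exp ‖y‖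
    nlinarith [norm_nonneg (x - y), norm_nonneg y]
  unfold decayWeight
  rw [Real.rpow_neg (by positivity), Real.rpow_neg (by positivity), mul_comm _ ‖y‖, Real.exp_mul,
    ← div_eq_mul_inv, inv_le_comm₀ (by positivity) (by positivity), inv_div,
    div_le_iff₀ (by positivity), mul_comm, ← Real.mul_rpow (by positivity) (by positivity)]
  exact Real.rpow_le_rpow (by positivity) h1 (by positivity)

instance (d : ℕ) : IsFiniteMeasure (weightedVolume d) :=
  isFiniteMeasure_withDensity_ofReal (integrable_decayWeight d).2

lemma integral_weightedVolume {d : ℕ} (F : (Fin d → ℝ) → ℝ) :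
    ∫ x, F x ∂weightedVolume d = ∫ x, decayWeight d x * F x := by
  rw [weightedVolume, integral_withDensity_eq_integral_toReal_smul
    (by have := @measurable_decayWeight d; fun_prop) (by simp)]
  simp [ENNReal.toReal_ofReal, (decayWeight_pos _).le]

lemma volume_absolutelyContinuous_weightedVolume (d : ℕ) :
    (volume : Measure (Fin d → ℝ)) ≪ weightedVolume d :=
  withDensity_absolutelyContinuous' (by have := @measurable_decayWeight d; fun_prop)
    (Filter.Eventually.of_forall fun x => by simpa using decayWeight_pos x)

lemma integrable_of_abs_le {α : Type*} [MeasurableSpace α] {μ : Measure α} [IsFiniteMeasure μ]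
    {F : α → ℝ} (hF : Measurable F) {C : ℝ} (hC : ∀ x, |F x| ≤ C) : Integrable F μ :=
  Integrable.of_bound hF.aestronglyMeasurable C (Filter.Eventually.of_forall hC)

lemma integrable_decayWeight_mul {d : ℕ} {F : (Fin d → ℝ) → ℝ} (hF : Measurable F) {C : ℝ}
    (hC : ∀ x, |F x| ≤ C) : Integrable (fun x => decayWeight d x * F x) :=
  (integrable_decayWeight d).mul_bdd hF.aestronglyMeasurable (c := C)
    (Filter.Eventually.of_forall hC)

lemma integral_weightedVolume_comp_add_le {d : ℕ} {F : (Fin d → ℝ) → ℝ} (hF : Measurable F) {C : ℝ}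
    (hC : ∀ x, |F x| ≤ C) (h0 : ∀ x, 0 ≤ F x) (y : Fin d → ℝ) :
    ∫ x, F (x + y) ∂weightedVolume d ≤
      Real.exp ((d + 1) * ‖y‖) * ∫ x, F x ∂weightedVolume d := by
  rw [integral_weightedVolume, integral_weightedVolume, ← integral_const_mul]
  have h1 : ∫ x, decayWeight d x * F (x + y) = ∫ x, decayWeight d (x - y) * F x := by
    simpa using integral_add_right_eq_self (fun x => decayWeight d (x - y) * F x) y
  rw [h1]
  refine integral_mono_of_nonneg
    (Filter.Eventually.of_forall fun x => mul_nonneg (decayWeight_pos _).le (h0 x))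
    ((integrable_decayWeight_mul hF hC).const_mul _) (Filter.Eventually.of_forall fun x => ?_)
  simp only [← mul_assoc]
  exact mul_le_mul_of_nonneg_right (decayWeight_sub_le x y) (h0 x)

/-- Integrals over bounded sets are controlled by weighted integrals. -/
lemma exists_integral_le_weightedVolume {d : ℕ} (R : ℝ) :
    ∃ C : ℝ, 0 ≤ C ∧ ∀ {F G : (Fin d → ℝ) → ℝ}, Measurable F → (∃ B, ∀ x, |F x| ≤ B) →
      (∀ x, 0 ≤ G x) → (∀ x, G x ≤ F x) → (∀ x, G x ≠ 0 → ‖x‖ ≤ R) →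
      ∫ x, G x ≤ C * ∫ x, F x ∂weightedVolume d := by
  refine ⟨(1 + |R|) ^ ((d : ℝ) + 1), by positivity, fun {F G} hF ⟨B, hB⟩ hG0 hGF hR => ?_⟩
  rw [integral_weightedVolume, ← integral_const_mul]
  refine integral_mono_of_nonneg (Filter.Eventually.of_forall hG0)
    ((integrable_decayWeight_mul hF hB).const_mul _) (Filter.Eventually.of_forall fun x => ?_)
  have hFx : 0 ≤ F x := (hG0 x).trans (hGF x)
  by_cases hx : G x = 0
  · simp only [hx]
    have := (decayWeight_pos x).le
    positivity
  · have h2 := hR x hx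
    have h3 : 1 ≤ (1 + |R|) ^ ((d : ℝ) + 1) * decayWeight d x := by
      rw [decayWeight, Real.rpow_neg (by positivity), ← div_eq_mul_inv,
        one_le_div (by positivity)]
      exact Real.rpow_le_rpow (by positivity) (by linarith [le_abs_self R]) (by positivity)
    have := hGF x
    simp only
    nlinarith

/-- `u` is measurable and bounded by `M` in absolute value. -/
def MeasurableBounded {α : Type*} [MeasurableSpace α] (M : ℝ) (u : α → ℝ) : Prop :=
  Measurable u ∧ ∀ x, |u x| ≤ M

/-- The distance of `u` and `v` in weighted `L¹`. -/
noncomputable def weightedDist {d : ℕ} (u v : (Fin d → ℝ) → ℝ) : ℝ :=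
  ∫ x, |u x - v x| ∂weightedVolume d

namespace MeasurableBounded

variable {α : Type*} [MeasurableSpace α] {M : ℝ} {u v : α → ℝ}

lemma comp {β : Type*} [MeasurableSpace β] (hu : MeasurableBounded M u) {g : β → α}
    (hg : Measurable g) : MeasurableBounded M fun x => u (g x) :=
  ⟨hu.1.comp hg, fun x => hu.2 (g x)⟩

lemma mem_Icc (hu : MeasurableBounded M u) (x : α) : u x ∈ Set.Icc (-M) M := abs_le.1 (hu.2 x)

lemma abs_sub_le (hu : MeasurableBounded M u) (hv : MeasurableBounded M v) (x : α) :
    |u x - v x| ≤ 2 * M := by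
  have h1 := abs_le.1 (hu.2 x)
  have h2 := abs_le.1 (hv.2 x)
  exact abs_le.2 ⟨by linarith, by linarith⟩

lemma measurable_abs_sub (hu : MeasurableBounded M u) (hv : MeasurableBounded M v) :
    Measurable fun x => |u x - v x| := by
  have h1 := hu.1
  have h2 := hv.1
  fun_prop

lemma integrable_abs_sub {μ : Measure α} [IsFiniteMeasure μ] (hu : MeasurableBounded M u)
    (hv : MeasurableBounded M v) : Integrable (fun x => |u x - v x|) μ :=
  integrable_of_abs_le (hu.measurable_abs_sub hv) (C := 2 * M)
    fun x => by rw [abs_abs]; exact hu.abs_sub_le hv x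

end MeasurableBounded

section weightedDist

variable {d : ℕ} {M : ℝ} {u v w : (Fin d → ℝ) → ℝ}

lemma weightedDist_nonneg : 0 ≤ weightedDist u v := integral_nonneg fun _ => abs_nonneg _

lemma weightedDist_self : weightedDist u u = 0 := by simp [weightedDist]

lemma weightedDist_comm : weightedDist u v = weightedDist v u := by
  simp only [weightedDist, abs_sub_comm]

lemma weightedDist_triangle (hu : MeasurableBounded M u) (hv : MeasurableBounded M v)
    (hw : MeasurableBounded M w) : weightedDist u w ≤ weightedDist u v + weightedDist v w := by
  unfold weightedDist
  rw [← integral_add (hu.integrable_abs_sub hv) (hv.integrable_abs_sub hw)]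
  exact integral_mono (hu.integrable_abs_sub hw)
    ((hu.integrable_abs_sub hv).add (hv.integrable_abs_sub hw)) fun x => abs_sub_le _ _ _

lemma weightedDist_le_of_abs_le {C : ℝ} (h : ∀ x, |u x - v x| ≤ C) :
    weightedDist u v ≤ C * (weightedVolume d).real Set.univ := by
  have h1 : ∫ _x, C ∂weightedVolume d = C * (weightedVolume d).real Set.univ := by
    simp [mul_comm]
  rw [← h1]
  exact integral_mono_of_nonneg (Filter.Eventually.of_forall fun x => abs_nonneg _)
    (integrable_const _) (Filter.Eventually.of_forall h)

lemma weightedDist_comp_add_le (hu : MeasurableBounded M u) (hv : MeasurableBounded M v)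
    (z : Fin d → ℝ) :
    weightedDist (fun x => u (x + z)) (fun x => v (x + z)) ≤
      Real.exp ((d + 1) * ‖z‖) * weightedDist u v :=
  integral_weightedVolume_comp_add_le (F := fun x => |u x - v x|) (hu.measurable_abs_sub hv)
    (fun x => by rw [abs_abs]; exact hu.abs_sub_le hv x) (fun _ => abs_nonneg _) z

end weightedDist

/-- A translation-invariant monotone conservative scheme `u ↦ ∑ j, g j (u (· + h e j))`. -/
structure MonotoneScheme (d : ℕ) (ι : Type) [Fintype ι] where
  M : ℝ
  κ : ℝ
  g : ι → ℝ → ℝ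
  e : ι → Fin d → ℝ
  κ_nonneg : 0 ≤ κ
  continuous_g : ∀ j, Continuous (g j)
  monotoneOn_g : ∀ j, MonotoneOn (g j) (Set.Icc (-M) M)
  sum_g : ∀ a, ∑ j, g j a = a
  norm_e_le : ∀ j, ‖e j‖ ≤ κ

namespace MonotoneScheme

variable {d : ℕ} {ι : Type} [Fintype ι] (S : MonotoneScheme d ι)

/-- One step of the scheme. -/
def step (h : ℝ) (u : (Fin d → ℝ) → ℝ) : (Fin d → ℝ) → ℝ :=
  fun x => ∑ j, S.g j (u (x + h • S.e j))

/-- The exponential growth rate of weighted distances. -/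
def rate : ℝ := (d + 1) * S.κ

lemma rate_nonneg : 0 ≤ S.rate := mul_nonneg (by positivity) S.κ_nonneg

lemma sum_abs_g_sub {a b : ℝ} (ha : a ∈ Set.Icc (-S.M) S.M) (hb : b ∈ Set.Icc (-S.M) S.M) :
    ∑ j, |S.g j a - S.g j b| = |a - b| := by
  rcases le_total a b with hab | hab
  · rw [abs_of_nonpos (by linarith), ← S.sum_g a, ← S.sum_g b, ← Finset.sum_sub_distrib,
      ← Finset.sum_neg_distrib]
    refine Finset.sum_congr rfl fun j _ => ?_
    rw [S.sum_g, S.sum_g, abs_of_nonpos]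
    linarith [S.monotoneOn_g j ha hb hab]
  · rw [abs_of_nonneg (by linarith), ← S.sum_g a, ← S.sum_g b, ← Finset.sum_sub_distrib]
    refine Finset.sum_congr rfl fun j _ => ?_
    rw [S.sum_g, S.sum_g, abs_of_nonneg]
    linarith [S.monotoneOn_g j hb ha hab]

lemma abs_g_sub_le {a b : ℝ} (ha : a ∈ Set.Icc (-S.M) S.M) (hb : b ∈ Set.Icc (-S.M) S.M) (j : ι) :
    |S.g j a - S.g j b| ≤ |a - b| := by
  rw [← S.sum_abs_g_sub ha hb]
  exact Finset.single_le_sum (f := fun j => |S.g j a - S.g j b|) (fun _ _ => abs_nonneg _)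
    (Finset.mem_univ j)

variable {S} {u v : (Fin d → ℝ) → ℝ}

lemma measurableBounded_step (hu : MeasurableBounded S.M u) (h : ℝ) :
    MeasurableBounded S.M (S.step h u) := by
  constructor
  · unfold step
    refine Finset.measurable_sum _ fun j _ => ?_
    have h1 := (S.continuous_g j).measurable
    have h2 := hu.1
    fun_prop
  · intro x
    have hM : -S.M ≤ S.M := by
      have := abs_le.1 (hu.2 x)
      linarith
    refine abs_le.2 ⟨?_, ?_⟩
    · rw [← S.sum_g (-S.M)]
      exact Finset.sum_le_sum fun j _ =>
        S.monotoneOn_g j (Set.left_mem_Icc.2 hM) (hu.mem_Icc _) (hu.mem_Icc _).1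
    · conv_rhs => rw [← S.sum_g S.M]
      exact Finset.sum_le_sum fun j _ =>
        S.monotoneOn_g j (hu.mem_Icc _) (Set.right_mem_Icc.2 hM) (hu.mem_Icc _).2

lemma weightedDist_step_le (hu : MeasurableBounded S.M u) (hv : MeasurableBounded S.M v) {h : ℝ}
    (hh : 0 ≤ h) :
    weightedDist (S.step h u) (S.step h v) ≤ Real.exp (S.rate * h) * weightedDist u v := by
  have hm : ∀ j, Measurable fun x => |S.g j (u x) - S.g j (v x)| := fun j => by
    have h1 := (S.continuous_g j).measurable
    have h2 := hu.1
    have h3 := hv.1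
    fun_prop
  have hb : ∀ j x, |(|S.g j (u x) - S.g j (v x)|)| ≤ 2 * S.M := fun j x => by
    rw [abs_abs]
    exact (S.abs_g_sub_le (hu.mem_Icc x) (hv.mem_Icc x) j).trans (hu.abs_sub_le hv x)
  have hi : ∀ (j : ι) (z : Fin d → ℝ), Integrable
      (fun x => |S.g j (u (x + z)) - S.g j (v (x + z))|) (weightedVolume d) := fun j z =>
    integrable_of_abs_le ((hm j).comp (measurable_add_const z)) fun x => hb j (x + z)
  calc weightedDist (S.step h u) (S.step h v)
      ≤ ∫ x, ∑ j, |S.g j (u (x + h • S.e j)) - S.g j (v (x + h • S.e j))| ∂weightedVolume d := by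
        refine integral_mono
          ((measurableBounded_step hu h).integrable_abs_sub (measurableBounded_step hv h))
          (integrable_finsetSum _ fun j _ => hi j _) fun x => ?_
        simp only [step, ← Finset.sum_sub_distrib]
        exact Finset.abs_sum_le_sum_abs _ _
    _ = ∑ j, ∫ x, |S.g j (u (x + h • S.e j)) - S.g j (v (x + h • S.e j))| ∂weightedVolume d :=
        integral_finsetSum _ fun j _ => hi j _
    _ ≤ ∑ j, Real.exp (S.rate * h) * ∫ x, |S.g j (u x) - S.g j (v x)| ∂weightedVolume d := by
        refine Finset.sum_le_sum fun j _ => ?_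
        refine (integral_weightedVolume_comp_add_le (hm j) (hb j) (fun _ => abs_nonneg _) _).trans
          (mul_le_mul_of_nonneg_right (Real.exp_le_exp.2 ?_)
            (integral_nonneg fun _ => abs_nonneg _))
        rw [norm_smul, Real.norm_of_nonneg hh, rate, mul_assoc, mul_comm S.κ h]
        gcongr
        exact S.norm_e_le j
    _ = Real.exp (S.rate * h) * weightedDist u v := by
        rw [← Finset.mul_sum, ← integral_finsetSum _ fun j _ => by simpa using hi j 0]
        congr 1
        refine integral_congr_ae (Filter.Eventually.of_forall fun x => ?_)
        exact S.sum_abs_g_sub (hu.mem_Icc x) (hv.mem_Icc x)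

lemma measurableBounded_iterate (hu : MeasurableBounded S.M u) (h : ℝ) (k : ℕ) :
    MeasurableBounded S.M ((S.step h)^[k] u) := by
  induction k with
  | zero => exact hu
  | succ k ih => rw [Function.iterate_succ_apply']; exact measurableBounded_step ih h

lemma weightedDist_iterate_le (hu : MeasurableBounded S.M u) (hv : MeasurableBounded S.M v) {h : ℝ}
    (hh : 0 ≤ h) (k : ℕ) :
    weightedDist ((S.step h)^[k] u) ((S.step h)^[k] v) ≤
      Real.exp (S.rate * (k * h)) * weightedDist u v := by
  induction k with
  | zero => simp
  | succ k ih =>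
    rw [Function.iterate_succ_apply', Function.iterate_succ_apply']
    refine (weightedDist_step_le (measurableBounded_iterate hu h k)
      (measurableBounded_iterate hv h k) hh).trans ?_
    refine (mul_le_mul_of_nonneg_left ih (Real.exp_nonneg _)).trans (le_of_eq ?_)
    rw [← mul_assoc, ← Real.exp_add]
    congr 2
    push_cast
    ring

lemma step_comp_add (h : ℝ) (u : (Fin d → ℝ) → ℝ) (z : Fin d → ℝ) :
    S.step h (fun x => u (x + z)) = fun x => S.step h u (x + z) := by
  ext x
  simp only [step, add_right_comm]

lemma iterate_comp_add (h : ℝ) (u : (Fin d → ℝ) → ℝ) (z : Fin d → ℝ) (k : ℕ) :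
    (S.step h)^[k] (fun x => u (x + z)) = fun x => (S.step h)^[k] u (x + z) := by
  induction k with
  | zero => rfl
  | succ k ih => rw [Function.iterate_succ_apply', ih, step_comp_add, Function.iterate_succ_apply']

lemma abs_step_sub_le {K : NNReal} (hu : MeasurableBounded S.M u) (hK : LipschitzWith K u) {h : ℝ}
    (hh : 0 ≤ h) (x : Fin d → ℝ) :
    |S.step h u x - u x| ≤ Fintype.card ι * (K * (h * S.κ)) := by
  conv_lhs => rw [← S.sum_g (u x)]
  rw [step, ← Finset.sum_sub_distrib]
  refine (Finset.abs_sum_le_sum_abs _ _).trans ?_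
  rw [← nsmul_eq_mul, ← Finset.card_univ]
  refine Finset.sum_le_card_nsmul _ _ _ fun j _ => ?_
  refine (S.abs_g_sub_le (hu.mem_Icc _) (hu.mem_Icc _) j).trans ?_
  have h1 := hK.dist_le_mul (x + h • S.e j) x
  rw [Real.dist_eq, dist_self_add_left, norm_smul, Real.norm_of_nonneg hh] at h1
  refine h1.trans ?_
  gcongr
  exact S.norm_e_le j

lemma weightedDist_iterate_add_le {K : NNReal} (hu : MeasurableBounded S.M u)
    (hK : LipschitzWith K u) {h : ℝ} (hh : 0 ≤ h) (k l : ℕ) :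
    weightedDist ((S.step h)^[k + l] u) ((S.step h)^[k] u) ≤
      Real.exp (S.rate * ((k + l : ℕ) * h)) *
        (l * h * (Fintype.card ι * K * S.κ * (weightedVolume d).real Set.univ)) := by
  induction l with
  | zero => simp [weightedDist_self]
  | succ l ih =>
    have hr := S.rate_nonneg
    have hκ := S.κ_nonneg
    have h1 : weightedDist ((S.step h)^[k + (l + 1)] u) ((S.step h)^[k + l] u) ≤
        Real.exp (S.rate * ((k + l : ℕ) * h)) *
          (h * (Fintype.card ι * K * S.κ * (weightedVolume d).real Set.univ)) := by
      rw [← add_assoc, Function.iterate_succ_apply]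
      refine (weightedDist_iterate_le (measurableBounded_step hu h) hu hh (k + l)).trans ?_
      gcongr
      refine (weightedDist_le_of_abs_le (abs_step_sub_le hu hK hh)).trans (le_of_eq ?_)
      ring
    refine (weightedDist_triangle (measurableBounded_iterate hu h _)
      (measurableBounded_iterate hu h (k + l)) (measurableBounded_iterate hu h k)).trans ?_
    refine (add_le_add h1 ih).trans ?_
    rw [← mul_add]
    have h2 : h * (Fintype.card ι * K * S.κ * (weightedVolume d).real Set.univ) +
        l * h * (Fintype.card ι * K * S.κ * (weightedVolume d).real Set.univ) =
        ((l + 1 : ℕ) : ℝ) * h * (Fintype.card ι * K * S.κ * (weightedVolume d).real Set.univ) := by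
      push_cast; ring
    rw [h2]
    gcongr
    simp

end MonotoneScheme

lemma exists_lipschitz_weightedDist_le {d : ℕ} {M : ℝ} {u : (Fin d → ℝ) → ℝ}
    (hu : MeasurableBounded M u) {ε : ℝ} (hε : 0 < ε) :
    ∃ (w : (Fin d → ℝ) → ℝ) (K : NNReal), MeasurableBounded M w ∧ LipschitzWith K w ∧
      weightedDist u w ≤ ε := by
  have hM : -M ≤ M := by
    have := abs_le.1 (hu.2 0)
    linarith
  have hmem : MemLp u 1 (weightedVolume d) := memLp_one_iff_integrable.2
    (integrable_of_abs_le hu.1 hu.2)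
  obtain ⟨g, hgs, hgd, hg⟩ := hmem.exist_eLpNorm_sub_le (by simp) le_rfl hε
  obtain ⟨K, hK⟩ := ContDiff.lipschitzWith_of_hasCompactSupport hgs hgd (by simp)
  have hw : MeasurableBounded M fun x => max (-M) (min M (g x)) := by
    refine ⟨by have := hgd.continuous.measurable; fun_prop, fun x => abs_le.2 ⟨le_max_left _ _, ?_⟩⟩
    exact max_le hM (min_le_left _ _)
  refine ⟨_, K, hw, (hK.const_min M).const_max (-M), ?_⟩
  have h1 : ∫ x, |u x - g x| ∂weightedVolume d ≤ ε := by
    rw [eLpNorm_one_eq_lintegral_enorm] at hg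
    have h2 : Integrable (fun x => u x - g x) (weightedVolume d) :=
      (integrable_of_abs_le hu.1 hu.2).sub (hgd.continuous.integrable_of_hasCompactSupport hgs)
    have h3 := ofReal_integral_norm_eq_lintegral_enorm h2
    rw [← ENNReal.ofReal_le_ofReal_iff hε.le]
    simp only [Real.norm_eq_abs] at h3
    rw [h3]
    exact hg
  refine le_trans (integral_mono (hu.integrable_abs_sub hw) ?_ fun x => ?_) h1
  · exact ((integrable_of_abs_le hu.1 hu.2).sub
      (hgd.continuous.integrable_of_hasCompactSupport hgs)).abs
  · have h4 := abs_le.1 (hu.2 x)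
    have h5 : u x = max (-M) (min M (u x)) := by
      rw [min_eq_right h4.2, max_eq_right h4.1]
    simp only
    conv_lhs => rw [h5]
    refine (abs_max_sub_max_le_max _ _ _ _).trans (max_le (by simp) ?_)
    exact (abs_min_sub_min_le_max _ _ _ _).trans (max_le (by simp) le_rfl)

namespace MonotoneScheme

variable {d : ℕ} {ι : Type} [Fintype ι] {S : MonotoneScheme d ι} {u : (Fin d → ℝ) → ℝ}

variable (S) in
/-- The piecewise constant in time approximate solution with mesh size `h`. -/
noncomputable def approx (h : ℝ) (u : (Fin d → ℝ) → ℝ) (x : Fin d → ℝ) (t : ℝ) : ℝ :=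
  (S.step h)^[⌊t / h⌋₊] u x

lemma measurableBounded_approx (hu : MeasurableBounded S.M u) (h : ℝ) :
    MeasurableBounded S.M fun p : (Fin d → ℝ) × ℝ => S.approx h u p.1 p.2 := by
  refine ⟨?_, fun p => (measurableBounded_iterate hu h _).2 _⟩
  have h1 : Measurable fun q : (Fin d → ℝ) × ℕ => (S.step h)^[q.2] u q.1 :=
    measurable_from_prod_countable_left fun k => (measurableBounded_iterate hu h k).1
  have h2 : Measurable fun p : (Fin d → ℝ) × ℝ => (p.1, ⌊p.2 / h⌋₊) :=
    measurable_fst.prodMk (Nat.measurable_floor.comp (measurable_snd.div_const h))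
  exact h1.comp h2

lemma measurableBounded_approx_apply (hu : MeasurableBounded S.M u) (h t : ℝ) :
    MeasurableBounded S.M fun x => S.approx h u x t :=
  measurableBounded_iterate hu h _

lemma exists_approx_modulus (hu : MeasurableBounded S.M u) (T : ℝ) {ε : ℝ} (hε : 0 < ε) :
    ∃ δ > 0, ∀ h, 0 < h → h ≤ δ → ∀ t τ, 0 ≤ t → t ≤ T → 0 ≤ τ → τ ≤ δ →
      ∀ z : Fin d → ℝ, ‖z‖ ≤ δ →
      weightedDist (fun x => S.approx h u (x + z) (t + τ)) (fun x => S.approx h u x t) ≤ ε := by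
  have hr := S.rate_nonneg
  have hκ := S.κ_nonneg
  set V := (weightedVolume d).real Set.univ with hV
  have hV0 : 0 ≤ V := measureReal_nonneg
  set Γ := Real.exp ((d + 1) + S.rate * (|T| + 1)) with hΓ
  have hΓ0 : 0 < Γ := Real.exp_pos _
  obtain ⟨w, K, hw, hK, huw⟩ := exists_lipschitz_weightedDist_le hu (ε := ε / (4 * Γ))
    (by positivity)
  set B := Γ * (2 * (Fintype.card ι * K * S.κ * V) + K * V) with hB
  have hB0 : 0 ≤ B := by positivity
  refine ⟨min 1 (ε / (2 * (B + 1))), by positivity, ?_⟩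
  intro h hh hhδ t τ ht htT hτ hτδ z hz
  have hδ1 : min 1 (ε / (2 * (B + 1))) ≤ 1 := min_le_left _ _
  have hδB : B * min 1 (ε / (2 * (B + 1))) ≤ ε / 2 := by
    refine (mul_le_mul_of_nonneg_left (min_le_right _ _) hB0).trans ?_
    rw [mul_div_assoc', div_le_div_iff₀ (by positivity) (by positivity)]
    nlinarith
  set δ := min 1 (ε / (2 * (B + 1))) with hδ
  set k := ⌊t / h⌋₊ with hk
  obtain ⟨l, hl⟩ : ∃ l, ⌊(t + τ) / h⌋₊ = k + l := Nat.exists_eq_add_of_le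
    (Nat.floor_le_floor (by gcongr; linarith))
  have hkh : (k : ℝ) * h ≤ t := by
    rw [← le_div_iff₀ hh]; exact Nat.floor_le (by positivity)
  have hklh : ((k + l : ℕ) : ℝ) * h ≤ t + τ := by
    rw [← le_div_iff₀ hh, ← hl]; exact Nat.floor_le (by positivity)
  have hkh' : t < (k + 1) * h := by
    rw [← div_lt_iff₀ hh]; exact Nat.lt_floor_add_one _
  have hlh : l * h ≤ 2 * δ := by
    push_cast at hklh
    nlinarith
  have hT := le_abs_self T
  simp only [approx]
  rw [hl]
  have m1 := measurableBounded_iterate hu h (k + l)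
  have m2 := measurableBounded_iterate hw h (k + l)
  have m3 := measurableBounded_iterate hw h k
  have m4 := measurableBounded_iterate hu h k
  have hz' : Measurable fun x : Fin d → ℝ => x + z := measurable_add_const z
  have hzd : (d + 1) * ‖z‖ ≤ (d : ℝ) + 1 := by
    have : ‖z‖ ≤ 1 := hz.trans hδ1
    nlinarith [(Nat.cast_nonneg d : (0 : ℝ) ≤ d)]
  have e1 : weightedDist (fun x => (S.step h)^[k + l] u (x + z))
      (fun x => (S.step h)^[k + l] w (x + z)) ≤ ε / 4 := by
    refine (weightedDist_comp_add_le m1 m2 z).trans ?_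
    refine (mul_le_mul_of_nonneg_left (weightedDist_iterate_le hu hw hh.le _)
      (Real.exp_nonneg _)).trans ?_
    rw [← mul_assoc, ← Real.exp_add]
    have : Real.exp ((d + 1) * ‖z‖ + S.rate * ((k + l : ℕ) * h)) ≤ Γ := by
      refine Real.exp_le_exp.2 (add_le_add hzd (mul_le_mul_of_nonneg_left ?_ hr))
      linarith
    refine (mul_le_mul this huw weightedDist_nonneg hΓ0.le).trans (le_of_eq ?_)
    field_simp
  have e2 : weightedDist (fun x => (S.step h)^[k + l] w (x + z))
      (fun x => (S.step h)^[k] w (x + z)) ≤ Γ * (2 * (Fintype.card ι * K * S.κ * V)) * δ := by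
    refine (weightedDist_comp_add_le m2 m3 z).trans ?_
    refine (mul_le_mul_of_nonneg_left (weightedDist_iterate_add_le hw hK hh.le k l)
      (Real.exp_nonneg _)).trans ?_
    rw [← mul_assoc, ← Real.exp_add]
    have : Real.exp ((d + 1) * ‖z‖ + S.rate * ((k + l : ℕ) * h)) ≤ Γ := by
      refine Real.exp_le_exp.2 (add_le_add hzd (mul_le_mul_of_nonneg_left ?_ hr))
      linarith
    have h2 : l * h * (Fintype.card ι * K * S.κ * V) ≤
        (2 * δ) * (Fintype.card ι * K * S.κ * V) := by gcongr
    refine (mul_le_mul this h2 (by positivity) hΓ0.le).trans (le_of_eq ?_)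
    ring
  have e3 : weightedDist (fun x => (S.step h)^[k] w (x + z)) ((S.step h)^[k] w) ≤
      Γ * (K * V) * δ := by
    rw [← iterate_comp_add]
    refine (weightedDist_iterate_le (hw.comp hz') hw hh.le _).trans ?_
    have h1 : weightedDist (fun x => w (x + z)) w ≤ (K * δ) * V := by
      refine weightedDist_le_of_abs_le fun x => ?_
      have := hK.dist_le_mul (x + z) x
      rw [Real.dist_eq, dist_self_add_left] at this
      exact this.trans (by gcongr)
    have : Real.exp (S.rate * (k * h)) ≤ Γ := by
      refine Real.exp_le_exp.2 ?_
      have : S.rate * (k * h) ≤ S.rate * (|T| + 1) := mul_le_mul_of_nonneg_left (by linarith) hr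
      have : (0 : ℝ) ≤ d + 1 := by positivity
      linarith
    refine (mul_le_mul this h1 weightedDist_nonneg hΓ0.le).trans (le_of_eq ?_)
    ring
  have e4 : weightedDist ((S.step h)^[k] w) ((S.step h)^[k] u) ≤ ε / 4 := by
    rw [weightedDist_comm]
    refine (weightedDist_iterate_le hu hw hh.le _).trans ?_
    have : Real.exp (S.rate * (k * h)) ≤ Γ := by
      refine Real.exp_le_exp.2 ?_
      have : S.rate * (k * h) ≤ S.rate * (|T| + 1) := mul_le_mul_of_nonneg_left (by linarith) hr
      have : (0 : ℝ) ≤ d + 1 := by positivity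
      linarith
    refine (mul_le_mul this huw weightedDist_nonneg hΓ0.le).trans (le_of_eq ?_)
    field_simp
  have t1 := weightedDist_triangle (m1.comp hz') (m2.comp hz') m4
  have t2 := weightedDist_triangle (m2.comp hz') (m3.comp hz') m4
  have t3 := weightedDist_triangle (m3.comp hz') m3 m4
  have : Γ * (2 * (Fintype.card ι * K * S.κ * V)) * δ + Γ * (K * V) * δ = B * δ := by
    rw [hB]; ring
  refine t1.trans ?_
  linarith

end MonotoneScheme

instance isAddHaarMeasure_volume_spacetime (d : ℕ) :
    Measure.IsAddHaarMeasure (volume : Measure ((Fin d → ℝ) × ℝ)) :=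
  inferInstanceAs (Measure.IsAddHaarMeasure
    ((volume : Measure (Fin d → ℝ)).prod (volume : Measure ℝ)))

/-- A mollifier on space-time, concentrated at small positive times. -/
structure IsForwardKernel {d : ℕ} (δ : ℝ) (ρ : (Fin d → ℝ) × ℝ → ℝ) : Prop where
  contDiff : ContDiff ℝ 1 ρ
  hasCompactSupport : HasCompactSupport ρ
  nonneg : ∀ z, 0 ≤ ρ z
  integral_eq_one : ∫ z, ρ z = 1
  support_subset : ∀ z, ρ z ≠ 0 → 0 < z.2 ∧ z.2 ≤ δ ∧ ‖z.1‖ ≤ δ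

lemma exists_isForwardKernel (d : ℕ) {δ : ℝ} (hδ : 0 < δ) :
    ∃ ρ : (Fin d → ℝ) × ℝ → ℝ, IsForwardKernel δ ρ := by
  let b : ContDiffBump (((0 : Fin d → ℝ), δ / 2) : (Fin d → ℝ) × ℝ) :=
    ⟨δ / 8, δ / 4, by positivity, by linarith⟩
  refine ⟨b.normed volume, b.contDiff_normed (n := 1), b.hasCompactSupport_normed,
    b.nonneg_normed, b.integral_normed, fun z hz => ?_⟩
  have h1 : z ∈ Metric.ball (((0 : Fin d → ℝ), δ / 2) : (Fin d → ℝ) × ℝ) (δ / 4) := by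
    rw [← show Function.support (b.normed volume) = _ from b.support_normed_eq]
    exact hz
  rw [Metric.mem_ball, Prod.dist_eq, max_lt_iff, dist_zero_right, Real.dist_eq, abs_lt] at h1
  exact ⟨by linarith [h1.2.1], by linarith [h1.2.2], by linarith [h1.1]⟩

namespace IsForwardKernel

variable {d : ℕ} {δ : ℝ} {ρ : (Fin d → ℝ) × ℝ → ℝ}

lemma continuous (hρ : IsForwardKernel δ ρ) : Continuous ρ := hρ.contDiff.continuous

lemma integrable (hρ : IsForwardKernel δ ρ) : Integrable ρ :=
  hρ.continuous.integrable_of_hasCompactSupport hρ.hasCompactSupport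

end IsForwardKernel

/-- Bounded sequences have weak-* convergent subsequences. -/
lemma exists_subseq_tendsto_integral_mul {d : ℕ} {M : ℝ} {w : ℕ → (Fin d → ℝ) × ℝ → ℝ}
    (hw : ∀ n, MeasurableBounded M (w n)) :
    ∃ φ : ℕ → ℕ, StrictMono φ ∧ ∀ ρ : (Fin d → ℝ) × ℝ → ℝ, Integrable ρ →
      ∃ L, Filter.Tendsto (fun n => ∫ q, w (φ n) q * ρ q) Filter.atTop (nhds L) := by
  have hM : 0 ≤ M := (abs_nonneg _).trans ((hw 0).2 0)
  let V := Lp ℝ 1 (volume : Measure ((Fin d → ℝ) × ℝ))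
  have : Fact ((1 : ENNReal) ≠ ⊤) := ⟨by simp⟩
  have : TopologicalSpace.SeparableSpace V := inferInstance
  have hint : ∀ n (g : V), Integrable fun q => w n q * g q := fun n g =>
    (L1.integrable_coeFn g).bdd_mul (hw n).1.aestronglyMeasurable
      (Filter.Eventually.of_forall (hw n).2)
  let Λ₀ : ℕ → V →ₗ[ℝ] ℝ := fun n =>
    { toFun := fun g => ∫ q, w n q * g q
      map_add' := fun g g' => by
        rw [← integral_add (hint n g) (hint n g')]
        refine integral_congr_ae ?_
        filter_upwards [Lp.coeFn_add g g'] with q hq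
        rw [hq, Pi.add_apply, mul_add]
      map_smul' := fun c g => by
        rw [RingHom.id_apply, smul_eq_mul, ← integral_const_mul]
        refine integral_congr_ae ?_
        filter_upwards [Lp.coeFn_smul c g] with q hq
        rw [hq, Pi.smul_apply, smul_eq_mul]
        ring }
  have hΛ₀ : ∀ n g, ‖Λ₀ n g‖ ≤ M * ‖g‖ := fun n g => by
      rw [L1.norm_eq_integral_norm, ← integral_const_mul]
      refine norm_integral_le_of_norm_le ((L1.integrable_coeFn g).norm.const_mul M)
        (Filter.Eventually.of_forall fun q => ?_)
      rw [norm_mul]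
      exact mul_le_mul_of_nonneg_right ((hw n).2 q) (norm_nonneg _)
  let Λ : ℕ → StrongDual ℝ V := fun n => (Λ₀ n).mkContinuous M (hΛ₀ n)
  have hΛ : ∀ n, StrongDual.toWeakDual (Λ n) ∈
      WeakDual.toStrongDual ⁻¹' Metric.closedBall (0 : StrongDual ℝ V) M := fun n => by
    simp only [Set.mem_preimage, mem_closedBall_zero_iff]
    exact LinearMap.mkContinuous_norm_le (Λ₀ n) hM (hΛ₀ n)
  obtain ⟨L, -, φ, hφ, hL⟩ := WeakDual.isSeqCompact_closedBall ℝ V 0 M hΛ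
  refine ⟨φ, hφ, fun ρ hρ => ⟨L (hρ.toL1 ρ), ?_⟩⟩
  have h1 := ((WeakDual.eval_continuous (𝕜 := ℝ) (hρ.toL1 ρ)).tendsto L).comp hL
  refine h1.congr fun n => ?_
  change ∫ q, w (φ n) q * (hρ.toL1 ρ) q = _
  refine integral_congr_ae ?_
  filter_upwards [hρ.coeFn_toL1] with q hq
  rw [hq]

/-- The average of `w` forward in time, with respect to a kernel. -/
noncomputable def forwardAverage {d : ℕ} (ρ w : (Fin d → ℝ) × ℝ → ℝ) (p : (Fin d → ℝ) × ℝ) : ℝ :=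
  ∫ q, w q * ρ (q - p)

section forwardAverage

variable {d : ℕ} {M δ : ℝ} {ρ w : (Fin d → ℝ) × ℝ → ℝ}

lemma forwardAverage_eq (p : (Fin d → ℝ) × ℝ) :
    forwardAverage ρ w p = ∫ z, w (p + z) * ρ z := by
  have h1 := integral_add_right_eq_self (μ := volume) (fun q => w q * ρ (q - p)) p
  rw [forwardAverage, ← h1]
  simp [add_comm]

lemma measurableBounded_forwardAverage (hρ : IsForwardKernel δ ρ) (hw : MeasurableBounded M w) :
    MeasurableBounded M (forwardAverage ρ w) := by
  constructor
  · have h1 : Measurable fun r : ((Fin d → ℝ) × ℝ) × ((Fin d → ℝ) × ℝ) =>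
        w r.2 * ρ (r.2 - r.1) := by
      have := hw.1
      have := hρ.continuous.measurable
      fun_prop
    exact (h1.stronglyMeasurable.integral_prod_right').measurable
  · intro p
    rw [forwardAverage_eq, ← Real.norm_eq_abs]
    refine (norm_integral_le_of_norm_le (hρ.integrable.const_mul M)
      (Filter.Eventually.of_forall fun z => ?_)).trans ?_
    · rw [norm_mul, Real.norm_of_nonneg (hρ.nonneg z)]
      exact mul_le_mul_of_nonneg_right (hw.2 _) (hρ.nonneg z)
    · rw [integral_const_mul, hρ.integral_eq_one, mul_one]

lemma weightedDist_forwardAverage_le (hρ : IsForwardKernel δ ρ) (hw : MeasurableBounded M w)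
    {ε t : ℝ} (hmod : ∀ τ, 0 ≤ τ → τ ≤ δ → ∀ z : Fin d → ℝ, ‖z‖ ≤ δ →
      weightedDist (fun x => w (x + z, t + τ)) (fun x => w (x, t)) ≤ ε) :
    weightedDist (fun x => w (x, t)) (fun x => forwardAverage ρ w (x, t)) ≤ ε := by
  have hM : 0 ≤ M := (abs_nonneg _).trans (hw.2 0)
  have hwm := hw.1
  have hρm := hρ.continuous.measurable
  have hp : Measurable fun x : Fin d → ℝ => (x, t) := by fun_prop
  have hm1 : ∀ x, Measurable fun z => |w ((x, t) + z) - w (x, t)| := fun x => by fun_prop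
  have hm2 : ∀ x, Measurable fun z => w ((x, t) + z) := fun x => by fun_prop
  have hm3 : Measurable fun r : (Fin d → ℝ) × ((Fin d → ℝ) × ℝ) =>
    |w ((r.1, t) + r.2) - w (r.1, t)| := by fun_prop
  have hi : ∀ x, Integrable fun z => |w ((x, t) + z) - w (x, t)| * ρ z := fun x =>
    hρ.integrable.bdd_mul (c := 2 * M) (hm1 x).aestronglyMeasurable (Filter.Eventually.of_forall fun z => by
      rw [Real.norm_eq_abs, abs_abs]
      exact (hw.comp (g := fun _ : Unit => (x, t) + z) measurable_const).abs_sub_le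
        (hw.comp (g := fun _ : Unit => (x, t)) measurable_const) ())
  have hF : Integrable (Function.uncurry fun (x : Fin d → ℝ) (z : (Fin d → ℝ) × ℝ) =>
      |w ((x, t) + z) - w (x, t)| * ρ z) ((weightedVolume d).prod volume) := by
    refine (hρ.integrable.comp_snd (weightedVolume d)).bdd_mul (c := 2 * M)
      (f := fun r : (Fin d → ℝ) × ((Fin d → ℝ) × ℝ) => |w ((r.1, t) + r.2) - w (r.1, t)|)
      hm3.aestronglyMeasurable (Filter.Eventually.of_forall fun r => ?_)
    rw [Real.norm_eq_abs, abs_abs]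
    exact (hw.comp (g := fun _ : Unit => (r.1, t) + r.2) measurable_const).abs_sub_le
      (hw.comp (g := fun _ : Unit => (r.1, t)) measurable_const) ()
  have h1 : ∀ x, |w (x, t) - forwardAverage ρ w (x, t)| ≤
      ∫ z, |w ((x, t) + z) - w (x, t)| * ρ z := fun x => by
    have h2 : w (x, t) - forwardAverage ρ w (x, t) =
        ∫ z, (w (x, t) - w ((x, t) + z)) * ρ z := by
      simp only [sub_mul]
      rw [integral_sub (hρ.integrable.const_mul _), integral_const_mul, hρ.integral_eq_one,
        mul_one, forwardAverage_eq]
      exact hρ.integrable.bdd_mul (c := M) (hm2 x).aestronglyMeasurable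
        (Filter.Eventually.of_forall fun z => hw.2 _)
    rw [h2, ← Real.norm_eq_abs]
    refine norm_integral_le_of_norm_le (hi x) (Filter.Eventually.of_forall fun z => ?_)
    rw [norm_mul, Real.norm_of_nonneg (hρ.nonneg z), Real.norm_eq_abs, abs_sub_comm]
  calc weightedDist (fun x => w (x, t)) (fun x => forwardAverage ρ w (x, t))
      ≤ ∫ x, (∫ z, |w ((x, t) + z) - w (x, t)| * ρ z) ∂weightedVolume d :=
        integral_mono ((hw.comp hp).integrable_abs_sub
          ((measurableBounded_forwardAverage hρ hw).comp hp)) hF.integral_prod_left h1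
    _ = ∫ z, (∫ x, |w ((x, t) + z) - w (x, t)| * ρ z ∂weightedVolume d) :=
        integral_integral_swap hF
    _ ≤ ∫ z, ε * ρ z := by
        refine integral_mono hF.integral_prod_right (hρ.integrable.const_mul ε) fun z => ?_
        simp only
        rw [integral_mul_const]
        by_cases hz : ρ z = 0
        · simp [hz]
        · obtain ⟨hz1, hz2, hz3⟩ := hρ.support_subset z hz
          exact mul_le_mul_of_nonneg_right (hmod z.2 hz1.le hz2 z.1 hz3) (hρ.nonneg z)
    _ = ε := by rw [integral_const_mul, hρ.integral_eq_one, mul_one]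

end forwardAverage

lemma tendsto_weightedDist_of_ae_tendsto {d : ℕ} {M : ℝ} {w : ℕ → (Fin d → ℝ) → ℝ}
    {v : (Fin d → ℝ) → ℝ} (hw : ∀ n, MeasurableBounded M (w n)) (hv : MeasurableBounded M v)
    (h : ∀ᵐ x ∂weightedVolume d, Filter.Tendsto (fun n => w n x) Filter.atTop (nhds (v x))) :
    Filter.Tendsto (fun n => weightedDist (w n) v) Filter.atTop (nhds 0) := by
  have h1 : ∫ _x : Fin d → ℝ, (0 : ℝ) ∂weightedVolume d = 0 := by simp
  rw [← h1]
  refine tendsto_integral_of_dominated_convergence (fun _ => 2 * M)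
    (fun n => ((hw n).measurable_abs_sub hv).aestronglyMeasurable) (integrable_const _)
    (fun n => Filter.Eventually.of_forall fun x => ?_) ?_
  · rw [Real.norm_eq_abs, abs_abs]
    exact (hw n).abs_sub_le hv x
  · filter_upwards [h] with x hx
    simpa using (hx.sub_const (v x)).abs

lemma ae_tendsto_of_weightedDist_le {d : ℕ} {M C : ℝ} {w : ℕ → (Fin d → ℝ) → ℝ}
    (hw : ∀ n, MeasurableBounded M (w n))
    (h : ∀ k n m, k ≤ n → k ≤ m → weightedDist (w n) (w m) ≤ C * (1 / 2) ^ k) :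
    ∀ᵐ x ∂weightedVolume d, ∃ l, Filter.Tendsto (fun n => w n x) Filter.atTop (nhds l) := by
  have hC : 0 ≤ C := by
    have := weightedDist_nonneg.trans (h 0 0 0 le_rfl le_rfl)
    simpa using this
  have hs : Summable fun k : ℕ => (C + 1) * (1 / 2 : ℝ) ^ k :=
    summable_geometric_two.mul_left _
  refine Lp.ae_tendsto_of_cauchy_eLpNorm (p := 1) (B := fun k => ENNReal.ofReal ((C + 1) * (1 / 2) ^ k))
    (fun n => (hw n).1.aestronglyMeasurable) le_rfl hs.tsum_ofReal_ne_top fun k n m hn hm => ?_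
  rw [eLpNorm_one_eq_lintegral_enorm, ← ofReal_integral_norm_eq_lintegral_enorm]
  · refine (ENNReal.ofReal_lt_ofReal_iff (by positivity)).2 ((h k n m hn hm).trans_lt ?_)
    exact mul_lt_mul_of_pos_right (by linarith) (by positivity)
  · exact (integrable_of_abs_le (hw n).1 (hw n).2).sub (integrable_of_abs_le (hw m).1 (hw m).2)

/-- A bounded sequence with a uniform forward modulus of continuity in weighted `L¹` has a
subsequence converging at each time. -/
lemma exists_subseq_tendsto_weightedDist {d : ℕ} {M : ℝ} {w : ℕ → (Fin d → ℝ) × ℝ → ℝ}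
    (hw : ∀ n, MeasurableBounded M (w n))
    (hmod : ∀ T ε : ℝ, 0 < ε → ∃ δ > 0, ∃ N, ∀ n ≥ N, ∀ t τ, 0 ≤ t → t ≤ T → 0 ≤ τ → τ ≤ δ →
      ∀ z : Fin d → ℝ, ‖z‖ ≤ δ →
        weightedDist (fun x => w n (x + z, t + τ)) (fun x => w n (x, t)) ≤ ε) :
    ∃ φ : ℕ → ℕ, StrictMono φ ∧ ∃ u, MeasurableBounded M u ∧ ∀ t, 0 ≤ t →
      Filter.Tendsto (fun n => weightedDist (fun x => w (φ n) (x, t)) (fun x => u (x, t)))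
        Filter.atTop (nhds 0) := by
  have hM : 0 ≤ M := (abs_nonneg _).trans ((hw 0).2 0)
  have hp : ∀ t : ℝ, Measurable fun x : Fin d → ℝ => (x, t) := fun t => by fun_prop
  choose δ hδ N hN using fun j : ℕ => hmod j ((1 / 2) ^ j) (by positivity)
  choose ρ hρ using fun j => exists_isForwardKernel d (hδ j)
  obtain ⟨φ, hφ, hL⟩ := exists_subseq_tendsto_integral_mul hw
  choose B hB using fun (j : ℕ) (p : (Fin d → ℝ) × ℝ) =>
    hL (fun q => ρ j (q - p)) ((hρ j).integrable.comp_sub_right p)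
  have hA : ∀ j n, MeasurableBounded M (forwardAverage (ρ j) (w n)) := fun j n =>
    measurableBounded_forwardAverage (hρ j) (hw n)
  have hBm : ∀ j, MeasurableBounded M (B j) := fun j =>
    ⟨measurable_of_tendsto_metrizable (fun n => (hA j (φ n)).1)
      (tendsto_pi_nhds.2 fun p => hB j p),
      fun p => le_of_tendsto (hB j p).abs (Filter.Eventually.of_forall fun n => (hA j (φ n)).2 p)⟩
  have h1 : ∀ (j : ℕ) (t : ℝ), 0 ≤ t → t ≤ j → ∀ᶠ n in Filter.atTop,
      weightedDist (fun x => w (φ n) (x, t)) (fun x => B j (x, t)) ≤ 2 * (1 / 2) ^ j := by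
    intro j t ht htj
    have h2 := tendsto_weightedDist_of_ae_tendsto (fun n => (hA j (φ n)).comp (hp t))
      ((hBm j).comp (hp t)) (Filter.Eventually.of_forall fun x => hB j (x, t))
    filter_upwards [h2.eventually_le_const (show (0 : ℝ) < (1 / 2) ^ j by positivity),
      hφ.tendsto_atTop.eventually_ge_atTop (N j)] with n hn1 hn2
    have h3 := weightedDist_forwardAverage_le (t := t) (hρ j) (hw (φ n)) fun τ hτ hτ' z hz =>
      hN j (φ n) hn2 t τ ht htj hτ hτ' z hz
    have h4 := weightedDist_triangle ((hw (φ n)).comp (hp t)) ((hA j (φ n)).comp (hp t))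
      ((hBm j).comp (hp t))
    linarith
  have h2 : ∀ (i j : ℕ) (t : ℝ), 0 ≤ t → t ≤ i → t ≤ j →
      weightedDist (fun x => B i (x, t)) (fun x => B j (x, t)) ≤
        2 * (1 / 2) ^ i + 2 * (1 / 2) ^ j := by
    intro i j t ht hi hj
    obtain ⟨n, hn1, hn2⟩ := ((h1 i t ht hi).and (h1 j t ht hj)).exists
    have h4 := weightedDist_triangle ((hBm i).comp (hp t)) ((hw (φ n)).comp (hp t))
      ((hBm j).comp (hp t))
    rw [weightedDist_comm] at hn1
    linarith
  let u : (Fin d → ℝ) × ℝ → ℝ := fun p =>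
    max (-M) (min M (Filter.limsup (fun j => B j p) Filter.atTop))
  have hu : MeasurableBounded M u := by
    have hl : Measurable fun p => Filter.limsup (fun j => B j p) Filter.atTop :=
      Measurable.limsup fun j => (hBm j).1
    refine ⟨measurable_const.max (measurable_const.min hl), fun p => abs_le.2 ⟨le_max_left _ _,
      max_le (by linarith) (min_le_left _ _)⟩⟩
  have h3 : ∀ t : ℝ, 0 ≤ t → Filter.Tendsto
      (fun j => weightedDist (fun x => B j (x, t)) (fun x => u (x, t))) Filter.atTop (nhds 0) := by
    intro t ht
    refine tendsto_weightedDist_of_ae_tendsto (fun j => (hBm j).comp (hp t)) (hu.comp (hp t)) ?_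
    obtain ⟨J, hJ⟩ := exists_nat_ge t
    have h4 := ae_tendsto_of_weightedDist_le (C := 4) (w := fun j x => B (j + J) (x, t))
      (fun j => (hBm _).comp (hp t)) fun k n m hn hm => by
        have hq : ∀ n ≥ k, ((1 : ℝ) / 2) ^ (n + J) ≤ (1 / 2) ^ k := fun n hn =>
          pow_le_pow_of_le_one (by norm_num) (by norm_num) (by omega)
        refine (h2 _ _ t ht ?_ ?_).trans (by linarith [hq n hn, hq m hm]) <;>
        · push_cast
          linarith [n.cast_nonneg (α := ℝ), m.cast_nonneg (α := ℝ)]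
    filter_upwards [h4] with x ⟨l, hl⟩
    rw [Filter.tendsto_add_atTop_iff_nat (f := fun j => B j (x, t))] at hl
    have h5 : u (x, t) = l := by
      have h6 := abs_le.1 (le_of_tendsto hl.abs
        (Filter.Eventually.of_forall fun j => (hBm j).2 (x, t)))
      change max (-M) (min M (Filter.limsup (fun j => B j (x, t)) Filter.atTop)) = l
      rw [hl.limsup_eq, min_eq_right h6.2, max_eq_right h6.1]
    rwa [h5]
  refine ⟨φ, hφ, u, hu, fun t ht => ?_⟩
  refine tendsto_order.2 ⟨fun a ha => Filter.Eventually.of_forall fun n =>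
    ha.trans_le weightedDist_nonneg, fun a ha => ?_⟩
  have h4 : Filter.Tendsto (fun j : ℕ => 2 * (1 / 2 : ℝ) ^ j +
      weightedDist (fun x => B j (x, t)) (fun x => u (x, t))) Filter.atTop (nhds 0) := by
    simpa using ((tendsto_pow_atTop_nhds_zero_of_lt_one (r := (1 / 2 : ℝ)) (by norm_num)
      (by norm_num)).const_mul 2).add (h3 t ht)
  obtain ⟨j, hj1, hj2⟩ := ((h4.eventually_lt_const ha).and
    (tendsto_natCast_atTop_atTop.eventually_ge_atTop t)).exists
  filter_upwards [h1 j t ht hj2] with n hn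
  have h5 := weightedDist_triangle ((hw (φ n)).comp (hp t)) ((hBm j).comp (hp t))
    (hu.comp (hp t))
  linarith

/-- Uniform continuity in weighted `L¹` under space-time translations forward in time. -/
def HasForwardModulus {d : ℕ} (u : (Fin d → ℝ) × ℝ → ℝ) : Prop :=
  ∀ T ε : ℝ, 0 < ε → ∃ δ > 0, ∀ t τ, 0 ≤ t → t ≤ T → 0 ≤ τ → τ ≤ δ →
    ∀ z : Fin d → ℝ, ‖z‖ ≤ δ →
      weightedDist (fun x => u (x + z, t + τ)) (fun x => u (x, t)) ≤ ε

namespace MonotoneScheme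

variable {d : ℕ} {ι : Type} [Fintype ι] {S : MonotoneScheme d ι} {u₀ : (Fin d → ℝ) → ℝ}

variable (S) in
/-- `u` is the limit of approximate solutions with initial data `u₀` and mesh sizes `h n`. -/
structure IsLimit (u₀ : (Fin d → ℝ) → ℝ) (h : ℕ → ℝ) (u : (Fin d → ℝ) × ℝ → ℝ) : Prop where
  pos : ∀ n, 0 < h n
  le_one : ∀ n, h n ≤ 1
  tendsto_mesh : Filter.Tendsto h Filter.atTop (nhds 0)
  measurableBounded : MeasurableBounded S.M u
  tendsto : ∀ t, 0 ≤ t → Filter.Tendsto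
    (fun n => weightedDist (fun x => S.approx (h n) u₀ x t) (fun x => u (x, t)))
    Filter.atTop (nhds 0)

lemma exists_isLimit (hu₀ : MeasurableBounded S.M u₀) :
    ∃ h u, S.IsLimit u₀ h u ∧ HasForwardModulus u := by
  let w : ℕ → (Fin d → ℝ) × ℝ → ℝ := fun n p => S.approx (1 / ((n : ℝ) + 1)) u₀ p.1 p.2
  have hw : ∀ n, MeasurableBounded S.M (w n) := fun n => measurableBounded_approx hu₀ _
  have hp : ∀ t : ℝ, Measurable fun x : Fin d → ℝ => (x, t) := fun t => by fun_prop
  have hpz : ∀ (t : ℝ) (z : Fin d → ℝ), Measurable fun x : Fin d → ℝ => (x + z, t) :=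
    fun t z => by fun_prop
  have hmod : ∀ T ε : ℝ, 0 < ε → ∃ δ > 0, ∃ N, ∀ n ≥ N, ∀ t τ, 0 ≤ t → t ≤ T → 0 ≤ τ → τ ≤ δ →
      ∀ z : Fin d → ℝ, ‖z‖ ≤ δ →
        weightedDist (fun x => w n (x + z, t + τ)) (fun x => w n (x, t)) ≤ ε := by
    intro T ε hε
    obtain ⟨δ, hδ, H⟩ := exists_approx_modulus hu₀ T hε
    obtain ⟨N, hN⟩ := exists_nat_one_div_lt hδ
    refine ⟨δ, hδ, N, fun n hn => H _ (by positivity) (le_trans ?_ hN.le)⟩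
    exact one_div_le_one_div_of_le (by positivity) (by gcongr)
  obtain ⟨φ, hφ, u, hu, hlim⟩ := exists_subseq_tendsto_weightedDist hw hmod
  refine ⟨fun n => 1 / ((φ n : ℝ) + 1), u, ⟨fun n => by positivity, fun n => ?_, ?_, hu, hlim⟩, ?_⟩
  · rw [div_le_one (by positivity)]
    linarith [(φ n).cast_nonneg (α := ℝ)]
  · exact tendsto_one_div_add_atTop_nhds_zero_nat.comp hφ.tendsto_atTop
  · intro T ε hε
    obtain ⟨δ, hδ, N, hN⟩ := hmod T ε hε
    refine ⟨δ, hδ, fun t τ ht htT hτ hτδ z hz => ?_⟩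
    have h1 : Filter.Tendsto (fun n => Real.exp ((d + 1) * ‖z‖) *
        weightedDist (fun x => w (φ n) (x, t + τ)) (fun x => u (x, t + τ)) + ε +
        weightedDist (fun x => w (φ n) (x, t)) (fun x => u (x, t))) Filter.atTop (nhds ε) := by
      simpa using (((hlim (t + τ) (by positivity)).const_mul _).add_const ε).add (hlim t ht)
    refine ge_of_tendsto h1 ?_
    filter_upwards [hφ.tendsto_atTop.eventually_ge_atTop N] with n hn
    have h2 := weightedDist_comp_add_le ((hw (φ n)).comp (hp (t + τ))) (hu.comp (hp (t + τ))) z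
    have h3 := hN (φ n) hn t τ ht htT hτ hτδ z hz
    have h4 := weightedDist_triangle (hu.comp (hpz (t + τ) z)) ((hw (φ n)).comp (hpz (t + τ) z))
      (hu.comp (hp t))
    have h5 := weightedDist_triangle ((hw (φ n)).comp (hpz (t + τ) z)) ((hw (φ n)).comp (hp t))
      (hu.comp (hp t))
    rw [weightedDist_comm] at h2
    rw [weightedDist_comm (u := fun x => u (x + z, t + τ))
      (v := fun x => w (φ n) (x + z, t + τ))] at h4
    rw [weightedDist_comm] at h2
    linarith

/-- Limits in weighted `L¹` at each time are local limits in `L¹` of space-time. -/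
lemma IsLimit.tendsto_integral_indicator {h : ℕ → ℝ} {u : (Fin d → ℝ) × ℝ → ℝ}
    (hu₀ : MeasurableBounded S.M u₀) (hu : S.IsLimit u₀ h u) (R : ℝ) :
    Filter.Tendsto (fun n => ∫ p : (Fin d → ℝ) × ℝ,
      Set.indicator (Metric.closedBall 0 R ×ˢ Set.Icc 0 R)
        (fun p => |S.approx (h n) u₀ p.1 p.2 - u p|) p) Filter.atTop (nhds 0) := by
  obtain ⟨C, hC, H⟩ := exists_integral_le_weightedVolume (d := d) R
  have hub := hu.measurableBounded
  have hw : ∀ n, MeasurableBounded S.M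
    (fun p : (Fin d → ℝ) × ℝ => S.approx (h n) u₀ p.1 p.2) := fun n =>
    measurableBounded_approx hu₀ _
  have hp : ∀ t : ℝ, Measurable fun x : Fin d → ℝ => (x, t) := fun t => by fun_prop
  have hm : ∀ n, Measurable fun p : (Fin d → ℝ) × ℝ => |S.approx (h n) u₀ p.1 p.2 - u p| :=
    fun n => (hw n).measurable_abs_sub hub
  let D : ℕ → ℝ → ℝ := fun n t =>
    weightedDist (fun x => S.approx (h n) u₀ x t) (fun x => u (x, t))
  have hDm : ∀ n, Measurable (D n) := fun n =>
    ((hm n).stronglyMeasurable.integral_prod_left' (μ := weightedVolume d)).measurable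
  have hDb : ∀ n t, D n t ≤ 2 * S.M * (weightedVolume d).real Set.univ := fun n t =>
    weightedDist_le_of_abs_le fun x => (hw n).abs_sub_le hub (x, t)
  have hdom : Integrable ((Set.Icc 0 R).indicator fun _ : ℝ =>
      C * (2 * S.M * (weightedVolume d).real Set.univ)) := by
    rw [integrable_indicator_iff measurableSet_Icc]
    exact integrableOn_const (by simp)
  have hDle : ∀ n t, ‖(Set.Icc 0 R).indicator (fun t => C * D n t) t‖ ≤
      (Set.Icc 0 R).indicator (fun _ : ℝ => C * (2 * S.M * (weightedVolume d).real Set.univ)) t := by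
    intro n t
    rw [Set.indicator_apply, Set.indicator_apply]
    split_ifs
    · rw [Real.norm_of_nonneg (mul_nonneg hC weightedDist_nonneg)]
      exact mul_le_mul_of_nonneg_left (hDb n t) hC
    · simp
  have hDi : ∀ n, Measurable ((Set.Icc 0 R).indicator fun t => C * D n t) := fun n =>
    ((hDm n).const_mul C).indicator measurableSet_Icc
  have h1 : Filter.Tendsto (fun n => ∫ t, (Set.Icc 0 R).indicator (fun t => C * D n t) t)
      Filter.atTop (nhds (∫ _t : ℝ, (0 : ℝ))) := by
    refine tendsto_integral_of_dominated_convergence _ (fun n => (hDi n).aestronglyMeasurable)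
      hdom (fun n => Filter.Eventually.of_forall (hDle n)) (Filter.Eventually.of_forall fun t => ?_)
    by_cases ht : t ∈ Set.Icc 0 R
    · simp only [Set.indicator_of_mem ht]
      simpa using (hu.tendsto t ht.1).const_mul C
    · simp only [Set.indicator_of_notMem ht]
      exact tendsto_const_nhds
  rw [integral_zero] at h1
  refine squeeze_zero (fun n => integral_nonneg fun p =>
    Set.indicator_nonneg (fun _ _ => abs_nonneg _) p) (fun n => ?_) h1
  have hK : MeasurableSet (Metric.closedBall (0 : Fin d → ℝ) R ×ˢ Set.Icc 0 R) :=
    Metric.isClosed_closedBall.measurableSet.prod measurableSet_Icc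
  have hKf : volume (Metric.closedBall (0 : Fin d → ℝ) R ×ˢ Set.Icc 0 R) ≠ ⊤ :=
    ((isCompact_closedBall _ _).prod isCompact_Icc).measure_lt_top.ne
  have hint : Integrable ((Metric.closedBall (0 : Fin d → ℝ) R ×ˢ Set.Icc 0 R).indicator
      fun p => |S.approx (h n) u₀ p.1 p.2 - u p|) := by
    rw [integrable_indicator_iff hK]
    refine Measure.integrableOn_of_bounded (M := 2 * S.M) hKf (hm n).aestronglyMeasurable
      (Filter.Eventually.of_forall fun p => ?_)
    rw [Real.norm_eq_abs, abs_abs]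
    exact (hw n).abs_sub_le hub p
  rw [Measure.volume_eq_prod, integral_prod_symm _ hint]
  refine integral_mono_of_nonneg (Filter.Eventually.of_forall fun t => integral_nonneg fun x =>
    Set.indicator_nonneg (fun _ _ => abs_nonneg _) _)
    (hdom.mono' (hDi n).aestronglyMeasurable (Filter.Eventually.of_forall (hDle n)))
    (Filter.Eventually.of_forall fun t => ?_)
  by_cases ht : t ∈ Set.Icc 0 R
  · simp only [Set.indicator_of_mem ht]
    refine H (F := fun x => |S.approx (h n) u₀ x t - u (x, t)|) ((hm n).comp (hp t))
      ⟨2 * S.M, fun x => ?_⟩ (fun x => Set.indicator_nonneg (fun _ _ => abs_nonneg _) _)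
      (fun x => Set.indicator_le_self' (fun _ _ => abs_nonneg _) _) fun x hx => ?_
    · rw [abs_abs]
      exact (hw n).abs_sub_le hub (x, t)
    · simpa using (Set.mem_of_indicator_ne_zero hx).1
  · simp [Set.mem_prod, ht]

end MonotoneScheme

lemma Real.measurable_sign : Measurable Real.sign := by
  unfold Real.sign
  exact Measurable.ite measurableSet_Iio measurable_const
    (Measurable.ite measurableSet_Ioi measurable_const measurable_const)

lemma Real.sign_mul_self_eq_abs (a : ℝ) : Real.sign a * a = |a| := by
  rcases lt_trichotomy a 0 with h | h | h
  · rw [Real.sign_of_neg h, abs_of_neg h]; ring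
  · simp [h]
  · rw [Real.sign_of_pos h, abs_of_pos h]; ring

lemma Real.abs_sign_le_one (a : ℝ) : |Real.sign a| ≤ 1 := by
  rcases Real.sign_apply_eq a with h | h | h <;> simp [h]

namespace MonotoneScheme

variable {d : ℕ} {ι : Type} [Fintype ι] {S : MonotoneScheme d ι} {u₀ : (Fin d → ℝ) → ℝ}

variable (S) in
/-- The contribution of the `j`-th neighbour to the entropy `|· - c|`. -/
noncomputable def entropyPart (c : ℝ) (j : ι) (a : ℝ) : ℝ :=
  Real.sign (a - c) * (S.g j a - S.g j c)

lemma sum_entropyPart (c a : ℝ) : ∑ j, S.entropyPart c j a = |a - c| := by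
  simp only [entropyPart]
  rw [← Finset.mul_sum, Finset.sum_sub_distrib, S.sum_g, S.sum_g, Real.sign_mul_self_eq_abs]

lemma measurable_entropyPart (c : ℝ) (j : ι) : Measurable (S.entropyPart c j) := by
  have h1 := (S.continuous_g j).measurable
  exact (Real.measurable_sign.comp (measurable_id.sub_const c)).mul (h1.sub_const _)

lemma entropyPart_eq_abs {c a : ℝ} (hc : c ∈ Set.Icc (-S.M) S.M) (ha : a ∈ Set.Icc (-S.M) S.M)
    (j : ι) : S.entropyPart c j a = |S.g j a - S.g j c| := by
  rw [entropyPart]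
  rcases lt_trichotomy a c with h | h | h
  · rw [Real.sign_of_neg (by linarith), abs_of_nonpos]
    · ring
    · linarith [S.monotoneOn_g j ha hc h.le]
  · simp [h]
  · rw [Real.sign_of_pos (by linarith), abs_of_nonneg]
    · ring
    · linarith [S.monotoneOn_g j hc ha h.le]

lemma abs_entropyPart_sub_le {c a b : ℝ} (ha : a ∈ Set.Icc (-S.M) S.M)
    (hb : b ∈ Set.Icc (-S.M) S.M) (j : ι) :
    |S.entropyPart c j a - S.entropyPart c j b| ≤ |a - b| := by
  refine le_trans ?_ (S.abs_g_sub_le ha hb j)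
  by_cases hc : c ∈ Set.Icc (-S.M) S.M
  · rw [entropyPart_eq_abs hc ha, entropyPart_eq_abs hc hb]
    refine (abs_abs_sub_abs_le _ _).trans_eq ?_
    congr 1
    ring
  · have h1 : Real.sign (a - c) = Real.sign (b - c) := by
      rw [Set.mem_Icc, not_and_or, not_le, not_le] at hc
      rcases hc with hc | hc
      · rw [Real.sign_of_pos (by linarith [ha.1]), Real.sign_of_pos (by linarith [hb.1])]
      · rw [Real.sign_of_neg (by linarith [ha.2]), Real.sign_of_neg (by linarith [hb.2])]
    rw [entropyPart, entropyPart, h1, ← mul_sub, sub_sub_sub_cancel_right, abs_mul]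
    exact mul_le_of_le_one_left (abs_nonneg _) (Real.abs_sign_le_one _)

lemma abs_entropyPart_le {c a : ℝ} (ha : a ∈ Set.Icc (-S.M) S.M) (j : ι) :
    |S.entropyPart c j a| ≤ S.M + |S.entropyPart c j 0| := by
  have h0 : (0 : ℝ) ∈ Set.Icc (-S.M) S.M := ⟨by linarith [ha.1, ha.2], by linarith [ha.1, ha.2]⟩
  have h1 := abs_entropyPart_sub_le (c := c) ha h0 j
  rw [sub_zero] at h1
  have h2 := abs_sub_abs_le_abs_sub (S.entropyPart c j a) (S.entropyPart c j 0)
  have h3 : |a| ≤ S.M := abs_le.2 ha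
  linarith

lemma abs_step_sub_le_sum_entropyPart {u : (Fin d → ℝ) → ℝ} (hu : MeasurableBounded S.M u) (c h : ℝ)
    (x : Fin d → ℝ) :
    |S.step h u x - c| ≤ ∑ j, S.entropyPart c j (u (x + h • S.e j)) := by
  have h1 : S.step h u x - c = ∑ j, (S.g j (u (x + h • S.e j)) - S.g j c) := by
    rw [Finset.sum_sub_distrib, S.sum_g, step]
  by_cases hc : c ∈ Set.Icc (-S.M) S.M
  · rw [h1]
    refine (Finset.abs_sum_le_sum_abs _ _).trans (Finset.sum_le_sum fun j _ => ?_)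
    rw [entropyPart_eq_abs hc (hu.mem_Icc _)]
  · have h2 := (measurableBounded_step hu h).mem_Icc x
    have h3 := fun y => hu.mem_Icc y
    rw [Set.mem_Icc, not_and_or, not_le, not_le] at hc
    rcases hc with hc | hc
    · rw [abs_of_pos (by linarith [h2.1]), h1]
      refine Finset.sum_le_sum fun j _ => ?_
      rw [entropyPart, Real.sign_of_pos (by linarith [(h3 (x + h • S.e j)).1]), one_mul]
    · rw [abs_of_neg (by linarith [h2.2]), h1, ← Finset.sum_neg_distrib]
      refine Finset.sum_le_sum fun j _ => ?_
      rw [entropyPart, Real.sign_of_neg (by linarith [(h3 (x + h • S.e j)).2]), neg_one_mul]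

variable (S) in
/-- The space-time displacement of the `j`-th neighbour. -/
def displacement (j : ι) : (Fin d → ℝ) × ℝ := (-S.e j, 1)

lemma norm_displacement_le (j : ι) : ‖S.displacement j‖ ≤ S.κ + 1 := by
  have := S.norm_e_le j
  have := S.κ_nonneg
  rw [displacement, Prod.norm_def]
  simp only [norm_neg, norm_one]
  exact max_le (by linarith) (by linarith)

variable (S) in
/-- The entropy contribution of the `j`-th neighbour of `w`, extended by zero to negative times. -/
noncomputable def entropyField (c : ℝ) (w : (Fin d → ℝ) × ℝ → ℝ) (j : ι) :
    (Fin d → ℝ) × ℝ → ℝ :=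
  (Prod.snd ⁻¹' Set.Ici 0).indicator fun p => S.entropyPart c j (w p)

lemma measurableBounded_entropyField {w : (Fin d → ℝ) × ℝ → ℝ} (hw : MeasurableBounded S.M w)
    (c : ℝ) (j : ι) :
    MeasurableBounded (S.M + |S.entropyPart c j 0|) (S.entropyField c w j) := by
  refine ⟨((measurable_entropyPart c j).comp hw.1).indicator (measurable_snd measurableSet_Ici),
    fun p => ?_⟩
  classical
  rw [entropyField, Set.indicator_apply]
  split_ifs
  · exact abs_entropyPart_le (hw.mem_Icc p) j
  · have := (abs_nonneg _).trans (hw.2 p)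
    rw [abs_zero]
    positivity

lemma approx_of_lt {h t : ℝ} (h0 : 0 ≤ t) (ht : t < h) (x : Fin d → ℝ) :
    S.approx h u₀ x t = u₀ x := by
  have : ⌊t / h⌋₊ = 0 := Nat.floor_eq_zero.2 ((div_lt_one (h0.trans_lt ht)).2 ht)
  rw [approx, this, Function.iterate_zero_apply]

lemma approx_of_le {h t : ℝ} (hh : 0 < h) (ht : h ≤ t) (x : Fin d → ℝ) :
    S.approx h u₀ x t = S.step h (fun x => S.approx h u₀ x (t - h)) x := by
  have : ⌊t / h⌋₊ = ⌊(t - h) / h⌋₊ + 1 := by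
    rw [← Nat.floor_add_one (div_nonneg (by linarith) hh.le)]
    congr 1
    field_simp
    ring
  rw [approx, this, Function.iterate_succ_apply']
  rfl

/-- The discrete entropy inequality, pointwise. -/
lemma sum_entropyField_le (hu₀ : MeasurableBounded S.M u₀) (c : ℝ) {h : ℝ} (hh : 0 < h)
    (p : (Fin d → ℝ) × ℝ) :
    ∑ j, S.entropyField c (fun p => S.approx h u₀ p.1 p.2) j p ≤
      ∑ j, S.entropyField c (fun p => S.approx h u₀ p.1 p.2) j (p - h • S.displacement j) +
        (Prod.snd ⁻¹' Set.Ico 0 h).indicator (fun p => |u₀ p.1 - c|) p := by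
  classical
  have h1 : ∀ j, (p - h • S.displacement j).2 = p.2 - h := fun j => by simp [displacement]
  have h2 : ∀ j, (p - h • S.displacement j).1 = p.1 + h • S.e j := fun j => by
    simp [displacement]
  simp only [entropyField, Set.indicator_apply, Set.mem_preimage, Set.mem_Ici, Set.mem_Ico, h1, h2,
    sub_nonneg]
  rcases lt_or_ge p.2 0 with h0 | h0
  · simp [h0.not_ge, (h0.trans hh).not_ge]
  rcases lt_or_ge p.2 h with hlt | hge
  · simp only [h0, hlt, hlt.not_ge, if_true, if_false, Finset.sum_const_zero, and_self, zero_add,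
      sum_entropyPart]
    rw [approx_of_lt h0 hlt]
  · simp only [h0, hge, hge.not_gt, if_true, if_false, and_false, add_zero, sum_entropyPart]
    rw [approx_of_le hh hge]
    exact abs_step_sub_le_sum_entropyPart (measurableBounded_approx_apply hu₀ h _) c h p.1

end MonotoneScheme

lemma HasCompactSupport.exists_norm_le {E : Type*} [NormedAddCommGroup E] {φ : E → ℝ}
    (hφ : HasCompactSupport φ) : ∃ R, 0 ≤ R ∧ ∀ p, φ p ≠ 0 → ‖p‖ ≤ R := by
  obtain ⟨R, hR⟩ := hφ.isCompact.isBounded.exists_norm_le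
  refine ⟨max R 0, le_max_right _ _, fun p hp => (hR p ?_).trans (le_max_left _ _)⟩
  exact subset_tsupport φ hp

/-- The boundary layer at the initial time is controlled by the initial trace. -/
lemma exists_integral_indicator_le {d : ℕ} {b : ℝ} {a : (Fin d → ℝ) → ℝ}
    (ha : MeasurableBounded b a) (ha0 : ∀ x, 0 ≤ a x) {φ : (Fin d → ℝ) × ℝ → ℝ} {L : NNReal}
    (hφ : LipschitzWith L φ) (hφc : HasCompactSupport φ) :
    ∃ C, ∀ h, 0 < h → ∫ p, (Prod.snd ⁻¹' Set.Ico 0 h).indicator (fun p => a p.1) p * φ p ≤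
      h * ((∫ x, a x * φ (x, 0)) + h * C) := by
  obtain ⟨R, -, hR⟩ := hφc.exists_norm_le
  have hKf : volume (Metric.closedBall (0 : Fin d → ℝ) R) ≠ ⊤ :=
    (isCompact_closedBall _ _).measure_lt_top.ne
  have hR1 : ∀ x t, φ (x, t) ≠ 0 → x ∈ Metric.closedBall (0 : Fin d → ℝ) R := fun x t h => by
    rw [mem_closedBall_zero_iff]
    exact (norm_fst_le (x, t)).trans (hR _ h)
  have hφi : Integrable φ := hφ.continuous.integrable_of_hasCompactSupport hφc
  have hB : Integrable ((Metric.closedBall (0 : Fin d → ℝ) R).indicator fun x => a x * L) := by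
    rw [integrable_indicator_iff Metric.isClosed_closedBall.measurableSet]
    refine Measure.integrableOn_of_bounded (M := b * L) hKf (ha.1.mul_const _).aestronglyMeasurable
      (Filter.Eventually.of_forall fun x => ?_)
    rw [norm_mul, NNReal.norm_eq]
    exact mul_le_mul_of_nonneg_right (ha.2 x) L.2
  have hs : ∀ t, Integrable fun x => a x * φ (x, t) := fun t => by
    have hc : Continuous fun x : Fin d → ℝ => φ (x, t) := hφ.continuous.comp (by fun_prop)
    refine (hc.integrable_of_hasCompactSupport ?_).bdd_mul (c := b) ha.1.aestronglyMeasurable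
      (Filter.Eventually.of_forall ha.2)
    exact HasCompactSupport.intro (isCompact_closedBall 0 R) fun x hx => by
      by_contra h
      exact hx (hR1 x t h)
  refine ⟨∫ x, (Metric.closedBall (0 : Fin d → ℝ) R).indicator (fun x => a x * L) x, fun h hh => ?_⟩
  have hm : Measurable ((Prod.snd ⁻¹' Set.Ico 0 h).indicator
      fun p : (Fin d → ℝ) × ℝ => a p.1) :=
    (ha.1.comp measurable_fst).indicator (measurable_snd measurableSet_Ico)
  have hint : Integrable fun p : (Fin d → ℝ) × ℝ =>
      (Prod.snd ⁻¹' Set.Ico 0 h).indicator (fun p => a p.1) p * φ p := by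
    refine hφi.bdd_mul (c := b) hm.aestronglyMeasurable (Filter.Eventually.of_forall fun p => ?_)
    exact (norm_indicator_le_norm_self _ _).trans (ha.2 p.1)
  rw [Measure.volume_eq_prod] at hint ⊢
  rw [integral_prod_symm _ hint]
  set J := (∫ x, a x * φ (x, 0)) + h * _ with hJ
  have h1 : h * J = ∫ t, (Set.Ico 0 h).indicator (fun _ => J) t := by
    rw [integral_indicator measurableSet_Ico]
    simp [hh.le]
  rw [h1]
  refine integral_mono hint.integral_prod_right ?_ fun t => ?_
  · rw [integrable_indicator_iff measurableSet_Ico]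
    exact integrableOn_const (by simp)
  by_cases ht : t ∈ Set.Ico 0 h
  · have h2 : ∀ x : Fin d → ℝ, (Prod.snd ⁻¹' Set.Ico 0 h).indicator
        (fun p : (Fin d → ℝ) × ℝ => a p.1) (x, t) = a x := fun x =>
      Set.indicator_of_mem (show (x, t) ∈ Prod.snd ⁻¹' Set.Ico 0 h from ht) _
    simp only [h2, Set.indicator_of_mem ht]
    rw [hJ, ← integral_const_mul, ← integral_add (hs 0) (hB.const_mul h)]
    refine integral_mono (hs t) ((hs 0).add (hB.const_mul h)) fun x => ?_
    have h3 := hφ.dist_le_mul (x, t) (x, 0)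
    rw [Prod.dist_eq, dist_self, Real.dist_eq, Real.dist_eq, sub_zero,
      max_eq_right (abs_nonneg _), abs_of_nonneg ht.1] at h3
    have h3' := (le_abs_self _).trans h3
    have h4 : (L : ℝ) * t ≤ L * h := mul_le_mul_of_nonneg_left ht.2.le L.2
    simp only
    by_cases hx : x ∈ Metric.closedBall (0 : Fin d → ℝ) R
    · rw [Set.indicator_of_mem hx]
      nlinarith [ha0 x]
    · have h5 : ∀ t, φ (x, t) = 0 := fun t => by
        by_contra h
        exact hx (hR1 x t h)
      simp [h5, Set.indicator_of_notMem hx]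
  · have h2 : ∀ x : Fin d → ℝ, (Prod.snd ⁻¹' Set.Ico 0 h).indicator
        (fun p : (Fin d → ℝ) × ℝ => a p.1) (x, t) = 0 := fun x =>
      Set.indicator_of_notMem (show (x, t) ∉ Prod.snd ⁻¹' Set.Ico 0 h from ht) _
    simp [h2, Set.indicator_of_notMem ht]

namespace MonotoneScheme

variable {d : ℕ} {ι : Type} [Fintype ι] {S : MonotoneScheme d ι} {u₀ : (Fin d → ℝ) → ℝ}

/-- The discrete entropy inequality in weak form. -/
lemma integral_entropyField_nonneg (hu₀ : MeasurableBounded S.M u₀) (c : ℝ) {h : ℝ} (hh : 0 < h)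
    {φ : (Fin d → ℝ) × ℝ → ℝ} (hφ : Continuous φ) (hφc : HasCompactSupport φ)
    (hφ0 : ∀ p, 0 ≤ φ p) :
    0 ≤ (∑ j, ∫ p, S.entropyField c (fun p => S.approx h u₀ p.1 p.2) j p *
        (φ (p + h • S.displacement j) - φ p)) +
      ∫ p, (Prod.snd ⁻¹' Set.Ico 0 h).indicator (fun p => |u₀ p.1 - c|) p * φ p := by
  set W := S.entropyField c (fun p => S.approx h u₀ p.1 p.2) with hW
  have hWb : ∀ j, MeasurableBounded _ (W j) := fun j =>
    measurableBounded_entropyField (measurableBounded_approx hu₀ h) c j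
  have hφi : Integrable φ := hφ.integrable_of_hasCompactSupport hφc
  have h1 : ∀ j q, Integrable fun p => W j p * φ (p + q) := fun j q =>
    (hφi.comp_add_right q).bdd_mul (hWb j).1.aestronglyMeasurable
      (Filter.Eventually.of_forall (hWb j).2)
  have h2 : ∀ j q, Integrable fun p => W j (p - q) * φ p := fun j q => by
    simpa using (h1 j q).comp_sub_right q
  have h2' : ∀ j q, ∫ p, W j (p - q) * φ p = ∫ p, W j p * φ (p + q) := fun j q => by
    have := integral_sub_right_eq_self (μ := volume) (fun p => W j p * φ (p + q)) q
    simpa using this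
  have h3 : ∀ j, Integrable fun p => W j p * φ p := fun j => by simpa using h1 j 0
  have hm : Measurable ((Prod.snd ⁻¹' Set.Ico 0 h).indicator
      fun p : (Fin d → ℝ) × ℝ => |u₀ p.1 - c|) := by
    have := hu₀.1
    exact Measurable.indicator (by fun_prop) (measurable_snd measurableSet_Ico)
  have h4 : Integrable fun p : (Fin d → ℝ) × ℝ =>
      (Prod.snd ⁻¹' Set.Ico 0 h).indicator (fun p => |u₀ p.1 - c|) p * φ p := by
    refine hφi.bdd_mul (c := S.M + |c|) hm.aestronglyMeasurable
      (Filter.Eventually.of_forall fun p => (norm_indicator_le_norm_self _ _).trans ?_)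
    rw [Real.norm_eq_abs, abs_abs]
    exact (abs_sub _ _).trans (add_le_add_left (hu₀.2 _) _)
  have h5 : ∀ j, ∫ p, W j p * (φ (p + h • S.displacement j) - φ p) =
      (∫ p, W j (p - h • S.displacement j) * φ p) - ∫ p, W j p * φ p := fun j => by
    rw [h2', ← integral_sub (h1 j _) (h3 j)]
    simp only [mul_sub]
  simp only [h5]
  rw [Finset.sum_sub_distrib, ← integral_finsetSum _ fun j _ => h2 j _,
    ← integral_finsetSum _ fun j _ => h3 j, sub_add_eq_add_sub, sub_nonneg,
    ← integral_add (integrable_finsetSum _ fun j _ => h2 j _) h4]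
  refine integral_mono (integrable_finsetSum _ fun j _ => h3 j)
    ((integrable_finsetSum _ fun j _ => h2 j _).add h4) fun p => ?_
  simp only
  rw [← Finset.sum_mul, ← Finset.sum_mul, ← add_mul]
  exact mul_le_mul_of_nonneg_right (sum_entropyField_le hu₀ c hh p) (hφ0 p)

lemma IsLimit.tendsto_integral_entropyField (hu₀ : MeasurableBounded S.M u₀) {h : ℕ → ℝ}
    {u : (Fin d → ℝ) × ℝ → ℝ} (hu : S.IsLimit u₀ h u) (c : ℝ) (j : ι)
    {φ : (Fin d → ℝ) × ℝ → ℝ} {L : NNReal} (hφ : LipschitzWith L φ) (hφc : HasCompactSupport φ) :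
    Filter.Tendsto (fun n => ∫ p, S.entropyField c (fun p => S.approx (h n) u₀ p.1 p.2) j p *
        ((h n)⁻¹ * (φ (p + h n • S.displacement j) - φ p))) Filter.atTop
      (nhds (∫ p, S.entropyField c u j p * fderiv ℝ φ p (S.displacement j))) := by
  have hκ := S.κ_nonneg
  set a := S.displacement j with ha
  set Q : ℕ → (Fin d → ℝ) × ℝ → ℝ := fun n p => (h n)⁻¹ * (φ (p + h n • a) - φ p) with hQ
  set W : ℕ → (Fin d → ℝ) × ℝ → ℝ :=
    fun n => S.entropyField c (fun p => S.approx (h n) u₀ p.1 p.2) j with hW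
  set V := S.entropyField c u j with hV
  set b := S.M + |S.entropyPart c j 0| with hb
  have hWb : ∀ n, MeasurableBounded b (W n) := fun n =>
    measurableBounded_entropyField (measurableBounded_approx hu₀ (h n)) c j
  have hVb : MeasurableBounded b V := measurableBounded_entropyField hu.measurableBounded c j
  have hb0 : 0 ≤ b := (abs_nonneg _).trans (hVb.2 0)
  obtain ⟨R, hR0, hR⟩ := hφc.exists_norm_le
  set R' := R + (S.κ + 1) with hR'
  have hQm : ∀ n, Measurable (Q n) := fun n => by
    have := hφ.continuous.measurable
    fun_prop
  have hQb : ∀ n p, |Q n p| ≤ L * (S.κ + 1) := fun n p => by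
    have h1 := hφ.dist_le_mul (p + h n • a) p
    have h2 := hu.pos n
    rw [dist_eq_norm, dist_eq_norm, add_sub_cancel_left, norm_smul, Real.norm_of_nonneg h2.le] at h1
    rw [hQ, abs_mul, abs_of_pos (inv_pos.2 h2), inv_mul_le_iff₀ h2]
    refine h1.trans ?_
    have h3 : h n * ‖a‖ ≤ h n * (S.κ + 1) := mul_le_mul_of_nonneg_left (norm_displacement_le j) h2.le
    nlinarith [L.2]
  have hQs : ∀ n p, Q n p ≠ 0 → ‖p‖ ≤ R' := fun n p hp => by
    by_contra! h1
    have h2 : φ p = 0 := by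
      by_contra h3
      linarith [hR p h3]
    have h3 : φ (p + h n • a) = 0 := by
      by_contra h3
      have h4 := norm_sub_le (p + h n • a) (h n • a)
      rw [add_sub_cancel_right, norm_smul, Real.norm_of_nonneg (hu.pos n).le] at h4
      have h5 : h n * ‖a‖ ≤ 1 * (S.κ + 1) :=
        mul_le_mul (hu.le_one n) (norm_displacement_le j) (norm_nonneg _) zero_le_one
      linarith [hR _ h3]
    exact hp (by simp [hQ, h2, h3])
  have hdom : Integrable ((Metric.closedBall (0 : (Fin d → ℝ) × ℝ) R').indicator fun _ =>
      L * (S.κ + 1)) := by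
    rw [integrable_indicator_iff Metric.isClosed_closedBall.measurableSet]
    exact integrableOn_const (isCompact_closedBall _ _).measure_lt_top.ne
  have hQd : ∀ n p, ‖Q n p‖ ≤ (Metric.closedBall (0 : (Fin d → ℝ) × ℝ) R').indicator (fun _ =>
      L * (S.κ + 1)) p := fun n p => by
    by_cases hp : Q n p = 0
    · rw [hp, norm_zero]
      exact Set.indicator_nonneg (fun _ _ => by positivity) _
    · rw [Set.indicator_of_mem (mem_closedBall_zero_iff.2 (hQs n p hp))]
      exact hQb n p
  have hQi : ∀ n, Integrable (Q n) := fun n =>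
    hdom.mono' (hQm n).aestronglyMeasurable (Filter.Eventually.of_forall (hQd n))
  have h1 : Filter.Tendsto (fun n => ∫ p, V p * Q n p) Filter.atTop
      (nhds (∫ p, V p * fderiv ℝ φ p a)) := by
    refine tendsto_integral_of_dominated_convergence _
      (fun n => (hVb.1.mul (hQm n)).aestronglyMeasurable) (hdom.const_mul b)
      (fun n => Filter.Eventually.of_forall fun p => ?_) ?_
    · rw [norm_mul]
      exact mul_le_mul (hVb.2 p) (hQd n p) (norm_nonneg _) hb0
    · filter_upwards [hφ.ae_differentiableAt (μ := volume)] with p hp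
      refine Filter.Tendsto.const_mul _ ?_
      have h2 := (hp.hasFDerivAt.hasLineDerivAt a).tendsto_slope_zero
      refine h2.comp (tendsto_nhdsWithin_iff.2 ⟨hu.tendsto_mesh,
        Filter.Eventually.of_forall fun n => (hu.pos n).ne'⟩)
  have h2 : Filter.Tendsto (fun n => ∫ p, (W n p - V p) * Q n p) Filter.atTop (nhds 0) := by
    have h3 := (hu.tendsto_integral_indicator hu₀ R').mul_const (L * (S.κ + 1))
    rw [zero_mul] at h3
    refine squeeze_zero_norm (fun n => ?_) h3
    rw [← integral_mul_const]
    have hm := (measurableBounded_approx hu₀ (h n)).measurable_abs_sub hu.measurableBounded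
    have hK : MeasurableSet (Metric.closedBall (0 : Fin d → ℝ) R' ×ˢ Set.Icc 0 R') :=
      Metric.isClosed_closedBall.measurableSet.prod measurableSet_Icc
    refine norm_integral_le_of_norm_le (Integrable.mul_const ?_ _)
      (Filter.Eventually.of_forall fun p => ?_)
    · rw [integrable_indicator_iff hK]
      refine Measure.integrableOn_of_bounded (M := 2 * S.M)
        ((isCompact_closedBall _ _).prod isCompact_Icc).measure_lt_top.ne hm.aestronglyMeasurable
        (Filter.Eventually.of_forall fun p => ?_)
      rw [Real.norm_eq_abs, abs_abs]
      exact (measurableBounded_approx hu₀ (h n)).abs_sub_le hu.measurableBounded p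
    · have h0 : 0 ≤ (Metric.closedBall (0 : Fin d → ℝ) R' ×ˢ Set.Icc 0 R').indicator
          (fun p => |S.approx (h n) u₀ p.1 p.2 - u p|) p * (L * (S.κ + 1)) :=
        mul_nonneg (Set.indicator_nonneg (fun _ _ => abs_nonneg _) _) (by positivity)
      by_cases hp : Q n p = 0
      · rwa [hp, mul_zero, norm_zero]
      by_cases ht : 0 ≤ p.2
      · have hpR := hQs n p hp
        have hmem : p ∈ Metric.closedBall (0 : Fin d → ℝ) R' ×ˢ Set.Icc 0 R' :=
          ⟨mem_closedBall_zero_iff.2 ((norm_fst_le p).trans hpR), ht,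
            (le_abs_self _).trans ((norm_snd_le p).trans hpR)⟩
        rw [Set.indicator_of_mem hmem, norm_mul]
        refine mul_le_mul ?_ (hQb n p) (norm_nonneg _) (abs_nonneg _)
        have hmem' : p ∈ Prod.snd ⁻¹' Set.Ici (0 : ℝ) := ht
        simp only [hW, hV, entropyField, Set.indicator_of_mem hmem']
        exact abs_entropyPart_sub_le ((measurableBounded_approx hu₀ (h n)).mem_Icc p)
          (hu.measurableBounded.mem_Icc p) j
      · have hmem' : p ∉ Prod.snd ⁻¹' Set.Ici (0 : ℝ) := ht
        simp only [hW, hV, entropyField, Set.indicator_of_notMem hmem', sub_zero, zero_mul,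
          norm_zero]
        exact h0
  have h3 := h1.add h2
  rw [add_zero] at h3
  refine h3.congr fun n => ?_
  rw [← integral_add]
  · refine integral_congr_ae (Filter.Eventually.of_forall fun p => ?_)
    simp only
    ring
  · exact (hQi n).bdd_mul hVb.1.aestronglyMeasurable (Filter.Eventually.of_forall hVb.2)
  · exact (hQi n).bdd_mul ((hWb n).1.sub hVb.1).aestronglyMeasurable
      (Filter.Eventually.of_forall ((hWb n).abs_sub_le hVb))

/-- Limits of monotone schemes satisfy entropy inequalities. -/
theorem IsLimit.integral_entropyField_nonneg (hu₀ : MeasurableBounded S.M u₀) {h : ℕ → ℝ}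
    {u : (Fin d → ℝ) × ℝ → ℝ} (hu : S.IsLimit u₀ h u) (c : ℝ)
    {φ : (Fin d → ℝ) × ℝ → ℝ} {L : NNReal} (hφ : LipschitzWith L φ) (hφc : HasCompactSupport φ)
    (hφ0 : ∀ p, 0 ≤ φ p) :
    0 ≤ (∑ j, ∫ p, S.entropyField c u j p * fderiv ℝ φ p (S.displacement j)) +
      ∫ x, |u₀ x - c| * φ (x, 0) := by
  have hab : MeasurableBounded (S.M + |c|) fun x => |u₀ x - c| := by
    have := hu₀.1
    refine ⟨by fun_prop, fun x => ?_⟩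
    rw [abs_abs]
    exact (abs_sub _ _).trans (add_le_add_left (hu₀.2 _) _)
  obtain ⟨C, hC⟩ := exists_integral_indicator_le hab (fun x => abs_nonneg _) hφ hφc
  have h1 := tendsto_finsetSum Finset.univ fun j _ =>
    hu.tendsto_integral_entropyField hu₀ c j hφ hφc
  have h2 := h1.add ((hu.tendsto_mesh.mul_const C).const_add (∫ x, |u₀ x - c| * φ (x, 0)))
  rw [zero_mul, add_zero] at h2
  refine ge_of_tendsto h2 (Filter.Eventually.of_forall fun n => ?_)
  have h3 := MonotoneScheme.integral_entropyField_nonneg hu₀ c (hu.pos n) hφ.continuous hφc hφ0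
  have h4 := hC (h n) (hu.pos n)
  have h5 : ∑ j, ∫ p, S.entropyField c (fun p => S.approx (h n) u₀ p.1 p.2) j p *
      ((h n)⁻¹ * (φ (p + h n • S.displacement j) - φ p)) = (h n)⁻¹ *
      ∑ j, ∫ p, S.entropyField c (fun p => S.approx (h n) u₀ p.1 p.2) j p *
        (φ (p + h n • S.displacement j) - φ p) := by
    rw [Finset.mul_sum]
    refine Finset.sum_congr rfl fun j _ => ?_
    rw [← integral_const_mul]
    refine integral_congr_ae (Filter.Eventually.of_forall fun p => ?_)
    simp only
    ring
  rw [h5]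
  have h6 := hu.pos n
  refine nonneg_of_mul_nonneg_right (a := h n) ?_ h6
  rw [mul_add, mul_inv_cancel_left₀ h6.ne']
  linarith

end MonotoneScheme

/-- The entropy `|· - c|` and its flux, tested against a space-time covector. -/
noncomputable def entropyFlux {d : ℕ} (f : ℝ → (Fin d → ℝ)) (a c : ℝ)
    (ℓ : (Fin d → ℝ) × ℝ →L[ℝ] ℝ) : ℝ :=
  |a - c| * ℓ (0, 1) + ∑ i : Fin d, Real.sign (a - c) * (f a i - f c i) * ℓ (Pi.single i 1, 0)

lemma norm_single_zero_le {d : ℕ} (i : Fin d) : ‖((Pi.single i 1, 0) : (Fin d → ℝ) × ℝ)‖ ≤ 1 := by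
  rw [Prod.norm_def, Pi.norm_single]
  simp

lemma abs_entropyFlux_le {d : ℕ} {f : ℝ → (Fin d → ℝ)} {a c L : ℝ} (h : ‖f a - f c‖ ≤ L * |a - c|)
    (ℓ : (Fin d → ℝ) × ℝ →L[ℝ] ℝ) : |entropyFlux f a c ℓ| ≤ (1 + d * L) * |a - c| * ‖ℓ‖ := by
  have h1 : ‖ℓ (0, 1)‖ ≤ ‖ℓ‖ := by
    simpa [Prod.norm_def] using ℓ.le_opNorm (0, 1)
  have h2 : ∀ i : Fin d, |Real.sign (a - c) * (f a i - f c i) * ℓ (Pi.single i 1, 0)| ≤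
      L * |a - c| * ‖ℓ‖ := fun i => by
    have h3 := ℓ.le_opNorm (Pi.single i 1, 0)
    have h4 : ‖ℓ (Pi.single i 1, 0)‖ ≤ ‖ℓ‖ :=
      h3.trans (mul_le_of_le_one_right (norm_nonneg _) (norm_single_zero_le i))
    have h5 : |f a i - f c i| ≤ L * |a - c| := (norm_le_pi_norm (f a - f c) i).trans h
    rw [abs_mul, abs_mul]
    refine mul_le_mul ?_ h4 (abs_nonneg _) ((abs_nonneg _).trans h5)
    exact (mul_le_of_le_one_left (abs_nonneg _) (Real.abs_sign_le_one _)).trans h5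
  have h3 : |∑ i : Fin d, Real.sign (a - c) * (f a i - f c i) * ℓ (Pi.single i 1, 0)| ≤
      d * (L * |a - c| * ‖ℓ‖) := by
    refine (Finset.abs_sum_le_sum_abs _ _).trans ((Finset.sum_le_sum fun i _ => h2 i).trans ?_)
    simp
  have h4 : |(|a - c| * ℓ (0, 1))| ≤ |a - c| * ‖ℓ‖ := by
    rw [abs_mul, abs_abs]
    exact mul_le_mul_of_nonneg_left h1 (abs_nonneg _)
  refine (abs_add_le _ _).trans ?_
  nlinarith

lemma LocallyLipschitz.exists_norm_sub_le {d : ℕ} {f : ℝ → (Fin d → ℝ)} (hf : LocallyLipschitz f)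
    (M : ℝ) : ∃ L : ℝ, 0 ≤ L ∧ ∀ a b, |a| ≤ M → |b| ≤ M → ‖f a - f b‖ ≤ L * |a - b| := by
  obtain ⟨L, hL⟩ := (hf.locallyLipschitzOn (s := Set.Icc (-M) M)).exists_lipschitzOnWith_of_compact
    isCompact_Icc
  refine ⟨L, L.2, fun a b ha hb => ?_⟩
  have := hL.dist_le_mul a (abs_le.1 ha) b (abs_le.1 hb)
  rwa [dist_eq_norm, Real.dist_eq] at this

lemma HasCompactSupport.integrable_of_norm_le {X F : Type*} [TopologicalSpace X]
    [MeasurableSpace X] [OpensMeasurableSpace X] [R1Space X] {μ : Measure X}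
    [IsFiniteMeasureOnCompacts μ] [NormedAddCommGroup F]
    {g : X → F} {C : ℝ} (hg : HasCompactSupport g) (hgm : AEStronglyMeasurable g μ)
    (hC : ∀ x, ‖g x‖ ≤ C) : Integrable g μ :=
  (integrableOn_iff_integrable_of_support_subset (subset_tsupport g)).1
    (Measure.integrableOn_of_bounded hg.isCompact.measure_lt_top.ne hgm
      (Filter.Eventually.of_forall hC))

section Lipschitz

variable {d : ℕ} {φ : (Fin d → ℝ) × ℝ → ℝ} {L : NNReal}

lemma integrable_fderiv_of_lipschitzWith (hφ : LipschitzWith L φ) (hφc : HasCompactSupport φ) :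
    Integrable (fderiv ℝ φ) :=
  HasCompactSupport.integrable_of_norm_le (hφc.fderiv (𝕜 := ℝ))
    (measurable_fderiv ℝ φ).aestronglyMeasurable fun _ => norm_fderiv_le_of_lipschitz ℝ hφ

end Lipschitz

lemma Measurable.entropyFlux {α : Type*} [MeasurableSpace α] {d : ℕ} {f : ℝ → (Fin d → ℝ)}
    (hf : Continuous f) {a c : α → ℝ} {ℓ : α → (Fin d → ℝ) × ℝ →L[ℝ] ℝ} (ha : Measurable a)
    (hc : Measurable c) (hℓ : Measurable ℓ) :
    Measurable fun r => entropyFlux f (a r) (c r) (ℓ r) := by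
  have h1 : ∀ v, Measurable fun r => ℓ r v := fun v =>
    (ContinuousLinearMap.apply ℝ ℝ v).continuous.measurable.comp hℓ
  have h2 : Measurable fun r => Real.sign (a r - c r) := Real.measurable_sign.comp (ha.sub hc)
  have h3 : ∀ i, Measurable fun r => f (a r) i := fun i =>
    (measurable_pi_apply i).comp (hf.measurable.comp ha)
  have h4 : ∀ i, Measurable fun r => f (c r) i := fun i =>
    (measurable_pi_apply i).comp (hf.measurable.comp hc)
  unfold _root_.entropyFlux
  refine Measurable.add ?_ (Finset.measurable_sum _ fun i _ => ?_)
  · exact Measurable.mul (by fun_prop) (h1 _)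
  · exact (h2.mul ((h3 i).sub (h4 i))).mul (h1 _)

section KruzkovIntegral

variable {d : ℕ} {f : ℝ → (Fin d → ℝ)} {M : ℝ} {u : (Fin d → ℝ) × ℝ → ℝ}

lemma integrable_entropyFlux (hf : LocallyLipschitz f) (hu : MeasurableBounded M u) (c : ℝ)
    {φ : (Fin d → ℝ) × ℝ → ℝ} {L : NNReal} (hφ : LipschitzWith L φ) (hφc : HasCompactSupport φ) :
    Integrable fun p => entropyFlux f (u p) c (fderiv ℝ φ p) := by
  obtain ⟨K, hK0, hK⟩ := hf.exists_norm_sub_le (max M |c|)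
  refine ((integrable_fderiv_of_lipschitzWith hφ hφc).norm.const_mul
    ((1 + d * K) * (M + |c|))).mono' ?_ (Filter.Eventually.of_forall fun p => ?_)
  · exact (hu.1.entropyFlux hf.continuous measurable_const
      (measurable_fderiv ℝ φ)).aestronglyMeasurable
  · refine (abs_entropyFlux_le (hK (u p) c ((hu.2 p).trans (le_max_left _ _))
      (le_max_right _ _)) _).trans ?_
    gcongr
    exact (abs_sub _ _).trans (add_le_add_left (hu.2 p) _)

lemma setIntegral_integral_eq_integral_indicator {G : (Fin d → ℝ) × ℝ → ℝ} (hG : Integrable G)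
    {s : Set ℝ} (hs : MeasurableSet s) :
    ∫ t in s, ∫ x, G (x, t) = ∫ p, (Prod.snd ⁻¹' s).indicator G p := by
  have h1 : Integrable ((Prod.snd ⁻¹' s).indicator G) := hG.indicator (measurable_snd hs)
  rw [Measure.volume_eq_prod] at h1 ⊢
  rw [integral_prod_symm _ h1, ← integral_indicator hs]
  congr 1
  ext t
  by_cases ht : t ∈ s
  · simp [ht]
  · simp [ht]

end KruzkovIntegral

/-- The Lax–Friedrichs scheme for a flux `f` that is `L`-Lipschitz on `[-M, M]`. -/
noncomputable def laxFriedrichs {d : ℕ} (hd : 1 ≤ d) {f : ℝ → (Fin d → ℝ)} (hf : Continuous f)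
    {M L : ℝ} (hL0 : 0 ≤ L) (hL : ∀ a b, |a| ≤ M → |b| ≤ M → ‖f a - f b‖ ≤ L * |a - b|) :
    MonotoneScheme d (Fin d × Bool) where
  M := M
  κ := d * L + 1
  g j a := a / (2 * d) + (if j.2 then 1 else -1) * f a j.1 / (2 * (d * L + 1))
  e j := (-(if j.2 then 1 else -1) * (d * L + 1)) • Pi.single j.1 1
  κ_nonneg := by positivity
  continuous_g j := by fun_prop
  monotoneOn_g j a ha b hb hab := by
    have hd' : (0 : ℝ) < d := by exact_mod_cast hd
    have h1 := (norm_le_pi_norm (f a - f b) j.1).trans (hL a b (abs_le.2 ha) (abs_le.2 hb))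
    rw [Pi.sub_apply, Real.norm_eq_abs, abs_sub_comm a b, abs_of_nonneg (by linarith : 0 ≤ b - a)]
      at h1
    have h2 := abs_le.1 h1
    have h3 : ∀ D : ℝ, D ≤ L * (b - a) → D / (2 * (d * L + 1)) ≤ (b - a) / (2 * d) := fun D hD => by
      rw [div_le_div_iff₀ (by positivity) (by positivity)]
      nlinarith [mul_le_mul_of_nonneg_left hD hd'.le]
    simp only
    split_ifs
    · have := h3 (f a j.1 - f b j.1) h2.2
      rw [sub_div, sub_div] at this
      rw [one_mul, one_mul]
      linarith
    · have := h3 (-(f a j.1 - f b j.1)) (by linarith)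
      rw [neg_div, sub_div, sub_div] at this
      rw [neg_one_mul, neg_one_mul, neg_div, neg_div]
      linarith
  sum_g a := by
    have hd' : (d : ℝ) ≠ 0 := by exact_mod_cast (by omega : d ≠ 0)
    rw [Fintype.sum_prod_type]
    simp only [Fintype.sum_bool, if_true, Bool.false_eq_true, if_false]
    have : ∀ i : Fin d, a / (2 * d) + 1 * f a i / (2 * (d * L + 1)) +
        (a / (2 * d) + -1 * f a i / (2 * (d * L + 1))) = a / d := fun i => by
      field_simp
      ring
    simp only [this, Finset.sum_const, Finset.card_univ, Fintype.card_fin, nsmul_eq_mul]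
    field_simp
  norm_e_le j := by
    rw [norm_smul, Pi.norm_single, norm_mul, Real.norm_of_nonneg (by positivity : 0 ≤ d * L + 1)]
    split_ifs <;> simp

lemma sum_entropyPart_laxFriedrichs {d : ℕ} (hd : 1 ≤ d) {f : ℝ → (Fin d → ℝ)} (hf : Continuous f)
    {M L : ℝ} (hL0 : 0 ≤ L) (hL : ∀ a b, |a| ≤ M → |b| ≤ M → ‖f a - f b‖ ≤ L * |a - b|)
    (c a : ℝ) (ℓ : (Fin d → ℝ) × ℝ →L[ℝ] ℝ) :
    ∑ j, (laxFriedrichs hd hf hL0 hL).entropyPart c j a *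
      ℓ ((laxFriedrichs hd hf hL0 hL).displacement j) = entropyFlux f a c ℓ := by
  have hd' : (d : ℝ) ≠ 0 := by exact_mod_cast (by omega : d ≠ 0)
  have hκ : (d : ℝ) * L + 1 ≠ 0 := by positivity
  have h1 : ∀ (r : ℝ) (i : Fin d), ℓ (-(r • Pi.single i 1), 1) =
      ℓ (0, 1) - r * ℓ (Pi.single i 1, 0) := fun r i => by
    rw [← smul_eq_mul, ← map_smul, ← map_sub]
    congr 1
    ext <;> simp
  have h2 : |a - c| * ℓ (0, 1) = ∑ _i : Fin d, |a - c| * ℓ (0, 1) / d := by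
    simp only [Finset.sum_const, Finset.card_univ, Fintype.card_fin, nsmul_eq_mul]
    field_simp
  rw [Fintype.sum_prod_type, entropyFlux, h2, ← Finset.sum_add_distrib]
  refine Finset.sum_congr rfl fun i _ => ?_
  simp only [MonotoneScheme.entropyPart, MonotoneScheme.displacement, laxFriedrichs,
    Fintype.sum_bool, if_true, Bool.false_eq_true, if_false, h1]
  rw [← Real.sign_mul_self_eq_abs]
  field_simp
  ring

/-- Existence of entropy solutions. -/
theorem exists_isKruzkovEntropySolution {d : ℕ} (hd : 1 ≤ d) {f : ℝ → (Fin d → ℝ)}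
    (hf : LocallyLipschitz f) {M : ℝ} {u₀ : (Fin d → ℝ) → ℝ} (hu₀ : MeasurableBounded M u₀) :
    ∃ u : (Fin d → ℝ) × ℝ → ℝ, MeasurableBounded M u ∧ HasForwardModulus u ∧
      IsKruzkovEntropySolution f u₀ (fun x t => u (x, t)) ∧
      (fun x => u (x, 0)) =ᵐ[volume] u₀ := by
  obtain ⟨L, hL0, hL⟩ := hf.exists_norm_sub_le M
  set S := laxFriedrichs hd hf.continuous hL0 hL with hS
  have hu₀' : MeasurableBounded S.M u₀ := hu₀
  obtain ⟨h, u, hu, hmod⟩ := MonotoneScheme.exists_isLimit hu₀'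
  have hub : MeasurableBounded M u := hu.measurableBounded
  refine ⟨u, hub, hmod, ⟨hub.1, ⟨M, fun x t => hub.2 _⟩, ?_⟩, ?_⟩
  · rintro c φ ⟨K, hφ⟩ hφc hφ0
    have h1 := hu.integral_entropyField_nonneg hu₀' c hφ hφc hφ0
    have h2 := fun j => ((ContinuousLinearMap.apply ℝ ℝ (S.displacement j)).integrable_comp
      (integrable_fderiv_of_lipschitzWith hφ hφc)).bdd_mul
      (MonotoneScheme.measurableBounded_entropyField hu.measurableBounded c j).1.aestronglyMeasurable
      (Filter.Eventually.of_forall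
        (MonotoneScheme.measurableBounded_entropyField hu.measurableBounded c j).2)
    simp only [ContinuousLinearMap.apply_apply] at h2
    rw [← integral_finsetSum _ fun j _ => h2 j] at h1
    refine h1.trans_eq (congrArg (· + _) ?_)
    change _ = ∫ t in Set.Ioi (0 : ℝ), ∫ x, (fun p => entropyFlux f (u p) c (fderiv ℝ φ p)) (x, t)
    rw [← integral_Ici_eq_integral_Ioi, setIntegral_integral_eq_integral_indicator
      (integrable_entropyFlux hf hub c hφ hφc) measurableSet_Ici]
    congr 1
    ext p
    by_cases hp : p ∈ Prod.snd ⁻¹' Set.Ici (0 : ℝ)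
    · rw [Set.indicator_of_mem hp]
      simp only [MonotoneScheme.entropyField, Set.indicator_of_mem hp]
      exact sum_entropyPart_laxFriedrichs hd hf.continuous hL0 hL c (u p) _
    · simp [MonotoneScheme.entropyField, Set.indicator_of_notMem hp]
  · have h1 : ∀ n x, S.approx (h n) u₀ x 0 = u₀ x := fun n x =>
      MonotoneScheme.approx_of_lt le_rfl (hu.pos n) x
    have h2 := hu.tendsto 0 le_rfl
    simp only [h1] at h2
    have h3 := tendsto_nhds_unique h2 tendsto_const_nhds
    have hu0 : MeasurableBounded M fun x => u (x, 0) := hub.comp (by fun_prop)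
    rw [weightedDist, eq_comm, integral_eq_zero_iff_of_nonneg (fun _ => abs_nonneg _)
      (hu₀.integrable_abs_sub hu0)] at h3
    filter_upwards [(volume_absolutelyContinuous_weightedVolume d).ae_le h3] with x hx
    have := abs_eq_zero.1 hx
    linarith

section EntropyFluxAlgebra

variable {d : ℕ} {f : ℝ → (Fin d → ℝ)} {a c : ℝ} {ℓ ℓ' : (Fin d → ℝ) × ℝ →L[ℝ] ℝ}

lemma entropyFlux_add : entropyFlux f a c (ℓ + ℓ') = entropyFlux f a c ℓ + entropyFlux f a c ℓ' := by
  simp only [entropyFlux, add_apply, mul_add, Finset.sum_add_distrib]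
  ring

lemma entropyFlux_smul (r : ℝ) : entropyFlux f a c (r • ℓ) = r * entropyFlux f a c ℓ := by
  simp only [entropyFlux, smul_apply, smul_eq_mul, mul_add, Finset.mul_sum]
  congr 1
  · ring
  · exact Finset.sum_congr rfl fun i _ => by ring

lemma entropyFlux_zero : entropyFlux f a c 0 = 0 := by simp [entropyFlux]

lemma entropyFlux_comm : entropyFlux f a c ℓ = entropyFlux f c a ℓ := by
  simp only [entropyFlux]
  rw [abs_sub_comm a c, ← neg_sub c a, Real.sign_neg]
  congr 1
  exact Finset.sum_congr rfl fun i _ => by ring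

end EntropyFluxAlgebra

/-- A backward cone: the cutoff used to localise the contraction estimate. -/
noncomputable def coneCutoff {d : ℕ} (R K : ℝ) (p : (Fin d → ℝ) × ℝ) : ℝ :=
  max 0 (R - ‖p.1‖ - K * |p.2|)

section coneCutoff

variable {d : ℕ} {R K : ℝ} {p : (Fin d → ℝ) × ℝ}

lemma coneCutoff_nonneg : 0 ≤ coneCutoff R K p := le_max_left _ _

lemma abs_coneCutoff_le (hR : 0 ≤ R) (hK : 0 ≤ K) : |coneCutoff R K p| ≤ R := by
  rw [abs_of_nonneg coneCutoff_nonneg]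
  refine max_le hR ?_
  have : 0 ≤ K * |p.2| := by positivity
  linarith [norm_nonneg p.1]

lemma norm_le_of_coneCutoff_ne_zero (hK : 1 ≤ K) (hp : coneCutoff R K p ≠ 0) : ‖p‖ ≤ R := by
  by_contra! h
  refine hp (max_eq_left ?_)
  have h1 : |p.2| ≤ K * |p.2| := le_mul_of_one_le_left (abs_nonneg _) hK
  have h2 := Prod.norm_def p
  rw [Real.norm_eq_abs] at h2
  rcases max_choice ‖p.1‖ |p.2| with h3 | h3 <;> rw [h3] at h2 <;>
    linarith [norm_nonneg p.1, abs_nonneg p.2]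

lemma exists_lipschitzWith_coneCutoff (d : ℕ) (R : ℝ) (hK : 0 ≤ K) :
    ∃ L, LipschitzWith L (coneCutoff (d := d) R K) := by
  refine ⟨1 + K.toNNReal, LipschitzWith.const_max (LipschitzWith.of_dist_le_mul fun p q => ?_) 0⟩
  have h1 : |‖q.1‖ - ‖p.1‖| ≤ ‖p - q‖ :=
    (abs_norm_sub_norm_le _ _).trans ((norm_sub_rev _ _).trans_le (norm_fst_le (p - q)))
  have h2 : |(|q.2| - |p.2|)| ≤ ‖p - q‖ :=
    (abs_abs_sub_abs_le _ _).trans ((abs_sub_comm _ _).trans_le (norm_snd_le (p - q)))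
  rw [Real.dist_eq, dist_eq_norm, NNReal.coe_add, NNReal.coe_one, Real.coe_toNNReal _ hK]
  calc |R - ‖p.1‖ - K * |p.2| - (R - ‖q.1‖ - K * |q.2|)|
      = |(‖q.1‖ - ‖p.1‖) + K * (|q.2| - |p.2|)| := by congr 1; ring
    _ ≤ |‖q.1‖ - ‖p.1‖| + K * |(|q.2| - |p.2|)| := by
        refine (abs_add_le _ _).trans_eq ?_
        rw [abs_mul, abs_of_nonneg hK]
    _ ≤ (1 + K) * ‖p - q‖ := by nlinarith

lemma hasCompactSupport_coneCutoff (hK : 1 ≤ K) : HasCompactSupport (coneCutoff (d := d) R K) :=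
  .of_support_subset_isCompact (isCompact_closedBall 0 R) fun _ hp =>
    mem_closedBall_zero_iff.2 (norm_le_of_coneCutoff_ne_zero hK hp)

lemma abs_fderiv_coneCutoff_single_le (h : DifferentiableAt ℝ (coneCutoff (d := d) R K) p)
    (i : Fin d) : |fderiv ℝ (coneCutoff R K) p (Pi.single i 1, 0)| ≤ 1 := by
  have h1 : HasDerivAt (fun s : ℝ => coneCutoff R K (p + s • (Pi.single i 1, 0)))
    (fderiv ℝ (coneCutoff R K) p (Pi.single i 1, 0)) 0 := h.hasFDerivAt.hasLineDerivAt _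
  refine h1.le_of_lip' zero_le_one (Filter.Eventually.of_forall fun s => ?_)
  rw [Real.norm_eq_abs, zero_smul, add_zero, one_mul, sub_zero, Real.norm_eq_abs]
  refine (abs_max_sub_max_le_max _ _ _ _).trans (max_le (by simp) ?_)
  have h1 := abs_norm_sub_norm_le p.1 (p.1 + s • Pi.single i 1)
  simpa [norm_smul, Pi.norm_single] using h1

lemma fderiv_coneCutoff_time (h : DifferentiableAt ℝ (coneCutoff (d := d) R K) p)
    (hp : 0 < coneCutoff R K p) (ht : 0 < p.2) : fderiv ℝ (coneCutoff R K) p (0, 1) = -K := by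
  have h1 : HasDerivAt (fun s : ℝ => coneCutoff R K (p + s • (0, 1)))
    (fderiv ℝ (coneCutoff R K) p (0, 1)) 0 := h.hasFDerivAt.hasLineDerivAt _
  refine h1.unique ?_
  have h2 : HasDerivAt (fun s : ℝ => R - ‖p.1‖ - K * (p.2 + s)) (-K) 0 := by
    simpa using (((hasDerivAt_id (0 : ℝ)).const_add p.2).const_mul K).const_sub (R - ‖p.1‖)
  refine h2.congr_of_eventuallyEq ?_
  have h3 : ContinuousAt (fun s : ℝ => R - ‖p.1‖ - K * (p.2 + s)) 0 := h2.continuousAt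
  have h4 : 0 < R - ‖p.1‖ - K * |p.2| := by
    by_contra! h5
    rw [coneCutoff, max_eq_left h5] at hp
    exact hp.false
  have h5 : ∀ᶠ s : ℝ in nhds 0, 0 < R - ‖p.1‖ - K * (p.2 + s) :=
    h3.eventually (lt_mem_nhds (by simpa [abs_of_pos ht] using h4))
  have h6 : ∀ᶠ s : ℝ in nhds 0, -p.2 < s := lt_mem_nhds (by linarith)
  filter_upwards [h5, h6] with s hs hs'
  have h7 : |p.2 + s| = p.2 + s := abs_of_pos (by linarith)
  simp only [coneCutoff, Prod.fst_add, Prod.snd_add, Prod.smul_mk, smul_zero, add_zero, smul_eq_mul,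
    mul_one, h7]
  exact max_eq_right hs.le

lemma entropyFlux_fderiv_coneCutoff_le {f : ℝ → (Fin d → ℝ)} {a c L : ℝ}
    (hL : ‖f a - f c‖ ≤ L * |a - c|) (h : DifferentiableAt ℝ (coneCutoff R (d * L + 1)) p)
    (ht : 0 < p.2) : entropyFlux f a c (fderiv ℝ (coneCutoff R (d * L + 1)) p) ≤
      -({p | 0 < coneCutoff R (d * L + 1) p}.indicator 1 p * |a - c|) := by
  by_cases hp : 0 < coneCutoff R (d * L + 1) p
  · rw [Set.indicator_of_mem (by exact hp), entropyFlux, fderiv_coneCutoff_time h hp ht]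
    have h1 : ∑ i : Fin d, Real.sign (a - c) * (f a i - f c i) *
        fderiv ℝ (coneCutoff R (d * L + 1)) p (Pi.single i 1, 0) ≤ ∑ _i : Fin d, L * |a - c| := by
      refine Finset.sum_le_sum fun i _ => (le_abs_self _).trans ?_
      have h5 : |f a i - f c i| ≤ L * |a - c| := (norm_le_pi_norm (f a - f c) i).trans hL
      rw [abs_mul, abs_mul]
      refine (mul_le_of_le_one_right (by positivity)
        (abs_fderiv_coneCutoff_single_le h i)).trans ?_
      exact (mul_le_of_le_one_left (abs_nonneg _) (Real.abs_sign_le_one _)).trans h5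
    simp only [Finset.sum_const, Finset.card_univ, Fintype.card_fin, nsmul_eq_mul] at h1
    rw [Pi.one_apply]
    nlinarith
  · rw [Set.indicator_of_notMem (by exact hp)]
    have h1 : IsLocalMin (coneCutoff R (d * L + 1)) p := Filter.Eventually.of_forall fun q =>
      (not_lt.1 hp).trans coneCutoff_nonneg
    rw [h1.fderiv_eq_zero, entropyFlux_zero]
    simp

end coneCutoff

lemma integrable_of_norm_le_of_support {E F : Type*} [NormedAddCommGroup E] [ProperSpace E]
    [MeasurableSpace E] [OpensMeasurableSpace E] {μ : Measure E} [IsFiniteMeasureOnCompacts μ]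
    [NormedAddCommGroup F] {G : E → F} {C R : ℝ} (hG : AEStronglyMeasurable G μ)
    (hC : ∀ x, ‖G x‖ ≤ C) (hR : ∀ x, G x ≠ 0 → ‖x‖ ≤ R) : Integrable G μ :=
  HasCompactSupport.integrable_of_norm_le
    (.of_support_subset_isCompact (isCompact_closedBall 0 R) fun _ hx =>
      mem_closedBall_zero_iff.2 (hR _ hx)) hG hC

lemma IsKruzkovEntropySolution.integral_indicator_nonneg {d : ℕ} {f : ℝ → (Fin d → ℝ)}
    (hf : LocallyLipschitz f) {u₀ : (Fin d → ℝ) → ℝ} {M : ℝ} {w : (Fin d → ℝ) × ℝ → ℝ}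
    (hw : MeasurableBounded M w) (h : IsKruzkovEntropySolution f u₀ fun x t => w (x, t)) (c : ℝ)
    {φ : (Fin d → ℝ) × ℝ → ℝ} {L : NNReal} (hφ : LipschitzWith L φ) (hφc : HasCompactSupport φ)
    (hφ0 : ∀ p, 0 ≤ φ p) :
    0 ≤ (∫ p, (Prod.snd ⁻¹' Set.Ioi 0).indicator
      (fun p => entropyFlux f (w p) c (fderiv ℝ φ p)) p) + ∫ x, |u₀ x - c| * φ (x, 0) := by
  rw [← setIntegral_integral_eq_integral_indicator (integrable_entropyFlux hf hw c hφ hφc)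
    measurableSet_Ioi]
  exact h.2.2 c φ ⟨L, hφ⟩ hφc hφ0

namespace IsForwardKernel

variable {d : ℕ} {δ : ℝ} {ρ : (Fin d → ℝ) × ℝ → ℝ}

lemma exists_lipschitzWith (hρ : IsForwardKernel δ ρ) : ∃ L, LipschitzWith L ρ :=
  ContDiff.lipschitzWith_of_hasCompactSupport hρ.hasCompactSupport hρ.contDiff one_ne_zero

lemma exists_abs_le (hρ : IsForwardKernel δ ρ) : ∃ B, ∀ z, |ρ z| ≤ B :=
  hρ.hasCompactSupport.exists_bound_of_continuous hρ.continuous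

lemma norm_le (hρ : IsForwardKernel δ ρ) {z : (Fin d → ℝ) × ℝ} (hz : ρ z ≠ 0) : ‖z‖ ≤ δ := by
  obtain ⟨h1, h2, h3⟩ := hρ.support_subset z hz
  rw [Prod.norm_def, Real.norm_of_nonneg h1.le]
  exact max_le h3 h2

lemma fderiv_eq_zero (hρ : IsForwardKernel δ ρ) {z : (Fin d → ℝ) × ℝ} (hz : ρ z = 0) :
    fderiv ℝ ρ z = 0 :=
  IsLocalMin.fderiv_eq_zero (Filter.Eventually.of_forall fun q => hz.trans_le (hρ.nonneg q))

lemma integral_integral_mul_le {X : Type*} [MeasureSpace X] [SFinite (volume : Measure X)]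
    (hρ : IsForwardKernel δ ρ) {ι : X → (Fin d → ℝ) × ℝ} {H : X → (Fin d → ℝ) × ℝ → ℝ} {ε : ℝ}
    (hH : Integrable fun r : X × ((Fin d → ℝ) × ℝ) => H r.1 (ι r.1 + r.2) * ρ r.2)
    (hε : ∀ z, ρ z ≠ 0 → ∫ x, H x (ι x + z) ≤ ε) :
    ∫ x, ∫ q, H x q * ρ (q - ι x) ≤ ε := by
  have h1 : ∀ x, ∫ q, H x q * ρ (q - ι x) = ∫ z, H x (ι x + z) * ρ z := fun x => by
    rw [← integral_add_left_eq_self (fun q => H x q * ρ (q - ι x)) (ι x)]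
    simp
  simp only [h1]
  rw [Measure.volume_eq_prod] at hH
  rw [integral_integral_swap hH]
  calc ∫ z, ∫ x, H x (ι x + z) * ρ z ≤ ∫ z, ε * ρ z := by
        refine integral_mono hH.integral_prod_right (hρ.integrable.const_mul ε) fun z => ?_
        simp only
        rw [integral_mul_const]
        by_cases hz : ρ z = 0
        · simp [hz]
        · exact mul_le_mul_of_nonneg_right (hε z hz) (hρ.nonneg z)
    _ = ε := by rw [integral_const_mul, hρ.integral_eq_one, mul_one]

end IsForwardKernel

section Mul

variable {E : Type*} [NormedAddCommGroup E] {φ ψ : E → ℝ}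

lemma exists_lipschitzWith_mul {K L : NNReal} {A B : ℝ} (hφ : LipschitzWith K φ)
    (hψ : LipschitzWith L ψ) (hA : ∀ x, |φ x| ≤ A) (hB : ∀ x, |ψ x| ≤ B) :
    ∃ N, LipschitzWith N fun x => φ x * ψ x := by
  have hA0 : 0 ≤ A := (abs_nonneg _).trans (hA 0)
  have hB0 : 0 ≤ B := (abs_nonneg _).trans (hB 0)
  refine ⟨A.toNNReal * L + B.toNNReal * K, LipschitzWith.of_dist_le_mul fun x y => ?_⟩
  have h1 := hφ.dist_le_mul x y
  have h2 := hψ.dist_le_mul x y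
  rw [Real.dist_eq] at h1 h2 ⊢
  push_cast
  rw [Real.coe_toNNReal _ hA0, Real.coe_toNNReal _ hB0]
  calc |φ x * ψ x - φ y * ψ y| = |φ x * (ψ x - ψ y) + ψ y * (φ x - φ y)| := by congr 1; ring
    _ ≤ |φ x| * |ψ x - ψ y| + |ψ y| * |φ x - φ y| := by
        rw [← abs_mul, ← abs_mul]; exact abs_add_le _ _
    _ ≤ A * (L * dist x y) + B * (K * dist x y) := by
        gcongr
        · exact hA x
        · exact hB y
    _ = _ := by ring

end Mul

lemma integrable_prod_of_support {X E : Type*} [NormedAddCommGroup X] [ProperSpace X]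
    [MeasureSpace X] [OpensMeasurableSpace X] [SecondCountableTopology X]
    [IsFiniteMeasureOnCompacts (volume : Measure X)] [SFinite (volume : Measure X)]
    [NormedAddCommGroup E] [ProperSpace E] [MeasureSpace E] [OpensMeasurableSpace E]
    [SecondCountableTopology E] [IsFiniteMeasureOnCompacts (volume : Measure E)]
    [SFinite (volume : Measure E)]
    {ι : X → E} (hι : ∀ x, ‖ι x‖ ≤ ‖x‖) {G : X × E → ℝ} {C R δ : ℝ} (hG : Measurable G)
    (hC : ∀ r, |G r| ≤ C) (hs : ∀ r, G r ≠ 0 → ‖r.1‖ ≤ R ∧ ‖r.2 - ι r.1‖ ≤ δ) : Integrable G := by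
  rw [Measure.volume_eq_prod]
  refine integrable_of_norm_le_of_support (C := C) (R := R + δ) hG.aestronglyMeasurable hC
    fun r hr => ?_
  obtain ⟨h1, h2⟩ := hs r hr
  have h3 : ‖r.2‖ ≤ R + δ := by
    have h4 := norm_add_le (r.2 - ι r.1) (ι r.1)
    rw [sub_add_cancel] at h4
    linarith [hι r.1]
  rw [Prod.norm_def]
  exact max_le (by linarith [norm_nonneg (r.2 - ι r.1)]) h3

lemma IsForwardKernel.integrable_mul_comp_sub {X : Type*} [NormedAddCommGroup X] [ProperSpace X]
    [MeasureSpace X] [OpensMeasurableSpace X] [SecondCountableTopology X]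
    [IsFiniteMeasureOnCompacts (volume : Measure X)] [SFinite (volume : Measure X)] {d : ℕ}
    {δ : ℝ} {ρ : (Fin d → ℝ) × ℝ → ℝ} (hρ : IsForwardKernel δ ρ) {ι : X → (Fin d → ℝ) × ℝ}
    (hι : ∀ x, ‖ι x‖ ≤ ‖x‖) (hιm : Measurable ι) {H : X × ((Fin d → ℝ) × ℝ) → ℝ} {C R : ℝ}
    (hH : Measurable H) (hC : ∀ r, |H r| ≤ C) (hR : ∀ r, H r ≠ 0 → ‖r.1‖ ≤ R) :
    Integrable fun r => H r * ρ (r.2 - ι r.1) := by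
  obtain ⟨B, hB⟩ := hρ.exists_abs_le
  have hρm := hρ.continuous.measurable
  refine integrable_prod_of_support hι (C := C * B) (R := R) (δ := δ) (by fun_prop) (fun r => ?_)
    fun r hr => ⟨hR r fun h => hr (by simp [h]), hρ.norm_le fun h => hr (by simp [h])⟩
  rw [abs_mul]
  exact mul_le_mul (hC r) (hB _) (abs_nonneg _) ((abs_nonneg _).trans (hC r))

section Doubling

variable {d : ℕ} {f : ℝ → (Fin d → ℝ)} {M L R δ : ℝ} {u₀ : (Fin d → ℝ) → ℝ}
  {u v ρ : (Fin d → ℝ) × ℝ → ℝ}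

/-- Kruzkov's doubling of variables. -/
lemma integral_doubling_le (hf : LocallyLipschitz f) (hL0 : 0 ≤ L)
    (hL : ∀ a b, |a| ≤ M → |b| ≤ M → ‖f a - f b‖ ≤ L * |a - b|) (hu₀ : MeasurableBounded M u₀)
    (hub : MeasurableBounded M u) (hvb : MeasurableBounded M v)
    (hu : IsKruzkovEntropySolution f u₀ fun x t => u (x, t))
    (hv : IsKruzkovEntropySolution f u₀ fun x t => v (x, t)) (hρ : IsForwardKernel δ ρ)
    (hR : 0 ≤ R) :
    ∫ p, ∫ q, (Prod.snd ⁻¹' Set.Ioi (0 : ℝ) ∩ {p | 0 < coneCutoff R (d * L + 1) p}).indicator 1 p *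
        |v p - u q| * ρ (q - p) ≤
      ∫ x, ∫ q, coneCutoff R (d * L + 1) (x, 0) * |u₀ x - u q| * ρ (q - (x, 0)) := by
  have hK : 1 ≤ d * L + 1 := by
    have : 0 ≤ d * L := by positivity
    linarith
  obtain ⟨Lψ, hψ⟩ := exists_lipschitzWith_coneCutoff d R (zero_le_one.trans hK)
  have hψb : ∀ p : (Fin d → ℝ) × ℝ, |coneCutoff R (d * L + 1) p| ≤ R := fun p =>
    abs_coneCutoff_le hR (zero_le_one.trans hK)
  have hψc : HasCompactSupport (coneCutoff (d := d) R (d * L + 1)) := hasCompactSupport_coneCutoff hK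
  have hψs : ∀ p : (Fin d → ℝ) × ℝ, coneCutoff R (d * L + 1) p ≠ 0 → ‖p‖ ≤ R := fun p =>
    norm_le_of_coneCutoff_ne_zero hK
  have hψ0 : ∀ p : (Fin d → ℝ) × ℝ, 0 ≤ coneCutoff R (d * L + 1) p := fun p => coneCutoff_nonneg
  have hEF : ∀ p q, DifferentiableAt ℝ (coneCutoff R (d * L + 1)) p → 0 < p.2 →
      entropyFlux f (v p) (u q) (fderiv ℝ (coneCutoff R (d * L + 1)) p) ≤
        -({p | 0 < coneCutoff R (d * L + 1) p}.indicator 1 p * |v p - u q|) := fun p q =>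
    entropyFlux_fderiv_coneCutoff_le (hL (v p) (u q) (hvb.2 p) (hub.2 q))
  set ψ := coneCutoff (d := d) R (d * L + 1) with hψdef
  clear_value ψ
  obtain ⟨Lρ, hρL⟩ := hρ.exists_lipschitzWith
  obtain ⟨Bρ, hρB⟩ := hρ.exists_abs_le
  have hρd : ∀ z, HasFDerivAt ρ (fderiv ℝ ρ z) z := fun z =>
    (hρ.contDiff.differentiable one_ne_zero z).hasFDerivAt
  have hρm := hρ.continuous.measurable
  have hψm := hψ.continuous.measurable
  have hM : 0 ≤ M := (abs_nonneg _).trans (hub.2 0)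
  set s : Set ((Fin d → ℝ) × ℝ) := Prod.snd ⁻¹' Set.Ioi 0 with hs
  have hsm : MeasurableSet s := measurable_snd measurableSet_Ioi
  let A : ((Fin d → ℝ) × ℝ) × ((Fin d → ℝ) × ℝ) → ℝ := fun r =>
    s.indicator 1 r.1 * (ψ r.1 * entropyFlux f (v r.1) (u r.2) (fderiv ℝ ρ (r.2 - r.1)))
  let B : ((Fin d → ℝ) × ℝ) × ((Fin d → ℝ) × ℝ) → ℝ := fun r =>
    s.indicator 1 r.1 * (ρ (r.2 - r.1) * entropyFlux f (v r.1) (u r.2) (fderiv ℝ ψ r.1))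
  let I : (Fin d → ℝ) × ((Fin d → ℝ) × ℝ) → ℝ := fun r =>
    ψ (r.1, 0) * |u₀ r.1 - u r.2| * ρ (r.2 - (r.1, 0))
  let J : ((Fin d → ℝ) × ℝ) × ((Fin d → ℝ) × ℝ) → ℝ := fun r =>
    (s ∩ {p | 0 < ψ p}).indicator 1 r.1 * |v r.1 - u r.2| * ρ (r.2 - r.1)
  have hi1 : ∀ (t : Set ((Fin d → ℝ) × ℝ)) p, |t.indicator (1 : (Fin d → ℝ) × ℝ → ℝ) p| ≤ 1 := fun t p => by
    by_cases hp : p ∈ t <;> simp [hp]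
  have hflux : ∀ r : ((Fin d → ℝ) × ℝ) × ((Fin d → ℝ) × ℝ), ∀ (ℓ : (Fin d → ℝ) × ℝ →L[ℝ] ℝ)
      (N : NNReal), ‖ℓ‖ ≤ N → |entropyFlux f (v r.1) (u r.2) ℓ| ≤ (1 + d * L) * (2 * M) * N :=
    fun r ℓ N hN => by
    refine (abs_entropyFlux_le (hL _ _ (hvb.2 r.1) (hub.2 r.2)) ℓ).trans ?_
    have h1 : |v r.1 - u r.2| ≤ 2 * M :=
      (abs_sub _ _).trans (by linarith [hvb.2 r.1, hub.2 r.2])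
    gcongr
  have hvm : Measurable fun r : ((Fin d → ℝ) × ℝ) × ((Fin d → ℝ) × ℝ) => v r.1 :=
    hvb.1.comp measurable_fst
  have hum : Measurable fun r : ((Fin d → ℝ) × ℝ) × ((Fin d → ℝ) × ℝ) => u r.2 :=
    hub.1.comp measurable_snd
  have hρm' : Measurable fun r : ((Fin d → ℝ) × ℝ) × ((Fin d → ℝ) × ℝ) => ρ (r.2 - r.1) :=
    hρm.comp (measurable_snd.sub measurable_fst)
  have him : Measurable fun r : ((Fin d → ℝ) × ℝ) × ((Fin d → ℝ) × ℝ) =>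
      s.indicator (1 : (Fin d → ℝ) × ℝ → ℝ) r.1 :=
    (measurable_one.indicator hsm).comp measurable_fst
  have hA : Integrable A := by
    refine integrable_prod_of_support (ι := id) (fun _ => le_rfl)
      (C := 1 * (R * ((1 + d * L) * (2 * M) * Lρ))) (R := R) (δ := δ) ?_ (fun r => ?_) fun r hr => ?_
    · exact him.mul ((hψm.comp measurable_fst).mul (hvm.entropyFlux hf.continuous hum
        ((measurable_fderiv ℝ ρ).comp (measurable_snd.sub measurable_fst))))
    · rw [abs_mul, abs_mul]
      gcongr
      · exact hi1 _ _
      · exact hψb _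
      · exact hflux r _ _ (norm_fderiv_le_of_lipschitz ℝ hρL)
    · refine ⟨hψs _ fun h => hr (by simp [A, h]), hρ.norm_le fun h => hr ?_⟩
      simp only [A, id] at h ⊢
      rw [hρ.fderiv_eq_zero h, entropyFlux_zero]
      simp
  have hB : Integrable B := by
    refine integrable_prod_of_support (ι := id) (fun _ => le_rfl)
      (C := 1 * (Bρ * ((1 + d * L) * (2 * M) * Lψ))) (R := R) (δ := δ) ?_ (fun r => ?_) fun r hr => ?_
    · exact him.mul (hρm'.mul (hvm.entropyFlux hf.continuous hum
        ((measurable_fderiv ℝ ψ).comp measurable_fst)))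
    · rw [abs_mul, abs_mul]
      gcongr
      · exact hi1 _ _
      · exact (abs_nonneg _).trans (hρB 0)
      · exact hρB _
      · exact hflux r _ _ (norm_fderiv_le_of_lipschitz ℝ hψ)
    · refine ⟨hψs _ fun h => hr ?_, hρ.norm_le fun h => hr (by simp only [id] at h; simp [B, h])⟩
      have h1 : IsLocalMin ψ r.1 := Filter.Eventually.of_forall fun q => h.trans_le (hψ0 q)
      simp [B, h1.fderiv_eq_zero, entropyFlux_zero]
  have hI : Integrable I := by
    refine hρ.integrable_mul_comp_sub (ι := fun x => (x, 0)) (fun x => by simp [Prod.norm_def])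
      (by fun_prop) (C := R * (2 * M)) (R := R) ?_ (fun r => ?_) fun r hr => ?_
    · have h1 := hu₀.1
      have h2 := hub.1
      fun_prop
    · have h1 : |u₀ r.1 - u r.2| ≤ 2 * M :=
        (abs_sub _ _).trans (by linarith [hu₀.2 r.1, hub.2 r.2])
      rw [abs_mul, abs_abs]
      gcongr
      exact hψb _
    · exact (norm_fst_le ((r.1, 0) : (Fin d → ℝ) × ℝ)).trans (hψs _ fun h => hr (by simp [h]))
  have hJ : Integrable J := by
    refine hρ.integrable_mul_comp_sub (ι := id) (fun _ => le_rfl) measurable_id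
      (C := 1 * (2 * M)) (R := R) ?_ (fun r => ?_) fun r hr => hψs _ fun h => hr (by simp [h])
    · exact ((measurable_one.indicator (hsm.inter (measurableSet_lt measurable_const hψm))).comp
        measurable_fst).mul (continuous_abs.measurable.comp (hvm.sub hum))
    · have h1 : |v r.1 - u r.2| ≤ 2 * M :=
        (abs_sub _ _).trans (by linarith [hvb.2 r.1, hub.2 r.2])
      rw [abs_mul, abs_abs]
      gcongr
      exact hi1 _ _
  have hfd : ∀ᵐ p : (Fin d → ℝ) × ℝ, DifferentiableAt ℝ ψ p := hψ.ae_differentiableAt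
  have hvq : ∀ q, 0 ≤ (∫ p, (B (p, q) - A (p, q))) + ∫ x, I (x, q) := fun q => by
    have hφ : LipschitzWith Lρ fun p => ρ (q - p) := LipschitzWith.of_dist_le_mul fun p p' => by
      have := hρL.dist_le_mul (q - p) (q - p')
      rwa [dist_sub_left] at this
    obtain ⟨N, hN⟩ := exists_lipschitzWith_mul hψ hφ hψb fun p => hρB (q - p)
    have h1 := hv.integral_indicator_nonneg hf hvb (u q) hN hψc.mul_right
      fun p => mul_nonneg (hψ0 p) (hρ.nonneg _)
    rw [← hs] at h1
    refine h1.trans_eq (congrArg₂ (· + ·) (integral_congr_ae ?_) ?_)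
    · filter_upwards [hfd] with p hp
      have h2 : HasFDerivAt (fun p => ρ (q - p)) (-fderiv ℝ ρ (q - p)) p := by
        have := (hρd (q - p)).comp p ((hasFDerivAt_id p).const_sub q)
        rwa [ContinuousLinearMap.comp_neg, ContinuousLinearMap.comp_id] at this
      have h3 : fderiv ℝ (fun p => ψ p * ρ (q - p)) p =
          ρ (q - p) • fderiv ℝ ψ p + (-ψ p) • fderiv ℝ ρ (q - p) := by
        refine (hp.hasFDerivAt.mul h2).fderiv.trans ?_
        refine ContinuousLinearMap.ext fun w => ?_
        simp only [add_apply, smul_apply, neg_apply, smul_eq_mul]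
        ring
      by_cases hps : p ∈ s
      · simp only [A, B, Set.indicator_of_mem hps, Pi.one_apply, h3, entropyFlux_add,
          entropyFlux_smul]
        ring
      · simp [A, B, Set.indicator_of_notMem hps]
    · simp only [I]
      congr 1
      ext x
      ring
  have hup : ∀ p, 0 ≤ ∫ q, A (p, q) := fun p => by
    by_cases hps : p ∈ s
    · have hφ : LipschitzWith Lρ fun q => ρ (q - p) := LipschitzWith.of_dist_le_mul fun q q' => by
        have := hρL.dist_le_mul (q - p) (q' - p)
        rwa [dist_sub_right] at this
      have hN : LipschitzWith (R.toNNReal * Lρ) fun q => ψ p * ρ (q - p) :=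
        LipschitzWith.of_dist_le_mul fun q q' => by
          have h1 := hφ.dist_le_mul q q'
          rw [Real.dist_eq] at h1 ⊢
          rw [← mul_sub, abs_mul, NNReal.coe_mul, Real.coe_toNNReal _ hR, mul_assoc]
          exact mul_le_mul (hψb p) h1 (abs_nonneg _) hR
      have hc : HasCompactSupport fun q => ψ p * ρ (q - p) :=
        (hρ.hasCompactSupport.comp_homeomorph (Homeomorph.subRight p)).mul_left
      have h1 := hu.integral_indicator_nonneg hf hub (v p) hN hc
        fun q => mul_nonneg (hψ0 p) (hρ.nonneg _)
      have h0 : ∀ q : (Fin d → ℝ) × ℝ, q.2 ≤ 0 → ρ (q - p) = 0 := fun q hq => by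
        by_contra h
        have h2 := (hρ.support_subset _ h).1
        have h3 : 0 < p.2 := hps
        rw [Prod.snd_sub] at h2
        linarith
      have h2 : ∫ x, |u₀ x - v p| * (ψ p * ρ ((x, 0) - p)) = 0 := by
        simp [fun x => h0 (x, 0) le_rfl]
      rw [h2, add_zero, ← hs] at h1
      refine h1.trans_eq ?_
      congr 1
      ext q
      have h3 : HasFDerivAt (fun q => ρ (q - p)) (fderiv ℝ ρ (q - p)) q := by
        have := (hρd (q - p)).comp q ((hasFDerivAt_id q).sub_const p)
        rwa [ContinuousLinearMap.comp_id] at this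
      simp only [A, Set.indicator_of_mem hps, Pi.one_apply, one_mul]
      by_cases hqs : q ∈ s
      · rw [Set.indicator_of_mem hqs, (h3.const_mul (ψ p)).fderiv, entropyFlux_smul,
          entropyFlux_comm]
      · rw [Set.indicator_of_notMem hqs, hρ.fderiv_eq_zero (h0 q (not_lt.1 hqs)), entropyFlux_zero,
          mul_zero]
    · simp [A, Set.indicator_of_notMem hps]
  rw [Measure.volume_eq_prod] at hA hB hI hJ
  have hA0 : 0 ≤ ∫ r, A r ∂(volume.prod volume) := by
    rw [integral_prod _ hA]
    exact integral_nonneg hup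
  have hBI : 0 ≤ (∫ r, B r ∂(volume.prod volume)) - (∫ r, A r ∂(volume.prod volume)) +
      ∫ r, I r ∂(volume.prod volume) := by
    have hBA : Integrable (fun r => B r - A r) (volume.prod volume) := hB.sub hA
    rw [← integral_sub hB hA, integral_prod_symm _ hBA, integral_prod_symm _ hI,
      ← integral_add hBA.integral_prod_right hI.integral_prod_right]
    exact integral_nonneg hvq
  have hBJ : ∫ r, B r ∂(volume.prod volume) ≤ ∫ r, -J r ∂(volume.prod volume) := by
    refine integral_mono_ae hB hJ.neg ?_
    filter_upwards [Measure.quasiMeasurePreserving_fst.ae hfd] with r hr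
    by_cases hrs : r.1 ∈ s
    · have h1 := mul_le_mul_of_nonneg_left (hEF r.1 r.2 hr hrs) (hρ.nonneg (r.2 - r.1))
      have h2 : (s ∩ {p | 0 < ψ p}).indicator (1 : (Fin d → ℝ) × ℝ → ℝ) r.1 =
          {p | 0 < ψ p}.indicator 1 r.1 := by
        by_cases h : r.1 ∈ {p | 0 < ψ p}
        · rw [Set.indicator_of_mem h, Set.indicator_of_mem (show r.1 ∈ s ∩ {p | 0 < ψ p} from ⟨hrs, h⟩)]
        · rw [Set.indicator_of_notMem h, Set.indicator_of_notMem fun h' : r.1 ∈ s ∩ {p | 0 < ψ p} => h h'.2]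
      simp only [B, J, Set.indicator_of_mem hrs, Pi.one_apply, h2]
      linarith
    · simp [B, J, Set.indicator_of_notMem hrs,
        Set.indicator_of_notMem (fun h => hrs h.1 : r.1 ∉ s ∩ {p | 0 < ψ p})]
  rw [integral_neg] at hBJ
  have h1 := integral_prod _ hJ
  have h2 := integral_prod _ hI
  simp only [J] at h1
  simp only [I] at h2
  rw [← h1, ← h2]
  linarith

end Doubling

section Contraction

variable {d : ℕ} {f : ℝ → (Fin d → ℝ)} {M L R : ℝ} {u₀ : (Fin d → ℝ) → ℝ}
  {u v : (Fin d → ℝ) × ℝ → ℝ}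

lemma HasForwardModulus.exists_integral_initial_le (hu : HasForwardModulus u)
    (hub : MeasurableBounded M u) (hu0 : (fun x => u (x, 0)) =ᵐ[volume] u₀)
    {ψ : (Fin d → ℝ) → ℝ} (hψ0 : ∀ x, 0 ≤ ψ x) (hψb : ∀ x, ψ x ≤ R)
    (hψs : ∀ x, ψ x ≠ 0 → ‖x‖ ≤ R) {ε : ℝ} (hε : 0 < ε) :
    ∃ δ > 0, ∀ z : (Fin d → ℝ) × ℝ, 0 < z.2 → z.2 ≤ δ → ‖z.1‖ ≤ δ →
      ∫ x, ψ x * |u₀ x - u ((x, 0) + z)| ≤ ε := by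
  have hR : 0 ≤ R := (hψ0 0).trans (hψb 0)
  obtain ⟨C, hC, H⟩ := exists_integral_le_weightedVolume (d := d) R
  obtain ⟨δ, hδ, h⟩ := hu 0 (ε / (C * R + 1)) (by positivity)
  refine ⟨δ, hδ, fun z hz hz1 hz2 => ?_⟩
  have h1 : ∫ x, ψ x * |u₀ x - u ((x, 0) + z)| =
      ∫ x, ψ x * |u (x + z.1, 0 + z.2) - u (x, 0)| := by
    refine integral_congr_ae ?_
    filter_upwards [hu0] with x hx
    rw [← hx, abs_sub_comm]
    rfl
  have h2 := h 0 z.2 le_rfl le_rfl hz.le hz1 z.1 hz2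
  have hub1 : MeasurableBounded M fun x => u (x + z.1, 0 + z.2) := hub.comp (by fun_prop)
  have hub2 : MeasurableBounded M fun x => u (x, (0 : ℝ)) := hub.comp (by fun_prop)
  have h3 := H (F := fun x => R * |u (x + z.1, 0 + z.2) - u (x, 0)|)
    (G := fun x => ψ x * |u (x + z.1, 0 + z.2) - u (x, 0)|)
    ((hub1.measurable_abs_sub hub2).const_mul R)
    ⟨R * (2 * M), fun x => by
      rw [abs_mul, abs_abs, abs_of_nonneg hR]
      exact mul_le_mul_of_nonneg_left (hub1.abs_sub_le hub2 x) hR⟩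
    (fun x => mul_nonneg (hψ0 x) (abs_nonneg _))
    (fun x => mul_le_mul_of_nonneg_right (hψb x) (abs_nonneg _))
    (fun x hx => hψs x (left_ne_zero_of_mul hx))
  rw [integral_const_mul, ← mul_assoc] at h3
  rw [h1]
  calc _ ≤ C * R * (ε / (C * R + 1)) :=
        h3.trans (mul_le_mul_of_nonneg_left h2 (by positivity))
    _ ≤ (C * R + 1) * (ε / (C * R + 1)) := by gcongr; linarith
    _ = ε := by field_simp

lemma HasForwardModulus.exists_integral_indicator_le (hu : HasForwardModulus u)
    (hub : MeasurableBounded M u) (hR : 0 ≤ R) {s : Set ((Fin d → ℝ) × ℝ)} (hsm : MeasurableSet s)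
    (hs : ∀ p ∈ s, 0 ≤ p.2 ∧ ‖p‖ ≤ R) {ε : ℝ} (hε : 0 < ε) :
    ∃ δ > 0, ∀ z : (Fin d → ℝ) × ℝ, 0 < z.2 → z.2 ≤ δ → ‖z.1‖ ≤ δ →
      ∫ p, s.indicator 1 p * |u (p + z) - u p| ≤ ε := by
  obtain ⟨C, hC, H⟩ := exists_integral_le_weightedVolume (d := d) R
  obtain ⟨δ, hδ, h⟩ := hu R (ε / (C * R + 1)) (by positivity)
  refine ⟨δ, hδ, fun z hz hz1 hz2 => ?_⟩
  have hub1 : MeasurableBounded M fun p => u (p + z) := hub.comp (by fun_prop)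
  have hi0 : ∀ p, 0 ≤ s.indicator (1 : (Fin d → ℝ) × ℝ → ℝ) p :=
    Set.indicator_nonneg fun _ _ => zero_le_one
  have hi1 : ∀ p, s.indicator (1 : (Fin d → ℝ) × ℝ → ℝ) p ≤ 1 :=
    Set.indicator_le_self' (fun _ _ => zero_le_one)
  have hint : Integrable fun p => s.indicator (1 : (Fin d → ℝ) × ℝ → ℝ) p * |u (p + z) - u p| := by
    refine integrable_of_norm_le_of_support (C := 1 * (2 * M)) (R := R)
      ((measurable_one.indicator hsm).mul (hub1.measurable_abs_sub hub)).aestronglyMeasurable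
      (fun p => ?_) fun p hp => (hs p (Set.mem_of_indicator_ne_zero (left_ne_zero_of_mul hp))).2
    rw [Real.norm_eq_abs, abs_mul, abs_abs, abs_of_nonneg (hi0 p)]
    exact mul_le_mul (hi1 p) (hub1.abs_sub_le hub p) (abs_nonneg _) zero_le_one
  have hslice : ∀ t, ∫ x, s.indicator (1 : (Fin d → ℝ) × ℝ → ℝ) (x, t) *
      |u ((x, t) + z) - u (x, t)| ≤ (Set.Icc 0 R).indicator (fun _ => C * (ε / (C * R + 1))) t :=
    fun t => by
    by_cases ht : t ∈ Set.Icc 0 R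
    · rw [Set.indicator_of_mem ht]
      refine (H (F := fun x => |u ((x, t) + z) - u (x, t)|) ?_ ⟨2 * M, fun x => ?_⟩
        (fun x => mul_nonneg (hi0 _) (abs_nonneg _))
        (fun x => mul_le_of_le_one_left (abs_nonneg _) (hi1 _)) fun x hx => ?_).trans ?_
      · exact (hub1.measurable_abs_sub hub).comp (by fun_prop : Measurable fun x => (x, t))
      · rw [abs_abs]
        exact hub1.abs_sub_le hub _
      · exact (norm_fst_le (x, t)).trans
          (hs _ (Set.mem_of_indicator_ne_zero (left_ne_zero_of_mul hx))).2
      · exact mul_le_mul_of_nonneg_left (h t z.2 ht.1 ht.2 hz.le hz1 z.1 hz2) hC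
    · rw [Set.indicator_of_notMem ht]
      have h1 : ∀ x, (x, t) ∉ s := fun x hx => ht
        ⟨(hs _ hx).1, (le_abs_self t).trans ((norm_snd_le (x, t)).trans (hs _ hx).2)⟩
      simp [h1]
  rw [Measure.volume_eq_prod] at hint ⊢
  rw [integral_prod_symm _ hint]
  calc _ ≤ ∫ t, (Set.Icc 0 R).indicator (fun _ => C * (ε / (C * R + 1))) t :=
        integral_mono hint.integral_prod_right
          ((integrable_indicator_iff measurableSet_Icc).2
            (integrableOn_const measure_Icc_lt_top.ne)) hslice
    _ = C * R * (ε / (C * R + 1)) := by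
        rw [integral_indicator measurableSet_Icc, setIntegral_const, measureReal_def,
          Real.volume_Icc, sub_zero, ENNReal.toReal_ofReal hR, smul_eq_mul]
        ring
    _ ≤ (C * R + 1) * (ε / (C * R + 1)) := by gcongr; linarith
    _ = ε := by field_simp

lemma integral_indicator_abs_sub_le_add {δ : ℝ} {ρ : (Fin d → ℝ) × ℝ → ℝ}
    (hρ : IsForwardKernel δ ρ) (hub : MeasurableBounded M u) (hvb : MeasurableBounded M v)
    {s : Set ((Fin d → ℝ) × ℝ)} (hsm : MeasurableSet s) (hs : ∀ p ∈ s, ‖p‖ ≤ R) :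
    ∫ p, s.indicator 1 p * |v p - u p| ≤ (∫ p, ∫ q, s.indicator 1 p * |v p - u q| * ρ (q - p)) +
      ∫ p, ∫ q, s.indicator 1 p * |u q - u p| * ρ (q - p) := by
  have hi0 : ∀ p, 0 ≤ s.indicator (1 : (Fin d → ℝ) × ℝ → ℝ) p :=
    Set.indicator_nonneg fun _ _ => zero_le_one
  have hi1 : ∀ p, s.indicator (1 : (Fin d → ℝ) × ℝ → ℝ) p ≤ 1 :=
    Set.indicator_le_self' (fun _ _ => zero_le_one)
  have key : ∀ {a b : ((Fin d → ℝ) × ℝ) × ((Fin d → ℝ) × ℝ) → ℝ}, MeasurableBounded M a →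
      MeasurableBounded M b → Integrable (fun r : ((Fin d → ℝ) × ℝ) × ((Fin d → ℝ) × ℝ) =>
        s.indicator 1 r.1 * |a r - b r| * ρ (r.2 - r.1)) := fun {a b} ha hb => by
    refine hρ.integrable_mul_comp_sub (ι := id) (fun _ => le_rfl) measurable_id
      (C := 1 * (2 * M)) (R := R) ?_ (fun r => ?_)
      fun r hr => hs _ (Set.mem_of_indicator_ne_zero (left_ne_zero_of_mul hr))
    · exact ((measurable_one.indicator hsm).comp measurable_fst).mul (ha.measurable_abs_sub hb)
    · rw [abs_mul, abs_abs, abs_of_nonneg (hi0 _)]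
      exact mul_le_mul (hi1 _) (ha.abs_sub_le hb r) (abs_nonneg _) zero_le_one
  have h1 := key (hvb.comp measurable_fst) (hub.comp measurable_fst)
  have h2 := key (hvb.comp measurable_fst) (hub.comp measurable_snd)
  have h3 := key (hub.comp measurable_snd) (hub.comp measurable_fst)
  have h4 : ∫ p, s.indicator 1 p * |v p - u p| =
      ∫ p, ∫ q, s.indicator 1 p * |v p - u p| * ρ (q - p) := by
    congr 1
    ext p
    rw [integral_const_mul, integral_sub_right_eq_self, hρ.integral_eq_one, mul_one]
  rw [Measure.volume_eq_prod] at h1 h2 h3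
  have e1 := integral_prod _ h1
  have e2 := integral_prod _ h2
  have e3 := integral_prod _ h3
  rw [h4]
  refine (e1.symm.trans_le ?_).trans_eq (congrArg₂ (· + ·) e2 e3)
  rw [← integral_add h2 h3]
  refine integral_mono h1 (h2.add h3) fun r => ?_
  simp only
  rw [← add_mul, ← mul_add]
  refine mul_le_mul_of_nonneg_right (mul_le_mul_of_nonneg_left ?_ (hi0 _)) (hρ.nonneg _)
  exact _root_.abs_sub_le _ _ _

/-- Any entropy solution agrees with one that attains its initial datum uniformly. -/
theorem IsKruzkovEntropySolution.ae_eq (hf : LocallyLipschitz f) (hu₀ : MeasurableBounded M u₀)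
    (hub : MeasurableBounded M u) (hvb : MeasurableBounded M v)
    (hu : IsKruzkovEntropySolution f u₀ fun x t => u (x, t))
    (hv : IsKruzkovEntropySolution f u₀ fun x t => v (x, t))
    (hmod : HasForwardModulus u) (hu0 : (fun x => u (x, 0)) =ᵐ[volume] u₀) :
    ∀ᵐ p : (Fin d → ℝ) × ℝ, 0 < p.2 → v p = u p := by
  obtain ⟨L, hL0, hL⟩ := hf.exists_norm_sub_le M
  have hK : 1 ≤ d * L + 1 := by
    have : 0 ≤ d * L := by positivity
    linarith
  have hK0 := zero_le_one.trans hK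
  have hψm : ∀ R, Measurable (coneCutoff (d := d) R (d * L + 1)) := fun R => by
    obtain ⟨N, hN⟩ := exists_lipschitzWith_coneCutoff d R hK0
    exact hN.continuous.measurable
  have key : ∀ n : ℕ, ∀ᵐ p : (Fin d → ℝ) × ℝ,
      p ∈ Prod.snd ⁻¹' Set.Ioi (0 : ℝ) ∩ {p | 0 < coneCutoff n (d * L + 1) p} → v p = u p :=
    fun n => by
    set s := Prod.snd ⁻¹' Set.Ioi (0 : ℝ) ∩
      {p : (Fin d → ℝ) × ℝ | 0 < coneCutoff n (d * L + 1) p} with hs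
    have hsm : MeasurableSet s :=
      (measurable_snd measurableSet_Ioi).inter (measurableSet_lt measurable_const (hψm n))
    have hsR : ∀ p ∈ s, 0 ≤ p.2 ∧ ‖p‖ ≤ n := fun p hp =>
      ⟨le_of_lt hp.1, norm_le_of_coneCutoff_ne_zero hK (ne_of_gt hp.2)⟩
    have hψb : ∀ p : (Fin d → ℝ) × ℝ, coneCutoff n (d * L + 1) p ≤ n := fun p =>
      (le_abs_self _).trans (abs_coneCutoff_le n.cast_nonneg hK0)
    have hle : ∫ p, s.indicator 1 p * |v p - u p| ≤ 0 := le_of_forall_pos_le_add fun ε hε => by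
      obtain ⟨δ₁, hδ₁, h₁⟩ := hmod.exists_integral_initial_le hub hu0
        (ψ := fun x => coneCutoff n (d * L + 1) (x, 0)) (R := n) (fun _ => coneCutoff_nonneg)
        (fun _ => hψb _) (fun x hx => (norm_fst_le (x, (0 : ℝ))).trans
          (norm_le_of_coneCutoff_ne_zero hK hx)) (half_pos hε)
      obtain ⟨δ₂, hδ₂, h₂⟩ := hmod.exists_integral_indicator_le hub (Nat.cast_nonneg n) hsm hsR
        (half_pos hε)
      obtain ⟨ρ, hρ⟩ := exists_isForwardKernel d (lt_min hδ₁ hδ₂)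
      obtain ⟨B, hB⟩ := hρ.exists_abs_le
      have hρm := hρ.continuous.measurable
      have hu₀m := hu₀.1
      have hum := hub.1
      have hi1 : ∀ p, |s.indicator (1 : (Fin d → ℝ) × ℝ → ℝ) p| ≤ 1 := fun p => by
        by_cases hp : p ∈ s <;> simp [hp]
      have hsub : ∀ a b, |a| ≤ M → |b| ≤ M → |(|a - b|)| ≤ 2 * M := fun a b ha hb => by
        rw [abs_abs]
        exact (_root_.abs_sub _ _).trans (by linarith)
      have hM : 0 ≤ M := (abs_nonneg _).trans (hub.2 0)
      have hsupp : ∀ {X : Type} [NormedAddCommGroup X] {x : X} {z : (Fin d → ℝ) × ℝ}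
        {R δ : ℝ}, ‖x‖ ≤ R → ‖z‖ ≤ δ → ‖(x, z)‖ ≤ max R δ := fun h h' =>
        (Prod.norm_def _).trans_le (max_le_max h h')
      have e1 := integral_doubling_le hf hL0 hL hu₀ hub hvb hu hv hρ n.cast_nonneg
      have e2 : ∫ x, ∫ q, coneCutoff n (d * L + 1) (x, 0) * |u₀ x - u q| * ρ (q - (x, 0)) ≤
          ε / 2 := by
        refine hρ.integral_integral_mul_le (ι := fun x => (x, 0))
          (H := fun x q => coneCutoff n (d * L + 1) (x, 0) * |u₀ x - u q|) ?_ fun z hz => ?_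
        · rw [Measure.volume_eq_prod]
          have := hψm n
          refine integrable_of_norm_le_of_support (C := n * (2 * M) * B)
            (R := max n (min δ₁ δ₂)) (Measurable.aestronglyMeasurable (by fun_prop))
            (fun r => ?_) fun r hr => hsupp ((norm_fst_le (r.1, (0 : ℝ))).trans
              (norm_le_of_coneCutoff_ne_zero hK
                (left_ne_zero_of_mul (left_ne_zero_of_mul hr)))) (hρ.norm_le
                (right_ne_zero_of_mul hr))
          rw [Real.norm_eq_abs, abs_mul, abs_mul]
          gcongr
          · exact abs_coneCutoff_le n.cast_nonneg hK0
          · exact hsub _ _ (hu₀.2 _) (hub.2 _)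
          · exact hB _
        · obtain ⟨h3, h4, h5⟩ := hρ.support_subset z hz
          exact h₁ z h3 (h4.trans (min_le_left _ _)) (h5.trans (min_le_left _ _))
      have e3 : ∫ p, ∫ q, s.indicator 1 p * |u q - u p| * ρ (q - p) ≤ ε / 2 := by
        refine hρ.integral_integral_mul_le (ι := id)
          (H := fun p q => s.indicator 1 p * |u q - u p|) ?_ fun z hz => ?_
        · rw [Measure.volume_eq_prod]
          have := (measurable_one (α := ℝ)).indicator hsm
          refine integrable_of_norm_le_of_support (C := 1 * (2 * M) * B)
            (R := max n (min δ₁ δ₂)) (Measurable.aestronglyMeasurable (by fun_prop))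
            (fun r => ?_) fun r hr => hsupp (hsR _ (Set.mem_of_indicator_ne_zero
                (left_ne_zero_of_mul (left_ne_zero_of_mul hr)))).2 (hρ.norm_le
                (right_ne_zero_of_mul hr))
          rw [Real.norm_eq_abs, abs_mul, abs_mul]
          gcongr
          · exact hi1 _
          · exact hsub _ _ (hub.2 _) (hub.2 _)
          · exact hB _
        · obtain ⟨h3, h4, h5⟩ := hρ.support_subset z hz
          exact h₂ z h3 (h4.trans (min_le_right _ _)) (h5.trans (min_le_right _ _))
      have e4 := integral_indicator_abs_sub_le_add hρ hub hvb hsm fun p hp => (hsR p hp).2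
      linarith
    have hi0 : ∀ p, 0 ≤ s.indicator (1 : (Fin d → ℝ) × ℝ → ℝ) p * |v p - u p| := fun p =>
      mul_nonneg (Set.indicator_nonneg (fun _ _ => zero_le_one) p) (abs_nonneg _)
    have hint : Integrable fun p => s.indicator (1 : (Fin d → ℝ) × ℝ → ℝ) p * |v p - u p| := by
      refine integrable_of_norm_le_of_support (C := 1 * (2 * M)) (R := n)
        ((measurable_one.indicator hsm).mul (hvb.measurable_abs_sub hub)).aestronglyMeasurable
        (fun p => ?_) fun p hp => (hsR p (Set.mem_of_indicator_ne_zero (left_ne_zero_of_mul hp))).2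
      rw [Real.norm_of_nonneg (hi0 p)]
      exact mul_le_mul (Set.indicator_le_self' (fun _ _ => zero_le_one) p) (hvb.abs_sub_le hub p)
        (abs_nonneg _) zero_le_one
    filter_upwards [(integral_eq_zero_iff_of_nonneg hi0 hint).1
      (hle.antisymm (integral_nonneg hi0))] with p hp hps
    simpa [Set.indicator_of_mem hps, sub_eq_zero] using hp
  filter_upwards [ae_all_iff.2 key] with p hp hp2
  obtain ⟨n, hn⟩ := exists_nat_gt (‖p.1‖ + (d * L + 1) * |p.2|)
  have h : 0 < (n : ℝ) - ‖p.1‖ - (d * L + 1) * |p.2| := by linarith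
  exact hp n ⟨hp2, lt_max_of_lt_right (b := (0 : ℝ)) h⟩

end Contraction

lemma HasForwardModulus.tendsto_setIntegral_abs_sub {d : ℕ} {M : ℝ} {u : (Fin d → ℝ) × ℝ → ℝ}
    (hu : HasForwardModulus u) (hub : MeasurableBounded M u) {K : Set (Fin d → ℝ)}
    (hK : IsCompact K) {t : ℝ} (ht : 0 ≤ t) :
    Filter.Tendsto (fun s => ∫ x in K, |u (x, s) - u (x, t)|) (nhdsWithin t (Set.Ici 0))
      (nhds 0) := by
  obtain ⟨R, hR⟩ := hK.isBounded.exists_norm_le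
  obtain ⟨C, hC, H⟩ := exists_integral_le_weightedVolume (d := d) R
  have hub' : ∀ s, MeasurableBounded M fun x : Fin d → ℝ => u (x, s) := fun s =>
    hub.comp (by fun_prop)
  have hle : ∀ s, ∫ x in K, |u (x, s) - u (x, t)| ≤
      C * weightedDist (fun x => u (x, s)) (fun x => u (x, t)) := fun s => by
    rw [← integral_indicator hK.isClosed.measurableSet]
    refine H ((hub' s).measurable_abs_sub (hub' t)) ⟨2 * M, fun x => ?_⟩
      (Set.indicator_nonneg fun _ _ => abs_nonneg _)
      (Set.indicator_le_self' fun _ _ => abs_nonneg _)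
      fun x hx => hR x (Set.mem_of_indicator_ne_zero hx)
    rw [abs_abs]
    exact (hub' s).abs_sub_le (hub' t) x
  rw [Metric.tendsto_nhdsWithin_nhds]
  intro ε hε
  obtain ⟨δ, hδ, h⟩ := hu (t + 1) (ε / (2 * (C + 1))) (by positivity)
  refine ⟨min δ 1, lt_min hδ one_pos, fun s hs hst => ?_⟩
  rw [Real.dist_eq] at hst ⊢
  have h1 := abs_lt.1 hst
  have h2 := min_le_left δ 1
  have h3 := min_le_right δ 1
  have h4 : weightedDist (fun x => u (x, s)) (fun x => u (x, t)) ≤ ε / (2 * (C + 1)) := by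
    rcases le_total t s with hts | hts
    · simpa using h t (s - t) ht (by linarith) (by linarith) (by linarith) 0 (by simpa using hδ.le)
    · rw [weightedDist_comm]
      simpa using h s (t - s) hs (by linarith) (by linarith) (by linarith) 0 (by simpa using hδ.le)
  rw [sub_zero, abs_of_nonneg (integral_nonneg fun _ => abs_nonneg _)]
  calc _ ≤ C * (ε / (2 * (C + 1))) := (hle s).trans (mul_le_mul_of_nonneg_left h4 hC)
    _ ≤ (C + 1) * (ε / (2 * (C + 1))) := by gcongr; linarith
    _ = ε / 2 := by field_simp
    _ < ε := half_lt_self hε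

/-- **Well-posedness of the scalar initial value problem (Kruzkov).**
For `f : ℝ → ℝ^d` locally Lipschitz and `u₀ ∈ L^∞(ℝ^d)` there is a unique (up to
a.e. equality) bounded Kruzkov entropy solution `u` of `∂ₜu + ∇ₓ·f(u) = 0` with
initial data `u₀`; moreover, after modification on a null set for each time, it
belongs to `C([0,∞); L¹_loc(ℝ^d))` with `u(·,0) = u₀`. -/
theorem kruzkov_well_posedness (d : ℕ) (hd : 1 ≤ d)
    (f : ℝ → (Fin d → ℝ)) (hf : LocallyLipschitz f)
    (u₀ : (Fin d → ℝ) → ℝ) (hu₀m : Measurable u₀) (hu₀b : ∃ C : ℝ, ∀ x, |u₀ x| ≤ C) :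
    ∃ u : (Fin d → ℝ) → ℝ → ℝ,
      IsKruzkovEntropySolution f u₀ u ∧
      -- uniqueness up to a.e. equality
      (∀ v : (Fin d → ℝ) → ℝ → ℝ, IsKruzkovEntropySolution f u₀ v →
        ∀ᵐ p : (Fin d → ℝ) × ℝ ∂volume, 0 < p.2 → v p.1 p.2 = u p.1 p.2) ∧
      -- continuity in time with values in L¹_loc, after modification on null sets
      (∃ U : ℝ → (Fin d → ℝ) → ℝ,
        (∀ t ∈ Set.Ioi (0 : ℝ), (fun x => u x t) =ᵐ[volume] U t) ∧
        (U 0 =ᵐ[volume] u₀) ∧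
        (∀ K : Set (Fin d → ℝ), IsCompact K → ∀ t ∈ Set.Ici (0 : ℝ),
          Filter.Tendsto (fun s => ∫ x in K, |U s x - U t x|)
            (nhdsWithin t (Set.Ici 0)) (nhds 0))) := by
  obtain ⟨M, hM⟩ := hu₀b
  obtain ⟨u, hub, hmod, hu, hu0⟩ := exists_isKruzkovEntropySolution hd hf ⟨hu₀m, hM⟩
  refine ⟨fun x t => u (x, t), hu, fun v hv => ?_, fun t x => u (x, t), fun t _ => .rfl, hu0,
    fun K hK t ht => hmod.tendsto_setIntegral_abs_sub hub hK ht⟩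
  obtain ⟨hvm, ⟨N, hN⟩, -⟩ := id hv
  exact IsKruzkovEntropySolution.ae_eq (M := max M N) (u := u) (v := fun p => v p.1 p.2) hf
    ⟨hu₀m, fun x => (hM x).trans (le_max_left _ _)⟩
    ⟨hub.1, fun p => (hub.2 p).trans (le_max_left _ _)⟩
    ⟨hvm, fun p => (hN p.1 p.2).trans (le_max_right _ _)⟩ hu hv hmod hu0
end

section
/- (Conservation property of the TVB limiter rescaling.) Let Δ₀, Δ₁, Δ₂ ∈ ℝ and define pos = Σ_{i=0}^{2} max(0, Δ_i) and neg = Σ_{i=0}^{2} max(0, −Δ_i), and suppose Σ_{i=0}^{2} Δ_i ≠ 0 (so pos ≠ neg and both the relevant denominators below are nonzero). Set θ⁺ = min(1, neg/pos) (with θ⁺ = 1 if pos = 0), θ⁻ = min(1, pos/neg) (with θ⁻ = 1 if neg = 0), and Δ̂_i = θ⁺ max(0, Δ_i) − θ⁻ max(0, −Δ_i) for i = 0, 1, 2. Then: (i) Σ_{i=0}^{2} Δ̂_i = 0; (ii) for each i, |Δ̂_i| ≤ |Δ_i|; and (iii) for each i, Δ̂_i has the same sign as Δ_i or is zero (Δ̂_i·Δ_i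 ≥ 0). -/
/-- Rescaling `a ≥ 0` by the limiter factor `min 1 (b / a)` gives `min a b`. -/
theorem limiterFactor_mul {a b : ℝ} (ha : 0 ≤ a) (hb : 0 ≤ b) :
    (if a = 0 then 1 else min 1 (b / a)) * a = min a b := by
  split_ifs with h
  · simp [h, hb]
  · rw [min_mul_of_nonneg _ _ ha, one_mul, div_mul_cancel₀ b h]

theorem limiterFactor_mem_Icc {a b : ℝ} (ha : 0 ≤ a) (hb : 0 ≤ b) :
    (if a = 0 then 1 else min 1 (b / a)) ∈ Set.Icc (0 : ℝ) 1 := by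
  split_ifs
  · simp
  · exact ⟨le_min zero_le_one (div_nonneg hb ha), min_le_left _ _⟩

/-- Scaling the positive and negative parts of a real number by factors in `[0, 1]` does not
increase its absolute value and does not reverse its sign. -/
theorem abs_le_and_mul_nonneg_of_scaled_parts {s t : ℝ} (hs : s ∈ Set.Icc (0 : ℝ) 1)
    (ht : t ∈ Set.Icc (0 : ℝ) 1) (x : ℝ) :
    |s * max 0 x - t * max 0 (-x)| ≤ |x| ∧ 0 ≤ (s * max 0 x - t * max 0 (-x)) * x := by
  rcases le_total 0 x with hx | hx
  · rw [max_eq_right hx, max_eq_left (neg_nonpos.mpr hx), mul_zero, sub_zero, abs_mul,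
      abs_of_nonneg hs.1, mul_assoc]
    exact ⟨mul_le_of_le_one_left (abs_nonneg x) hs.2, mul_nonneg hs.1 (mul_self_nonneg x)⟩
  · rw [max_eq_left hx, max_eq_right (neg_nonneg.mpr hx), mul_zero, zero_sub, mul_neg, neg_neg,
      abs_mul, abs_of_nonneg ht.1, mul_assoc]
    exact ⟨mul_le_of_le_one_left (abs_nonneg x) ht.2, mul_nonneg ht.1 (mul_self_nonneg x)⟩

/-- **Conservation property of the TVB limiter rescaling (Cockburn–Shu).**
Given candidate slope corrections `Δ₀, Δ₁, Δ₂` with `Σ Δᵢ ≠ 0`, set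
`pos = Σ max(0, Δᵢ)`, `neg = Σ max(0, −Δᵢ)`,
`θ⁺ = min(1, neg/pos)` (`θ⁺ = 1` if `pos = 0`),
`θ⁻ = min(1, pos/neg)` (`θ⁻ = 1` if `neg = 0`), and
`Δ̂ᵢ = θ⁺ max(0, Δᵢ) − θ⁻ max(0, −Δᵢ)`.  Then (i) `Σ Δ̂ᵢ = 0`,
(ii) `|Δ̂ᵢ| ≤ |Δᵢ|` for each `i`, and (iii) `Δ̂ᵢ·Δᵢ ≥ 0` for each `i`. -/
theorem tvb_limiter_rescaling (Δ : Fin 3 → ℝ)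
    (hsum : ∑ i, Δ i ≠ 0)
    (pos neg : ℝ)
    (hpos : pos = ∑ i, max 0 (Δ i))
    (hneg : neg = ∑ i, max 0 (-Δ i))
    (θp θm : ℝ)
    (hθp : θp = if pos = 0 then 1 else min 1 (neg / pos))
    (hθm : θm = if neg = 0 then 1 else min 1 (pos / neg))
    (Δhat : Fin 3 → ℝ)
    (hΔhat : ∀ i, Δhat i = θp * max 0 (Δ i) - θm * max 0 (-Δ i)) :
    (∑ i, Δhat i = 0) ∧
    (∀ i, |Δhat i| ≤ |Δ i|) ∧
    (∀ i, 0 ≤ Δhat i * Δ i) := by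
  have hpos0 : 0 ≤ pos := hpos ▸ Finset.sum_nonneg fun i _ => le_max_left _ _
  have hneg0 : 0 ≤ neg := hneg ▸ Finset.sum_nonneg fun i _ => le_max_left _ _
  have hp : θp ∈ Set.Icc (0 : ℝ) 1 := hθp ▸ limiterFactor_mem_Icc hpos0 hneg0
  have hm : θm ∈ Set.Icc (0 : ℝ) 1 := hθm ▸ limiterFactor_mem_Icc hneg0 hpos0
  refine ⟨?_, fun i => ?_, fun i => ?_⟩
  · simp_rw [hΔhat]
    rw [Finset.sum_sub_distrib, ← Finset.mul_sum, ← Finset.mul_sum, ← hpos, ← hneg, hθp, hθm,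
      limiterFactor_mul hpos0 hneg0, limiterFactor_mul hneg0 hpos0, min_comm, sub_self]
  · rw [hΔhat]
    exact (abs_le_and_mul_nonneg_of_scaled_parts hp hm (Δ i)).1
  · rw [hΔhat]
    exact (abs_le_and_mul_nonneg_of_scaled_parts hp hm (Δ i)).2
end
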